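/- arXiv:2410.14662 — 2 statements merged into one kernel-verified Lean document; each statement's English description precedes it below -/
import Mathlib

section
/- For every real ε > 0, every integer r ≥ 2, and every prime power q, there exists a constant c ≥ 1 such that for infinitely many integers N the following holds. For each h ∈ [r] there exist parity-check matrices H_X^{(h)} ∈ F_q^{m_X × N} and H_Z^{(h)} ∈ F_q^{m_Z × N} with H_Z^{(h)} (H_X^{(h)})^⊤ = 0, each of locality at most (log N)^c, such that each quantum CSS code (ker H_X^{(h)}, ker H_Z^{(h)}) has dimension at least N^{1−ε} and distance at least N^{1/r} / (log N)^c. Moreover, there exist coefficients (a_j ∈ F_q)_{j∈[N]} and, for each h ∈ [r], a subspace H'_h of the quotient ker H_Z^{(h)} / im((H_X^{(h)})^⊤) such that the r-linear form ζ : (F_q^N)^r → F_q defined by ζ(z^{(1)},…,z^{(r)}) = Σ_{j=1}^N a_j · z^{(1)}_j ⋯ z^{(r)}_j is coboundary-invariant on H' = (H'_h)_{h∈[r]} (with B_h = im((H_X^{(h)})^⊤) and Z_h = ker H_Z^{(h)}), and the induced form ζ_{H'} has subrank at least N^{1−ε}. -/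
open scoped BigOperators
open Matrix

/-- The Hamming weight of a vector: the number of nonzero coordinates. -/
noncomputable def hwt {ι F : Type} [Zero F] (x : ι → F) : ℕ := Nat.card {i | x i ≠ 0}

/-- `M` has locality at most `w`: every row and every column of `M` has at most `w`
nonzero entries. -/
def locLE {α β F : Type} [Zero F] (M : Matrix α β F) (w : ℝ) : Prop :=
  (∀ i, (Nat.card {j | M i j ≠ 0} : ℝ) ≤ w) ∧ (∀ j, (Nat.card {i | M i j ≠ 0} : ℝ) ≤ w)

/-- The dual code with respect to the standard bilinear form `x ⬝ y = ∑ i, x i * y i`. -/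
def dualCode (F : Type) [Field F] {ι : Type} [Fintype ι] (C : Submodule F (ι → F)) :
    Submodule F (ι → F) where
  carrier := {x | ∀ y ∈ C, ∑ i, x i * y i = 0}
  add_mem' := by
    intro a b ha hb y hy
    simp only [Set.mem_setOf_eq, Pi.add_apply, add_mul, Finset.sum_add_distrib,
      ha y hy, hb y hy, add_zero]
  zero_mem' := by intro y hy; simp
  smul_mem' := by
    intro c a ha y hy
    simp only [Set.mem_setOf_eq, Pi.smul_apply, smul_eq_mul, mul_assoc]
    rw [← Finset.mul_sum, ha y hy, mul_zero]

section Packaging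

variable {F : Type} [Field F]

/-- Integer version of locality. -/
def locN {α β : Type} (M : Matrix α β F) (w : ℕ) : Prop :=
  (∀ i, Nat.card {j | M i j ≠ 0} ≤ w) ∧ (∀ j, Nat.card {i | M i j ≠ 0} ≤ w)

/-- The data of `r` CSS codes on a common index type together with a diagonal form. -/
def Sys (r : ℕ) (F : Type) [Field F] (ι : Type) [Fintype ι] (RX RZ J : Type) [Fintype RX]
    [Fintype RZ] [DecidableEq J] (w d : ℕ) : Prop :=
  ∃ (HX : Fin r → Matrix RX ι F) (HZ : Fin r → Matrix RZ ι F),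
    (∀ h, HZ h * (HX h)ᵀ = 0) ∧
    (∀ h, locN (HX h) w ∧ locN (HZ h) w) ∧
    (∀ h (x z : ι → F), HX h *ᵥ x = 0 → HZ h *ᵥ z = 0 → x ⬝ᵥ z ≠ 0 → d ≤ hwt x ∧ d ≤ hwt z) ∧
    ∃ (a : ι → F) (v : Fin r → J → ι → F),
      (∀ h j, HZ h *ᵥ v h j = 0) ∧
      (∀ (h : Fin r) (z : Fin r → ι → F) (f : RX → F), (∀ h', h' ≠ h → HZ h' *ᵥ z h' = 0) →
        z h = (HX h)ᵀ *ᵥ f → ∑ j, a j * ∏ h, z h j = 0) ∧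
      (∀ jj : Fin r → J, ∑ j, a j * ∏ h, v h (jj h) j = if ∀ h h', jj h = jj h' then 1 else 0)

lemma hwt_reindex {ι κ : Type} (e : ι ≃ κ) (x : κ → F) : hwt (x ∘ e) = hwt x := by
  unfold hwt
  exact Nat.card_congr (e.subtypeEquiv (by intro a; simp))

lemma locN_reindex {α β α' β' : Type} (e : α' ≃ α) (e' : β' ≃ β) (M : Matrix α β F) (w : ℕ)
    (h : locN M w) : locN (M.submatrix e e') w := by
  constructor
  · intro i
    have := h.1 (e i)
    refine le_trans (le_of_eq ?_) this
    exact Nat.card_congr (e'.subtypeEquiv (by intro a; simp))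
  · intro j
    have := h.2 (e' j)
    refine le_trans (le_of_eq ?_) this
    exact Nat.card_congr (e.subtypeEquiv (by intro a; simp))

lemma Sys.reindex {r : ℕ} {ι RX RZ J : Type} [Fintype ι] [Fintype RX]
    [Fintype RZ] [DecidableEq J] {w d : ℕ} {ι' RX' RZ' J' : Type} [Fintype ι'] [Fintype RX']
    [Fintype RZ'] [DecidableEq J'] (eι : ι' ≃ ι) (eX : RX' ≃ RX) (eZ : RZ' ≃ RZ) (eJ : J' ≃ J)
    (H : Sys r F ι RX RZ J w d) : Sys r F ι' RX' RZ' J' w d := by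
  obtain ⟨HX, HZ, h1, h2, h3, a, v, h4, h5, h6⟩ := H
  have key : ∀ {R R' : Type} (e : R' ≃ R) (M : Matrix R ι F) (x : ι' → F),
      (M.submatrix e eι) *ᵥ x = (M *ᵥ (x ∘ eι.symm)) ∘ e := by
    intro R R' e M x
    exact Matrix.submatrix_mulVec_equiv M x e eι
  have key0 : ∀ {R R' : Type} (e : R' ≃ R) (M : Matrix R ι F) (x : ι' → F),
      (M.submatrix e eι) *ᵥ x = 0 → M *ᵥ (x ∘ eι.symm) = 0 := by
    intro R R' e M x hx
    rw [key] at hx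
    funext i
    have := congrFun hx (e.symm i)
    simpa using this
  refine ⟨fun h => (HX h).submatrix eX eι, fun h => (HZ h).submatrix eZ eι, ?_, ?_, ?_,
    a ∘ eι, fun h j => v h (eJ j) ∘ eι, ?_, ?_, ?_⟩
  · intro h
    rw [Matrix.transpose_submatrix, Matrix.submatrix_mul_equiv, h1]
    simp
  · intro h
    exact ⟨locN_reindex _ _ _ _ (h2 h).1, locN_reindex _ _ _ _ (h2 h).2⟩
  · intro h x z hx hz hxz
    have := h3 h _ _ (key0 _ _ _ hx) (key0 _ _ _ hz) (by
      have : (x ∘ eι.symm) ⬝ᵥ (z ∘ eι.symm) = x ⬝ᵥ z :=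
        Fintype.sum_equiv eι.symm _ _ (fun _ => rfl)
      rw [this]; exact hxz)
    rwa [hwt_reindex, hwt_reindex] at this
  · intro h j
    rw [key]
    have : (v h (eJ j) ∘ eι) ∘ eι.symm = v h (eJ j) := by funext i; simp
    rw [this, h4]
    rfl
  · intro h z f hz hf
    have := h5 h (fun h => z h ∘ eι.symm) (f ∘ eX.symm) (fun h' hh => key0 _ _ _ (hz h' hh)) (by
      funext i
      simp only [Function.comp, hf]
      simp only [Matrix.mulVec, dotProduct, Matrix.transpose_apply, Matrix.submatrix_apply,
        Equiv.apply_symm_apply]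
      exact Fintype.sum_equiv eX _ _ (by simp))
    rw [← this]
    exact Fintype.sum_equiv eι _ _ (by simp)
  · intro jj
    have := h6 (fun h => eJ (jj h))
    simp only [EmbeddingLike.apply_eq_iff_eq] at this
    rw [← this]
    exact Fintype.sum_equiv eι _ _ (by simp)

lemma Sys.final {r : ℕ} (hr : 2 ≤ r) (hr0 : 0 < r) [Fintype F] {N mX mZ s : ℕ} {w d : ℕ}
    (H : Sys r F (Fin N) (Fin mX) (Fin mZ) (Fin s) w d) (ε : ℝ) (c : ℕ)
    (hw : (w : ℝ) ≤ Real.log N ^ c) (hd : (N : ℝ) ^ ((1 : ℝ) / r) / (Real.log N) ^ c ≤ (d : ℝ))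
    (hs : (N : ℝ) ^ ((1 : ℝ) - ε) ≤ (s : ℝ)) :
    ∃ (HX : Fin r → Matrix (Fin mX) (Fin N) F)
        (HZ : Fin r → Matrix (Fin mZ) (Fin N) F),
        (∀ h, HZ h * (HX h)ᵀ = 0) ∧
        (∀ h, locLE (HX h) ((Real.log N) ^ c) ∧ locLE (HZ h) ((Real.log N) ^ c)) ∧
        (∀ h, (N : ℝ) ^ ((1 : ℝ) - ε) ≤
          (Module.finrank F (LinearMap.ker (HZ h).mulVecLin) : ℝ) -
            (Module.finrank F (dualCode F (LinearMap.ker (HX h).mulVecLin)) : ℝ)) ∧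
        (∀ h, ∀ x : Fin N → F,
          ((x ∈ LinearMap.ker (HX h).mulVecLin ∧
              x ∉ dualCode F (LinearMap.ker (HZ h).mulVecLin)) ∨
           (x ∈ LinearMap.ker (HZ h).mulVecLin ∧
              x ∉ dualCode F (LinearMap.ker (HX h).mulVecLin))) →
          (N : ℝ) ^ ((1 : ℝ) / r) / (Real.log N) ^ c ≤ (hwt x : ℝ)) ∧
        ∃ (a : Fin N → F) (W : Fin r → Submodule F (Fin N → F)),
          (∀ h, LinearMap.range ((HX h)ᵀ.mulVecLin) ≤ W h ∧
            W h ≤ LinearMap.ker (HZ h).mulVecLin) ∧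
          (∀ z b : Fin r → (Fin N → F), (∀ h, z h ∈ W h) →
            (∀ h, b h ∈ LinearMap.range ((HX h)ᵀ.mulVecLin)) →
            (∑ j, a j * ∏ h, (z h + b h) j) = ∑ j, a j * ∏ h, z h j) ∧
          ∃ s : ℕ, (N : ℝ) ^ ((1 : ℝ) - ε) ≤ (s : ℝ) ∧
            ∃ v : Fin r → Fin s → (Fin N → F), (∀ h j, v h j ∈ W h) ∧
              ∀ jj : Fin r → Fin s,
                (∑ j, a j * ∏ h, v h (jj h) j) =
                  if ∀ h, jj h = jj ⟨0, hr0⟩ then 1 else 0 := by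
  obtain ⟨HX, HZ, h1, h2, h3, a, v, h4, h5, h6⟩ := H
  have hrange : ∀ h, LinearMap.range ((HX h)ᵀ.mulVecLin) ≤ LinearMap.ker (HZ h).mulVecLin := by
    rintro h _ ⟨f, rfl⟩
    rw [LinearMap.mem_ker, Matrix.mulVecLin_apply, Matrix.mulVecLin_apply, Matrix.mulVec_mulVec,
      h1, Matrix.zero_mulVec]
  refine ⟨HX, HZ, h1, ?_, ?_, ?_, a, fun h => LinearMap.ker (HZ h).mulVecLin,
    fun h => ⟨hrange h, le_rfl⟩, ?_, s, hs, v, ?_, ?_⟩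
  · intro h
    refine ⟨⟨fun i => ?_, fun i => ?_⟩, ⟨fun i => ?_, fun i => ?_⟩⟩ <;> refine le_trans ?_ hw <;>
      norm_cast
    · exact (h2 h).1.1 i
    · exact (h2 h).1.2 i
    · exact (h2 h).2.1 i
    · exact (h2 h).2.2 i
  · intro h
    set Z := LinearMap.ker (HZ h).mulVecLin with hZ
    set B := dualCode F (LinearMap.ker (HX h).mulVecLin) with hB
    have hBZ : B ≤ Z := by
      intro b hb
      rw [hZ, LinearMap.mem_ker, Matrix.mulVecLin_apply]
      funext i
      have := hb (HZ h i) (by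
        rw [LinearMap.mem_ker, Matrix.mulVecLin_apply]
        funext k
        have := congrFun (congrFun (h1 h) i) k
        rw [Matrix.mul_apply] at this
        simp only [Matrix.transpose_apply] at this
        simp only [Matrix.mulVec, dotProduct]
        rw [Pi.zero_apply, ← show _ = (0 : F) from this]
        exact Finset.sum_congr rfl (fun _ _ => mul_comm _ _))
      simp only [Matrix.mulVec, dotProduct]
      rw [Pi.zero_apply, ← this]
      exact Finset.sum_congr rfl (fun _ _ => mul_comm _ _)
    -- functionals
    let X : Fin s → Fin N → F := fun k j => a j * ∏ h' ∈ Finset.univ.erase h, v h' k j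
    have hsplit : ∀ (k : Fin s) (y : Fin N → F),
        ∑ j, y j * X k j = ∑ j, a j * ∏ h', (Function.update (fun h' => v h' k) h y) h' j := by
      intro k y
      refine Finset.sum_congr rfl (fun j _ => ?_)
      rw [← Finset.mul_prod_erase Finset.univ _ (Finset.mem_univ h)]
      rw [Function.update_self]
      have : ∏ x ∈ Finset.univ.erase h, Function.update (fun h' => v h' k) h y x j =
          ∏ h' ∈ Finset.univ.erase h, v h' k j := by
        refine Finset.prod_congr rfl (fun x hx => ?_)
        rw [Function.update_of_ne (Finset.ne_of_mem_erase hx)]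
      rw [this]
      simp only [X]; ring
    have hX : ∀ k, X k ∈ LinearMap.ker (HX h).mulVecLin := by
      intro k
      rw [LinearMap.mem_ker, Matrix.mulVecLin_apply]
      funext i
      have e := h5 h (Function.update (fun h' => v h' k) h ((HX h)ᵀ *ᵥ (Pi.single i 1)))
        (Pi.single i 1) (by intro h' hh; rw [Function.update_of_ne hh]; exact h4 _ _)
        (by rw [Function.update_self])
      rw [← hsplit] at e
      rw [Pi.zero_apply, ← e]
      simp [Matrix.mulVec, dotProduct, Pi.single_apply]
    have hval : ∀ k l, ∑ j, v h l j * X k j = if l = k then 1 else 0 := by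
      intro k l
      rw [hsplit]
      have := h6 (fun h' => if h' = h then l else k)
      have e2 : ∀ j, ∏ h', v h' (if h' = h then l else k) j =
          ∏ h', (Function.update (fun h' => v h' k) h (v h l)) h' j := by
        intro j
        refine Finset.prod_congr rfl (fun h' _ => ?_)
        by_cases hh : h' = h
        · subst hh; simp
        · simp [hh]
      simp only [e2] at this
      rw [this]
      congr 1
      apply propext
      constructor
      · intro H
        have : ∃ h' : Fin r, h' ≠ h := by
          have : Nontrivial (Fin r) := Fin.nontrivial_iff_two_le.2 hr
          exact exists_ne h
        obtain ⟨h', hh'⟩ := this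
        have := H h h'
        simpa [hh'] using this
      · rintro rfl; simp
    have hpair : ∀ (g : Fin s → F) k, ∑ j, (∑ l, g l • v h l) j * X k j = g k := by
      intro g k
      simp only [Finset.sum_apply, Pi.smul_apply, smul_eq_mul, Finset.sum_mul]
      rw [Finset.sum_comm]
      simp only [mul_assoc, ← Finset.mul_sum, hval]
      simp
    have hind : LinearIndependent F (v h) := by
      rw [Fintype.linearIndependent_iff]
      intro g hg k
      rw [← hpair g k, hg]; simp
    have hdisj : B ⊓ Submodule.span F (Set.range (v h)) = ⊥ := by
      rw [eq_bot_iff]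
      rintro y ⟨hy1, hy2⟩
      obtain ⟨g, rfl⟩ := (Submodule.mem_span_range_iff_exists_fun F).1 hy2
      have : g = 0 := by
        funext k
        rw [← hpair g k]
        exact hy1 _ (hX k)
      simp [this]
    have hle : B ⊔ Submodule.span F (Set.range (v h)) ≤ Z := by
      refine sup_le hBZ ?_
      rw [Submodule.span_le]
      rintro _ ⟨j, rfl⟩
      exact h4 h j
    have hf := Submodule.finrank_sup_add_finrank_inf_eq B (Submodule.span F (Set.range (v h)))
    rw [hdisj, finrank_bot, finrank_span_eq_card hind, Fintype.card_fin] at hf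
    have := Submodule.finrank_mono hle
    have h7 : Module.finrank F B + s ≤ Module.finrank F Z := by omega
    have h8 : (Module.finrank F B : ℝ) + s ≤ Module.finrank F Z := by exact_mod_cast h7
    linarith
  · intro h x hx
    refine le_trans hd ?_
    norm_cast
    rcases hx with ⟨hx, hn⟩ | ⟨hx, hn⟩
    · have : ∃ z ∈ LinearMap.ker (HZ h).mulVecLin, ∑ i, x i * z i ≠ 0 := by
        by_contra hcon
        push Not at hcon
        exact hn hcon
      obtain ⟨z, hz, hne⟩ := this
      exact (h3 h x z hx hz hne).1
    · have : ∃ z ∈ LinearMap.ker (HX h).mulVecLin, ∑ i, x i * z i ≠ 0 := by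
        by_contra hcon
        push Not at hcon
        exact hn hcon
      obtain ⟨z, hz, hne⟩ := this
      exact (h3 h z x hz hx (by rw [dotProduct_comm]; exact hne)).2
  · intro z b hz hb
    have e : ∀ j, ∏ h, (z h + b h) j = ∏ h, z h j + ∑ h, (b h j *
        ∏ h' with h' < h, (z h' j + b h' j)) * ∏ h' with h < h', z h' j := by
      intro j
      have := Finset.prod_add_ordered Finset.univ (fun h => z h j) (fun h => b h j)
      simpa using this
    simp only [e, mul_add, Finset.sum_add_distrib, Finset.mul_sum]
    rw [add_eq_left, Finset.sum_comm]
    refine Finset.sum_eq_zero (fun h _ => ?_)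
    obtain ⟨f, hf⟩ := hb h
    have := h5 h (fun h' => if h' < h then z h' + b h' else if h' = h then b h' else z h') f
      (by
        intro h' hh
        by_cases h9 : h' < h
        · simp only [h9, if_true]
          exact (LinearMap.ker (HZ h').mulVecLin).add_mem (hz h') (hrange h' (hb h'))
        · simp only [h9, hh, if_false]
          exact hz h')
      (by simp; exact hf.symm)
    rw [← this]
    refine Finset.sum_congr rfl (fun j _ => ?_)
    congr 1
    rw [← Finset.prod_filter_mul_prod_filter_not Finset.univ (fun h' => h' < h)]
    have e1 : ∏ x with ¬ x < h, (if x < h then z x + b x else if x = h then b x else z x) j =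
        b h j * ∏ x with h < x, z x j := by
      have : (Finset.univ.filter fun x => ¬ x < h) = insert h (Finset.univ.filter fun x => h < x) := by
        ext x; simp [le_iff_eq_or_lt, eq_comm]
      rw [this, Finset.prod_insert (by simp)]
      congr 1
      · simp
      · refine Finset.prod_congr rfl (fun x hx => ?_)
        simp only [Finset.mem_filter, Finset.mem_univ, true_and] at hx
        simp [hx.not_gt, hx.ne']
    rw [e1]
    have e2 : ∏ x with x < h, (if x < h then z x + b x else if x = h then b x else z x) j =
        ∏ x with x < h, (z x j + b x j) := by
      refine Finset.prod_congr rfl (fun x hx => ?_)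
      simp only [Finset.mem_filter, Finset.mem_univ, true_and] at hx
      simp [hx]
    rw [e2]; ring
  · intro h j; exact h4 h j
  · intro jj
    rw [h6]
    congr 1
    apply propext
    exact ⟨fun H h => H h _, fun H h h' => (H h).trans (H h').symm⟩

end Packaging
section Repetition

variable {F : Type} [Field F]

lemma natcard_filter {α : Type} [Fintype α] (p : α → Prop) [DecidablePred p] :
    Nat.card {j | p j} = (Finset.univ.filter p).card := by
  rw [Nat.card_eq_fintype_card, ← Fintype.card_subtype]
  rfl

open Classical in
/-- A general local multilinear form can be made diagonal by repeating coordinates. -/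
lemma Sys.repeat_coords {r : ℕ} {I T RX RZ J : Type} [Fintype I] [Fintype T] [Fintype RX]
    [Fintype RZ] [DecidableEq J] {w0 w1 d : ℕ}
    (φ : Fin r → T → I) (hφ : ∀ h i, Nat.card {t | φ h t = i} ≤ w1)
    (HX : Fin r → Matrix RX I F) (HZ : Fin r → Matrix RZ I F)
    (h1 : ∀ h, HZ h * (HX h)ᵀ = 0)
    (h2 : ∀ h, locN (HX h) w0 ∧ locN (HZ h) w0)
    (h3 : ∀ h (x z : I → F), HX h *ᵥ x = 0 → HZ h *ᵥ z = 0 → x ⬝ᵥ z ≠ 0 → d ≤ hwt x ∧ d ≤ hwt z)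
    (a : T → F) (v : Fin r → J → I → F)
    (h4 : ∀ h j, HZ h *ᵥ v h j = 0)
    (h5 : ∀ (h : Fin r) (z : Fin r → I → F) (f : RX → F), (∀ h', h' ≠ h → HZ h' *ᵥ z h' = 0) →
        z h = (HX h)ᵀ *ᵥ f → ∑ t, a t * ∏ h, z h (φ h t) = 0)
    (h6 : ∀ jj : Fin r → J, ∑ t, a t * ∏ h, v h (jj h) (φ h t) =
      if ∀ h h', jj h = jj h' then 1 else 0) :
    Sys r F (T ⊕ I) RX (RZ ⊕ T) J (w0 * (w1 + 1) + w1 + 2) d := by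
  let ψ : Fin r → T ⊕ I → I := fun h => Sum.elim (φ h) id
  let HX' : Fin r → Matrix RX (T ⊕ I) F := fun h => Matrix.of fun w j => HX h w (ψ h j)
  let HZ' : Fin r → Matrix (RZ ⊕ T) (T ⊕ I) F := fun h =>
    Matrix.fromBlocks 0 (HZ h) 1 (Matrix.of fun t i => if φ h t = i then -1 else 0)
  -- kernel of HZ'
  have hker : ∀ h (z : T ⊕ I → F), HZ' h *ᵥ z = 0 →
      HZ h *ᵥ (z ∘ Sum.inr) = 0 ∧ z = (z ∘ Sum.inr) ∘ ψ h := by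
    intro h z hz
    simp only [HZ', Matrix.fromBlocks_mulVec, Matrix.zero_mulVec, zero_add, Matrix.one_mulVec] at hz
    have e1 : HZ h *ᵥ (z ∘ Sum.inr) = 0 := by
      funext i; exact congrFun hz (Sum.inl i)
    refine ⟨e1, ?_⟩
    funext j
    rcases j with t | i
    · have := congrFun hz (Sum.inr t)
      simp [Matrix.mulVec, dotProduct] at this
      simp only [ψ, Function.comp, Sum.elim_inl]
      exact add_neg_eq_zero.1 this
    · rfl
  have hker' : ∀ h (z : I → F), HZ h *ᵥ z = 0 → HZ' h *ᵥ (z ∘ ψ h) = 0 := by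
    intro h z hz
    simp only [HZ', Matrix.fromBlocks_mulVec, Matrix.zero_mulVec, zero_add, Matrix.one_mulVec]
    funext j
    rcases j with t | i
    · have := congrFun hz t
      simpa [ψ, Function.comp_def] using this
    · simp [Matrix.mulVec, dotProduct, ψ]
  have hXT : ∀ h (f : RX → F), (HX' h)ᵀ *ᵥ f = ((HX h)ᵀ *ᵥ f) ∘ ψ h := by
    intro h f
    funext j
    simp [HX', Matrix.mulVec, dotProduct]
  -- push forward
  let push : Fin r → (T ⊕ I → F) → I → F := fun h x i => ∑ j, if ψ h j = i then x j else 0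
  have hpush : ∀ h (x : T ⊕ I → F) (y : I → F), y ⬝ᵥ push h x = (y ∘ ψ h) ⬝ᵥ x := by
    intro h x y
    simp only [push, dotProduct, Finset.mul_sum]
    rw [Finset.sum_comm]
    simp
  have hpushker : ∀ h x, HX' h *ᵥ x = 0 → HX h *ᵥ push h x = 0 := by
    intro h x hx
    funext w
    have := congrFun hx w
    change HX h w ⬝ᵥ push h x = 0
    rw [hpush]
    exact this
  have hpushwt : ∀ h x, hwt (push h x) ≤ hwt x := by
    intro h x
    unfold hwt
    rw [natcard_filter, natcard_filter]
    refine le_trans (Finset.card_le_card ?_) (Finset.card_image_le (f := ψ h))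
    intro i hi
    simp only [Finset.mem_filter, Finset.mem_univ, true_and, push] at hi
    obtain ⟨j, _, hj⟩ := Finset.exists_ne_zero_of_sum_ne_zero hi
    simp only [ne_eq, ite_eq_right_iff, Classical.not_imp] at hj
    simp only [Finset.mem_image, Finset.mem_filter, Finset.mem_univ, true_and]
    exact ⟨j, hj.2, hj.1⟩
  refine ⟨HX', HZ', ?_, ?_, ?_, Sum.elim a 0, fun h j => v h j ∘ ψ h, ?_, ?_, ?_⟩
  · intro h
    apply Matrix.toLin'.injective
    apply LinearMap.ext
    intro f
    rw [Matrix.toLin'_apply, ← Matrix.mulVec_mulVec, hXT, hker']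
    · simp
    · rw [Matrix.mulVec_mulVec, h1, Matrix.zero_mulVec]
  · intro h
    obtain ⟨⟨hx1, hx2⟩, ⟨hz1, hz2⟩⟩ := h2 h
    refine ⟨⟨fun w => ?_, fun j => ?_⟩, ⟨fun w => ?_, fun j => ?_⟩⟩
    · have hfib : ∀ i, (Finset.univ.filter fun j => ψ h j = i).card ≤ w1 + 1 := by
        intro i
        have : (Finset.univ.filter fun j => ψ h j = i) ⊆
            (Finset.univ.filter fun t => φ h t = i).image Sum.inl ∪ {Sum.inr i} := by
          intro j hj
          rcases j with t | i'
          · simpa [ψ] using hj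
          · simpa [ψ] using hj
        refine (Finset.card_le_card this).trans ((Finset.card_union_le _ _).trans ?_)
        have h9 := hφ h i
        rw [natcard_filter] at h9
        have := Finset.card_image_le (s := Finset.univ.filter fun t => φ h t = i)
          (f := (Sum.inl : T → T ⊕ I))
        rw [Finset.card_singleton]; omega
      have h8 := hx1 w
      rw [natcard_filter] at h8 ⊢
      have := Finset.card_le_mul_card_image (f := ψ h)
        (Finset.univ.filter fun j => HX' h w j ≠ 0) (w1 + 1) (by
          intro i _
          refine le_trans (Finset.card_le_card ?_) (hfib i)
          intro j hj
          simp only [Finset.mem_filter, Finset.mem_univ, true_and] at hj ⊢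
          exact hj.2)
      have h7 : ((Finset.univ.filter fun j => HX' h w j ≠ 0).image (ψ h)).card ≤ w0 := by
        refine le_trans (Finset.card_le_card ?_) h8
        intro i hi
        simp only [Finset.mem_image, Finset.mem_filter, Finset.mem_univ, true_and] at hi ⊢
        obtain ⟨j, hj, rfl⟩ := hi
        exact hj
      calc _ ≤ _ := this
        _ ≤ (w1 + 1) * w0 := Nat.mul_le_mul_left _ h7
        _ ≤ w0 * (w1 + 1) + w1 + 2 := by rw [mul_comm]; omega
    · have := hx2 (ψ h j)
      refine le_trans (le_trans (le_of_eq rfl) this) ?_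
      nlinarith [Nat.zero_le (w0 * w1)]
    · rcases w with w | t
      · have h8 := hz1 w
        rw [natcard_filter] at h8 ⊢
        have : (Finset.univ.filter fun j => HZ' h (Sum.inl w) j ≠ 0) ⊆
            (Finset.univ.filter fun i => HZ h w i ≠ 0).image Sum.inr := by
          intro j hj
          rcases j with t | i
          · simp [HZ'] at hj
          · simpa [HZ'] using hj
        have h9 := (Finset.card_le_card this).trans Finset.card_image_le
        have : w0 ≤ w0 * (w1 + 1) := Nat.le_mul_of_pos_right _ (by omega)
        omega
      · rw [natcard_filter]
        have : (Finset.univ.filter fun j => HZ' h (Sum.inr t) j ≠ 0) ⊆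
            {Sum.inl t, Sum.inr (φ h t)} := by
          intro j hj
          rcases j with t' | i
          · simp [HZ', Matrix.one_apply] at hj
            simp [hj]
          · simp [HZ'] at hj
            simp [hj]
        have h9 := (Finset.card_le_card this).trans Finset.card_le_two
        omega
    · rw [natcard_filter]
      rcases j with t | i
      · have : (Finset.univ.filter fun j => HZ' h j (Sum.inl t) ≠ 0) ⊆
            {Sum.inr t} := by
          intro j hj
          rcases j with w | t'
          · simp [HZ'] at hj
          · simp [HZ', Matrix.one_apply] at hj
            simp [hj]
        have h9 := (Finset.card_le_card this)
        simp only [Finset.card_singleton] at h9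
        omega
      · have : (Finset.univ.filter fun j => HZ' h j (Sum.inr i) ≠ 0) ⊆
            (Finset.univ.filter fun w => HZ h w i ≠ 0).image Sum.inl ∪
            (Finset.univ.filter fun t => φ h t = i).image Sum.inr := by
          intro j hj
          rcases j with w | t'
          · simpa [HZ'] using hj
          · simpa [HZ'] using hj
        have h9 := (Finset.card_le_card this).trans ((Finset.card_union_le _ _).trans
          (Nat.add_le_add Finset.card_image_le Finset.card_image_le))
        have h8 := hz2 i
        have h7 := hφ h i
        rw [natcard_filter] at h8 h7
        have : w0 ≤ w0 * (w1 + 1) := Nat.le_mul_of_pos_right _ (by omega)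
        omega
  · intro h x z hx hz hxz
    obtain ⟨hz1, hz2⟩ := hker h z hz
    have hne : push h x ⬝ᵥ (z ∘ Sum.inr) ≠ 0 := by
      rw [dotProduct_comm, hpush, ← hz2, dotProduct_comm]; exact hxz
    have := h3 h _ _ (hpushker h x hx) hz1 hne
    refine ⟨this.1.trans (hpushwt h x), this.2.trans ?_⟩
    unfold hwt
    rw [natcard_filter, natcard_filter]
    rw [← Finset.card_image_of_injective _ (Sum.inr_injective (α := T))]
    refine Finset.card_le_card ?_
    intro j hj
    simp only [Finset.mem_image, Finset.mem_filter, Finset.mem_univ, true_and] at hj ⊢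
    obtain ⟨i, hi, rfl⟩ := hj
    exact hi
  · intro h j
    exact hker' h _ (h4 h j)
  · intro h z f hz hf
    have := h5 h (fun h => z h ∘ Sum.inr) f (fun h' hh => (hker h' _ (hz h' hh)).1) (by
      rw [hf, hXT]; rfl)
    rw [Fintype.sum_sum_type]
    simp only [Sum.elim_inl, Sum.elim_inr, Pi.zero_apply, zero_mul, Finset.sum_const_zero, add_zero]
    rw [← this]
    refine Finset.sum_congr rfl (fun t _ => ?_)
    congr 1
    refine Finset.prod_congr rfl (fun h' _ => ?_)
    by_cases hh : h' = h
    · subst hh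
      rw [hf, hXT]; rfl
    · have := congrFun (hker h' _ (hz h' hh)).2 (Sum.inl t)
      exact this
  · intro jj
    rw [Fintype.sum_sum_type, ← h6 jj]
    simp [ψ]

end Repetition
section ProductCode

section App

variable {m U R : Type} [DecidableEq m] [Fintype U] [DecidableEq U] [CommRing R]

/-- Apply a matrix in the coordinate `i` of a function of several variables. -/
def app (i : m) (M : Matrix U U R) (z : (m → U) → R) : (m → U) → R :=
  fun u => ∑ v, M (u i) v * z (Function.update u i v)

lemma app_comm {i j : m} (hij : i ≠ j) (M N : Matrix U U R) (z : (m → U) → R) :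
    app i M (app j N z) = app j N (app i M z) := by
  funext u
  simp only [app, Finset.mul_sum]
  rw [Finset.sum_comm]
  refine Finset.sum_congr rfl (fun v _ => Finset.sum_congr rfl (fun v' _ => ?_))
  rw [Function.update_of_ne hij.symm, Function.update_of_ne hij, Function.update_comm hij]
  ring

lemma app_app (i : m) (M N : Matrix U U R) (z : (m → U) → R) :
    app i M (app i N z) = app i (M * N) z := by
  funext u
  simp only [app, Finset.mul_sum, Matrix.mul_apply, Finset.sum_mul, Function.update_self,
    Function.update_idem]
  rw [Finset.sum_comm]
  refine Finset.sum_congr rfl (fun v _ => Finset.sum_congr rfl (fun v' _ => ?_))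
  ring

lemma app_zero (i : m) (M : Matrix U U R) : app i M (0 : (m → U) → R) = 0 := by
  funext u; simp [app]

lemma app_zero_mat (i : m) (z : (m → U) → R) : app i (0 : Matrix U U R) z = 0 := by
  funext u; simp [app]

lemma app_one (i : m) (z : (m → U) → R) : app i (1 : Matrix U U R) z = z := by
  funext u; simp [app, Matrix.one_apply]

lemma app_add (i : m) (M : Matrix U U R) (z z' : (m → U) → R) :
    app i M (z + z') = app i M z + app i M z' := by
  funext u; simp [app, mul_add, Finset.sum_add_distrib]

lemma app_smul (i : m) (M : Matrix U U R) (c : R) (z : (m → U) → R) :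
    app i M (c • z) = c • app i M z := by
  funext u; simp only [app, Pi.smul_apply, smul_eq_mul, Finset.mul_sum]
  refine Finset.sum_congr rfl (fun v _ => ?_); ring

lemma app_sub_mat (i : m) (M N : Matrix U U R) (z : (m → U) → R) :
    app i (M - N) z = app i M z - app i N z := by
  funext u; simp [app, sub_mul, Finset.sum_sub_distrib]

lemma app_ne_zero {i : m} {M : Matrix U U R} {z : (m → U) → R} {u : m → U}
    (h : app i M z u ≠ 0) : ∃ v, M (u i) v ≠ 0 ∧ z (Function.update u i v) ≠ 0 := by
  obtain ⟨v, _, hv⟩ := Finset.exists_ne_zero_of_sum_ne_zero h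
  exact ⟨v, left_ne_zero_of_mul hv, right_ne_zero_of_mul hv⟩

lemma app_adjoint [Fintype m] (i : m) (M : Matrix U U R) (x z : (m → U) → R) :
    ∑ u, x u * app i M z u = ∑ u, app i Mᵀ x u * z u := by
  simp only [app, Finset.mul_sum, Finset.sum_mul]
  rw [← Finset.univ.sum_product' Finset.univ (fun u v => x u * (M (u i) v * z (Function.update u i v)))]
  rw [← Finset.univ.sum_product' Finset.univ
    (fun u v => Mᵀ (u i) v * x (Function.update u i v) * z u)]
  refine Finset.sum_nbij' (fun p => (Function.update p.1 i p.2, p.1 i))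
    (fun p => (Function.update p.1 i p.2, p.1 i)) ?_ ?_ ?_ ?_ ?_
  · simp
  · simp
  · intro p _; simp
  · intro p _; simp
  · intro p _
    simp only [Function.update_self, Function.update_idem, Function.update_eq_self,
      Matrix.transpose_apply]
    ring

lemma app_tensor [Fintype m] (i : m) (M : Matrix U U R) (Y : m → U → R) (u : m → U) :
    app i M (fun u => ∏ k, Y k (u k)) u = (M *ᵥ Y i) (u i) * ∏ k ∈ Finset.univ.erase i, Y k (u k) := by
  simp only [app, Matrix.mulVec, dotProduct, Finset.sum_mul]
  refine Finset.sum_congr rfl (fun v _ => ?_)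
  rw [← Finset.mul_prod_erase Finset.univ _ (Finset.mem_univ i), Function.update_self, mul_assoc]
  congr 2
  refine Finset.prod_congr rfl (fun k hk => ?_)
  rw [Function.update_of_ne (Finset.ne_of_mem_erase hk)]

lemma app_prod {n : Type} [DecidableEq n] [Fintype n] (h : n) (i : m) (M : Matrix U U R)
    (Y : n → (m → U) → R) (u : n × m → U) :
    app (h, i) M (fun u => ∏ h', Y h' (fun i => u (h', i))) u =
      ∏ h', (Function.update Y h (app i M (Y h))) h' (fun i => u (h', i)) := by
  rw [← Finset.mul_prod_erase Finset.univ _ (Finset.mem_univ h), Function.update_self]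
  simp only [app, Finset.sum_mul]
  refine Finset.sum_congr rfl (fun v _ => ?_)
  rw [← Finset.mul_prod_erase Finset.univ _ (Finset.mem_univ h), mul_assoc]
  congr 2
  · congr 1
    funext k
    by_cases hk : k = i
    · subst hk; simp
    · rw [Function.update_of_ne hk, Function.update_of_ne (by simp [hk])]
  · refine Finset.prod_congr rfl (fun k hk => ?_)
    have hk := Finset.ne_of_mem_erase hk
    rw [Function.update_of_ne hk]
    congr 1
    funext l
    rw [Function.update_of_ne (by simp [hk])]

end App

/-- Data attached to a single direction of the product. -/
structure Dir (r : ℕ) (F : Type) [Field F] (U J : Type) [Fintype U] [DecidableEq U]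
    (ν d : ℕ) where
  pP : U → Prop
  pA : U → Prop
  pD : U → Prop
  dA : Matrix U U F
  dD : Matrix U U F
  ρ : Matrix U U F
  κ : Fin r → Fin r → (Fin r → U) → F
  adj : U → U → Prop
  vC : J → U → F
  vD : J → U → F
  dA_supp : ∀ u v, dA u v ≠ 0 → pA u ∧ pP v
  dD_supp : ∀ u v, dD u v ≠ 0 → pP u ∧ pD v
  ρ_supp : ∀ u v, ρ u v ≠ 0 → pD u
  ρ_dD : ∀ u v, pD v → (ρ * dD) u v = if u = v then 1 else 0
  κ_supp : ∀ i h w, κ i h w ≠ 0 → (if i = h then pP (w h) else pA (w h)) ∧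
    ∀ h', h' ≠ h → if i = h' then pD (w h') else pP (w h')
  leib : ∀ i w, (∀ h, if i = h then pD (w h) else pP (w h)) →
    ∑ h, ∑ v, κ i h (Function.update w h v) * (if i = h then dD else dA) v (w h) = 0
  distC : ∀ f : U → F, (∀ u, f u ≠ 0 → pP u) → dA *ᵥ f = 0 → f ≠ 0 → d ≤ hwt f
  distD : ∀ f : U → F, (∀ u, f u ≠ 0 → pP u) → dDᵀ *ᵥ f = 0 → f ≠ 0 → d ≤ hwt f
  adj_refl : ∀ u, adj u u
  adj_symm : ∀ u v, adj u v → adj v u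
  adj_card : ∀ u, Nat.card {v | adj u v} ≤ ν
  dA_adj : ∀ u v, dA u v ≠ 0 → adj u v
  dD_adj : ∀ u v, dD u v ≠ 0 → adj u v
  κ_adj : ∀ i h w, κ i h w ≠ 0 → ∀ h₁ h₂, adj (w h₁) (w h₂)
  vC_supp : ∀ j u, vC j u ≠ 0 → pP u
  vD_supp : ∀ j u, vD j u ≠ 0 → pP u
  vC_ker : ∀ j, dA *ᵥ vC j = 0
  v_val : ∀ (i : Fin r) (jj : Fin r → J) (b : Fin r → U → F),
    (∀ h, b h = if h = i then vD (jj h) else vC (jj h)) →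
    (∀ h, jj h = jj i) → ∑ w, κ i i w * ∏ h, b h (w h) = 1
  v_val0 : ∀ (i : Fin r) (jj : Fin r → J) (b : Fin r → U → F),
    (∀ h, b h = if h = i then vD (jj h) else vC (jj h)) →
    (¬ ∀ h, jj h = jj i) → ∑ w, κ i i w * ∏ h, b h (w h) = 0

namespace Dir

variable {r : ℕ} {F : Type} [Field F] {U J : Type} [Fintype U] [DecidableEq U] {ν d : ℕ}
  (D : Dir r F U J ν d)

/-- The differential of code `h` in direction `i`. -/
def δ (h i : Fin r) : Matrix U U F := if i = h then D.dD else D.dA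

def g0 (h i : Fin r) (u : U) : Prop := if i = h then D.pD u else D.pP u

def g1 (h i : Fin r) (u : U) : Prop := if i = h then D.pP u else D.pA u

def valid (h i : Fin r) (u : Fin r → U) : Prop := D.g1 h i (u i) ∧ ∀ k, k ≠ i → D.g0 h k (u k)

lemma δ_supp (h i : Fin r) (u v : U) (H : D.δ h i u v ≠ 0) : D.g1 h i u ∧ D.g0 h i v := by
  unfold δ at H; unfold g1 g0
  split_ifs at H ⊢
  · exact D.dD_supp u v H
  · exact D.dA_supp u v H

lemma δ_adj (h i : Fin r) (u v : U) (H : D.δ h i u v ≠ 0) : D.adj u v := by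
  unfold δ at H
  split_ifs at H
  · exact D.dD_adj u v H
  · exact D.dA_adj u v H

/-- Closedness in degree one. -/
def closed (h : Fin r) (z : Fin r → (Fin r → U) → F) : Prop :=
  (∀ i u, ¬ D.valid h i u → z i u = 0) ∧
  ∀ i j, app i (D.δ h i) (z j) = app j (D.δ h j) (z i)

/-- The multilinear form. -/
def ζ (z : Fin r → Fin r → (Fin r → U) → F) : F :=
  ∑ σ : Equiv.Perm (Fin r), ((Equiv.Perm.sign σ : ℤ) : F) * ∑ u : Fin r × Fin r → U,
    (∏ i, D.κ i (σ⁻¹ i) (fun h => u (h, i))) * ∏ h, z h (σ h) (fun i => u (h, i))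

lemma leib' (i : Fin r) (w : Fin r → U) :
    ∑ h, ∑ v, D.κ i h (Function.update w h v) * D.δ h i v (w h) = 0 := by
  by_cases H : ∀ h, if i = h then D.pD (w h) else D.pP (w h)
  · exact D.leib i w H
  · push Not at H
    obtain ⟨h', hh'⟩ := H
    refine Finset.sum_eq_zero (fun h _ => Finset.sum_eq_zero (fun v _ => ?_))
    by_contra hne
    by_cases e : h' = h
    · subst e
      have := (D.δ_supp _ _ _ _ (right_ne_zero_of_mul hne)).2
      unfold g0 at this
      exact hh' this
    · have := (D.κ_supp _ _ _ (left_ne_zero_of_mul hne)).2 h' e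
      rw [Function.update_of_ne e] at this
      exact hh' this

lemma ζ_exact (h0 : Fin r) (z : Fin r → Fin r → (Fin r → U) → F) (f : (Fin r → U) → F)
    (hz : ∀ h, h ≠ h0 → ∀ i j, app i (D.δ h i) (z h j) = app j (D.δ h j) (z h i))
    (hf : ∀ i, z h0 i = app i (D.δ h0 i) f) : D.ζ z = 0 := by
  classical
  -- kernels
  let K : Equiv.Perm (Fin r) → Fin r → (Fin r × Fin r → U) → F := fun σ h u =>
    ∏ i, D.κ i (if i = σ h0 then h else σ⁻¹ i) (fun h => u (h, i))
  let Y : Equiv.Perm (Fin r) → Fin r → (Fin r → U) → F := fun σ =>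
    Function.update (fun h' => z h' (σ h')) h0 f
  let G : Equiv.Perm (Fin r) → Fin r → F := fun σ h => ∑ u, K σ h u *
    app (h, σ h0) (D.δ h (σ h0)) (fun u => ∏ h', Y σ h' (fun i => u (h', i))) u
  have hK : ∀ σ, ∑ h, G σ h = 0 := by
    intro σ
    simp only [G, app_adjoint]
    rw [Finset.sum_comm]
    refine Finset.sum_eq_zero (fun u _ => ?_)
    rw [← Finset.sum_mul]
    refine mul_eq_zero_of_left ?_ _
    have e : ∀ h, app (h, σ h0) (D.δ h (σ h0))ᵀ (K σ h) u =
        (∑ v, D.κ (σ h0) h (Function.update (fun h => u (h, σ h0)) h v) *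
          D.δ h (σ h0) v (u (h, σ h0))) *
        ∏ i ∈ Finset.univ.erase (σ h0), D.κ i (σ⁻¹ i) (fun h => u (h, i)) := by
      intro h
      simp only [app, Finset.sum_mul]
      refine Finset.sum_congr rfl (fun v _ => ?_)
      simp only [K]
      rw [← Finset.mul_prod_erase Finset.univ _ (Finset.mem_univ (σ h0)), if_pos rfl]
      have e1 : (fun h_1 => Function.update u (h, σ h0) v (h_1, σ h0)) =
          Function.update (fun h => u (h, σ h0)) h v := by
        funext k
        by_cases hk : k = h
        · subst hk; simp
        · rw [Function.update_of_ne hk, Function.update_of_ne (by simp [hk])]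
      have e2 : ∏ i ∈ Finset.univ.erase (σ h0), D.κ i (if i = σ h0 then h else σ⁻¹ i)
            (fun h_1 => Function.update u (h, σ h0) v (h_1, i)) =
          ∏ i ∈ Finset.univ.erase (σ h0), D.κ i (σ⁻¹ i) (fun h => u (h, i)) := by
        refine Finset.prod_congr rfl (fun i hi => ?_)
        have hi := Finset.ne_of_mem_erase hi
        rw [if_neg hi]
        congr 1
        funext k
        rw [Function.update_of_ne (by simp [hi])]
      rw [e1, e2, Matrix.transpose_apply]
      ring
    simp only [e]
    rw [← Finset.sum_mul, D.leib', zero_mul]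
  have hG0 : ∀ σ, G σ h0 = ∑ u : Fin r × Fin r → U,
      (∏ i, D.κ i (σ⁻¹ i) (fun h => u (h, i))) * ∏ h, z h (σ h) (fun i => u (h, i)) := by
    intro σ
    refine Finset.sum_congr rfl (fun u _ => ?_)
    rw [app_prod]
    congr 1
    · refine Finset.prod_congr rfl (fun i _ => ?_)
      congr 1
      split_ifs with hi
      · subst hi; simp
      · rfl
    · refine Finset.prod_congr rfl (fun h _ => ?_)
      congr 1
      by_cases hh : h = h0
      · subst hh
        simp [Y, hf]
      · simp [Y, hh]
  have hG : ∀ σ h, h ≠ h0 → G (σ * Equiv.swap h0 h) h = G σ h := by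
    intro σ h hh
    refine Finset.sum_congr rfl (fun u _ => ?_)
    rw [app_prod, app_prod]
    congr 1
    · refine Finset.prod_congr rfl (fun i _ => ?_)
      congr 1
      have e0 : (σ * Equiv.swap h0 h) h0 = σ h := by simp
      rw [e0]
      have e1 : (σ * Equiv.swap h0 h)⁻¹ i = Equiv.swap h0 h (σ⁻¹ i) := by simp
      rw [e1]
      by_cases hi : i = σ h0
      · subst hi
        simp
      · by_cases hi' : i = σ h
        · subst hi'; simp
        · rw [if_neg hi, if_neg hi', Equiv.swap_apply_of_ne_of_ne]
          · intro h9; apply hi; rw [← h9]; simp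
          · intro h9; apply hi'; rw [← h9]; simp
    · refine Finset.prod_congr rfl (fun k _ => ?_)
      congr 1
      by_cases hk : k = h
      · subst hk
        simp only [Function.update_self, Y, Function.update_of_ne hh]
        simp only [Equiv.Perm.coe_mul, Function.comp, Equiv.swap_apply_left,
          Equiv.swap_apply_right]
        exact congrFun (hz k hh _ _) _
      · rw [Function.update_of_ne hk, Function.update_of_ne hk]
        by_cases hk0 : k = h0
        · subst hk0; simp [Y]
        · simp only [Y, Function.update_of_ne hk0, Equiv.Perm.coe_mul, Function.comp]
          rw [Equiv.swap_apply_of_ne_of_ne hk0 hk]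
  have e1 : D.ζ z = - ∑ h ∈ Finset.univ.erase h0, ∑ σ : Equiv.Perm (Fin r),
      ((Equiv.Perm.sign σ : ℤ) : F) * G σ h := by
    unfold ζ
    rw [Finset.sum_comm, ← Finset.sum_neg_distrib]
    refine Finset.sum_congr rfl (fun σ _ => ?_)
    rw [← hG0, ← Finset.mul_sum, ← mul_neg]
    congr 1
    have := hK σ
    rw [← Finset.add_sum_erase _ _ (Finset.mem_univ h0)] at this
    exact eq_neg_of_add_eq_zero_left this
  rw [e1, neg_eq_zero]
  refine Finset.sum_eq_zero (fun h hh => ?_)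
  have hh := Finset.ne_of_mem_erase hh
  refine Finset.sum_involution (fun σ _ => σ * Equiv.swap h0 h) ?_ ?_ ?_ ?_
  · intro σ _
    rw [hG σ h hh, Equiv.Perm.sign_mul, Equiv.Perm.sign_swap hh.symm]
    simp
  · intro σ _ _ h9
    have : Equiv.swap h0 h = 1 := by simpa using h9
    rw [Equiv.swap_eq_one_iff] at this
    exact hh this.symm
  · simp
  · intro σ _; simp [mul_assoc]

end Dir
namespace Dir

variable {r : ℕ} {F : Type} [Field F] {U J : Type} [Fintype U] [DecidableEq U] {ν d : ℕ}
  (D : Dir r F U J ν d)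

open Classical in
/-- The coboundary map of code `h` in degree zero. -/
noncomputable def LX (h : Fin r) :
    ((Fin r → U) → F) →ₗ[F] (Fin r × (Fin r → U) → F) where
  toFun f := fun p =>
    app p.1 (D.δ h p.1) (fun w => if ∀ k, D.g0 h k (w k) then f w else 0) p.2
  map_add' f g := by
    funext p
    rw [Pi.add_apply, ← Pi.add_apply, ← app_add]
    congr 1
    funext w
    simp only [Pi.add_apply]
    split_ifs <;> simp
  map_smul' c f := by
    funext p
    rw [Pi.smul_apply, ← Pi.smul_apply, RingHom.id_apply, ← app_smul]
    congr 1
    funext w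
    simp only [Pi.smul_apply]
    split_ifs <;> simp

open Classical in
/-- The coboundary map of code `h` in degree one, with checks killing the padding. -/
noncomputable def LZ (h : Fin r) :
    (Fin r × (Fin r → U) → F) →ₗ[F]
      ((Fin r × Fin r × (Fin r → U)) ⊕ (Fin r × (Fin r → U)) → F) where
  toFun z := Sum.elim
    (fun p => app p.1 (D.δ h p.1) (fun u => z (p.2.1, u)) p.2.2
      - app p.2.1 (D.δ h p.2.1) (fun u => z (p.1, u)) p.2.2)
    (fun p => if D.valid h p.1 p.2 then 0 else z p)
  map_add' f g := by
    funext p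
    rcases p with p | p
    · simp only [Sum.elim_inl, Pi.add_apply, app, mul_add, Finset.sum_add_distrib]
      ring
    · simp only [Sum.elim_inr, Pi.add_apply]
      split_ifs <;> simp
  map_smul' c f := by
    funext p
    rcases p with p | p
    · simp only [Sum.elim_inl, Pi.smul_apply, app, smul_eq_mul, RingHom.id_apply, mul_sub,
        Finset.mul_sum]
      congr 1 <;> refine Finset.sum_congr rfl (fun v _ => ?_) <;> ring
    · simp only [Sum.elim_inr, Pi.smul_apply, RingHom.id_apply]
      split_ifs <;> simp

lemma LZ_closed (h : Fin r) (z : Fin r × (Fin r → U) → F) (H : D.LZ h z = 0) :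
    D.closed h (fun i u => z (i, u)) := by
  classical
  constructor
  · intro i u hv
    have := congrFun H (Sum.inr (i, u))
    simpa [LZ, hv] using this
  · intro i j
    funext u
    have := congrFun H (Sum.inl (i, j, u))
    simpa [LZ, sub_eq_zero] using this

lemma closed_LZ (h : Fin r) (z : Fin r × (Fin r → U) → F)
    (H : D.closed h (fun i u => z (i, u))) : D.LZ h z = 0 := by
  classical
  funext p
  rcases p with ⟨i, j, u⟩ | ⟨i, u⟩
  · have := congrFun (H.2 i j) u
    simpa [LZ, sub_eq_zero] using this
  · have := H.1 i u
    simp only [LZ, LinearMap.coe_mk, AddHom.coe_mk, Sum.elim_inr, Pi.zero_apply]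
    split_ifs with h9
    · rfl
    · exact this h9

lemma LX_eq (h : Fin r) (f : (Fin r → U) → F) (hf : ∀ u, f u ≠ 0 → ∀ k, D.g0 h k (u k))
    (i : Fin r) (u : Fin r → U) : D.LX h f (i, u) = app i (D.δ h i) f u := by
  classical
  simp only [LX, LinearMap.coe_mk, AddHom.coe_mk]
  congr 1
  funext w
  by_cases hw : f w = 0
  · simp [hw]
  · rw [if_pos (hf w hw)]

open Classical in
lemma LX_def (h : Fin r) (f : (Fin r → U) → F) : ∃ f' : (Fin r → U) → F,
    (∀ u, f' u ≠ 0 → f u ≠ 0) ∧ (∀ u, f' u ≠ 0 → ∀ k, D.g0 h k (u k)) ∧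
    ∀ i, (fun u => D.LX h f (i, u)) = app i (D.δ h i) f' := by
  refine ⟨fun w => if ∀ k, D.g0 h k (w k) then f w else 0, ?_, ?_, fun i => rfl⟩
  · intro u hu
    by_contra h9
    simp [h9] at hu
  · intro u hu
    by_contra h9
    simp [h9] at hu

lemma closed_LX (h : Fin r) (f : (Fin r → U) → F) :
    D.closed h (fun i u => D.LX h f (i, u)) := by
  obtain ⟨f', _, hf, he⟩ := D.LX_def h f
  constructor
  · intro i u hv
    have e : D.LX h f (i, u) = _ := congrFun (he i) u
    show D.LX h f (i, u) = 0
    rw [e]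
    by_contra hne
    obtain ⟨v, hv1, hv2⟩ := app_ne_zero hne
    apply hv
    refine ⟨(D.δ_supp _ _ _ _ hv1).1, fun k hk => ?_⟩
    have := hf _ hv2 k
    rwa [Function.update_of_ne hk] at this
  · intro i j
    simp only [he]
    by_cases hij : i = j
    · subst hij; rfl
    · exact app_comm hij _ _ _

lemma LZ_LX (h : Fin r) : D.LZ h ∘ₗ D.LX h = 0 := by
  refine LinearMap.ext (fun f => ?_)
  exact D.closed_LZ h _ (D.closed_LX h f)

lemma dD_ρ_dD : D.dD * (D.ρ * D.dD) = D.dD := by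
  ext u v
  by_cases hv : D.pD v
  · rw [Matrix.mul_apply]
    simp [D.ρ_dD _ _ hv]
  · have h0 : ∀ w, D.dD w v = 0 := by
      intro w
      by_contra h9
      exact hv (D.dD_supp _ _ h9).2
    have h1 : ∀ w, (D.ρ * D.dD) w v = 0 := by
      intro w; simp [Matrix.mul_apply, h0]
    rw [Matrix.mul_apply]
    simp [h0, h1]

/-- Decomposition of a closed cochain. -/
lemma closed_decomp (h : Fin r) (z : Fin r → (Fin r → U) → F) (hz : D.closed h z) :
    ∃ c f : (Fin r → U) → F,
      (∀ u, f u ≠ 0 → ∀ k, D.g0 h k (u k)) ∧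
      (∀ u, c u ≠ 0 → D.pP (u h) ∧ ∀ k, k ≠ h → D.g0 h k (u k)) ∧
      (∀ u, c u ≠ 0 → ∃ v, z h (Function.update u h v) ≠ 0) ∧
      (∀ j, j ≠ h → app j D.dA c = 0) ∧
      (z h = c + app h (D.δ h h) f) ∧ (∀ j, j ≠ h → z j = app j (D.δ h j) f) := by
  have hδ : D.δ h h = D.dD := by simp [δ]
  have hδ' : ∀ j, j ≠ h → D.δ h j = D.dA := by intro j hj; simp [δ, hj]
  have hvalid : ∀ u, z h u ≠ 0 → D.valid h h u := by
    intro u hu; by_contra h9; exact hu (hz.1 _ _ h9)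
  refine ⟨app h (1 - D.dD * D.ρ) (z h), app h D.ρ (z h), ?_, ?_, ?_, ?_, ?_, ?_⟩
  · intro u hu k
    obtain ⟨v, hv1, hv2⟩ := app_ne_zero hu
    by_cases hk : k = h
    · subst hk
      simp only [g0, if_true]
      exact D.ρ_supp _ _ hv1
    · have := (hvalid _ hv2).2 k hk
      rwa [Function.update_of_ne hk] at this
  · intro u hu
    obtain ⟨v, hv1, hv2⟩ := app_ne_zero hu
    refine ⟨?_, fun k hk => ?_⟩
    · by_cases e : u h = v
      · have := (hvalid _ hv2).1
        simpa [g1, e] using this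
      · rw [Matrix.sub_apply, Matrix.one_apply_ne e, zero_sub, neg_ne_zero, Matrix.mul_apply] at hv1
        obtain ⟨t, _, ht⟩ := Finset.exists_ne_zero_of_sum_ne_zero hv1
        exact (D.dD_supp _ _ (left_ne_zero_of_mul ht)).1
    · have := (hvalid _ hv2).2 k hk
      rwa [Function.update_of_ne hk] at this
  · intro u hu
    obtain ⟨v, hv1, hv2⟩ := app_ne_zero hu
    exact ⟨v, hv2⟩
  · intro j hj
    rw [app_comm hj]
    have := hz.2 j h
    rw [hδ, hδ' j hj] at this
    rw [this, app_app, sub_mul, Matrix.one_mul, Matrix.mul_assoc, D.dD_ρ_dD, sub_self, app_zero_mat]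
  · rw [app_sub_mat, app_one, hδ, app_app]
    simp
  · intro j hj
    have h1 : z j = app h (D.ρ * D.dD) (z j) := by
      funext u
      unfold app
      rw [Finset.sum_eq_single (u h)]
      · rw [Function.update_eq_self]
        by_cases h9 : z j u = 0
        · simp [h9]
        · have : D.valid h j u := by
            by_contra h8; exact h9 (hz.1 _ _ h8)
          have := this.2 h hj.symm
          simp only [g0, if_true] at this
          rw [D.ρ_dD _ _ this]; simp
      · intro v _ hv
        by_cases h9 : z j (Function.update u h v) = 0
        · simp [h9]
        · have : D.valid h j (Function.update u h v) := by
            by_contra h8; exact h9 (hz.1 _ _ h8)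
          have := this.2 h hj.symm
          simp only [g0, if_true, Function.update_self] at this
          rw [D.ρ_dD _ _ this, if_neg hv.symm, zero_mul]
      · simp
    have h2 := hz.2 h j
    rw [hδ, hδ' j hj] at h2
    rw [h1, ← app_app, h2, app_comm hj.symm, hδ' j hj]

lemma distance (hr : 2 ≤ r) (h : Fin r) (x z : Fin r × (Fin r → U) → F)
    (hx : ∀ f, ∑ p, x p * D.LX h f p = 0) (hz : D.LZ h z = 0) (hne : ∑ p, x p * z p ≠ 0) :
    d ≤ hwt x ∧ d ≤ hwt z := by
  classical
  obtain ⟨c, f, hf, hc, hcz, hcA, hzh, hzj⟩ := D.closed_decomp h _ (D.LZ_closed h z hz)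
  have hδ : D.δ h h = D.dD := by simp [δ]
  have hδ' : ∀ j, j ≠ h → D.δ h j = D.dA := by intro j hj; simp [δ, hj]
  have hne' : ∑ u, x (h, u) * c u ≠ 0 := by
    have e : ∑ p, x p * z p = ∑ u, x (h, u) * c u + ∑ p, x p * D.LX h f p := by
      rw [Fintype.sum_prod_type, Fintype.sum_prod_type,
        ← Finset.add_sum_erase _ _ (Finset.mem_univ h),
        ← Finset.add_sum_erase Finset.univ (fun i => ∑ y, x (i, y) * D.LX h f (i, y))
          (Finset.mem_univ h), ← add_assoc, ← Finset.sum_add_distrib]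
      congr 1
      · refine Finset.sum_congr rfl (fun u _ => ?_)
        have := congrFun hzh u
        simp only [Pi.add_apply] at this
        rw [this, D.LX_eq h f hf]; ring
      · refine Finset.sum_congr rfl (fun j hj => Finset.sum_congr rfl (fun u _ => ?_))
        have : z (j, u) = _ := congrFun (hzj j (Finset.ne_of_mem_erase hj)) u
        rw [this, D.LX_eq h f hf]
    rw [e, hx f, add_zero] at hne
    exact hne
  constructor
  · -- the weight of x
    let g : U → U → F := fun p q => ∑ u, x (h, u) * app h (Matrix.single q p 1) c u
    have happ : ∀ q p u, app h (Matrix.single q p 1) c u =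
        if u h = q then c (Function.update u h p) else 0 := by
      intro q p u
      simp only [app, Matrix.single, Matrix.of_apply]
      by_cases e : u h = q
      · simp [e]
      · simp [e, Ne.symm e]
    have hsum : ∑ p, g p p ≠ 0 := by
      have : ∑ p, g p p = ∑ u, x (h, u) * c u := by
        simp only [g]
        rw [Finset.sum_comm]
        refine Finset.sum_congr rfl (fun u _ => ?_)
        rw [← Finset.mul_sum]
        simp only [happ]
        rw [Finset.sum_ite_eq]
        simp
      rw [this]; exact hne'
    obtain ⟨p, _, hp⟩ := Finset.exists_ne_zero_of_sum_ne_zero hsum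
    have hpP : D.pP p := by
      obtain ⟨u, _, hu⟩ := Finset.exists_ne_zero_of_sum_ne_zero hp
      have hu := right_ne_zero_of_mul hu
      rw [happ] at hu
      split_ifs at hu with e
      · have := (hc _ hu).1
        simpa using this
      · exact absurd rfl hu
    let g' : U → F := fun q => if D.pP q then g p q else 0
    have hg' : D.dDᵀ *ᵥ g' = 0 := by
      funext l
      have e1 : (D.dDᵀ *ᵥ g') l = ∑ q, D.dD q l * g p q := by
        simp only [Matrix.mulVec, dotProduct, Matrix.transpose_apply]
        refine Finset.sum_congr rfl (fun q _ => ?_)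
        by_cases hq : D.dD q l = 0
        · simp [hq]
        · simp only [g', if_pos (D.dD_supp _ _ hq).1]
      rw [e1, Pi.zero_apply]
      by_cases hl : D.pD l
      · have hCs : ∀ u, app h (Matrix.single l p 1) c u ≠ 0 → ∀ k, D.g0 h k (u k) := by
          intro u hu k
          rw [happ] at hu
          split_ifs at hu with e
          · by_cases hk : k = h
            · subst hk
              simpa [g0, e] using hl
            · have := (hc _ hu).2 k hk
              rwa [Function.update_of_ne hk] at this
          · exact absurd rfl hu
        have h1 := hx (app h (Matrix.single l p 1) c)
        rw [Fintype.sum_prod_type, ← Finset.add_sum_erase _ _ (Finset.mem_univ h),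
          Finset.sum_eq_zero (s := Finset.univ.erase h), add_zero] at h1
        · rw [← h1]
          simp only [g, Finset.mul_sum]
          rw [Finset.sum_comm]
          refine Finset.sum_congr rfl (fun u _ => ?_)
          rw [D.LX_eq h _ hCs, hδ]
          have e3 : app h D.dD (app h (Matrix.single l p 1) c) u
              = ∑ q, D.dD q l * app h (Matrix.single q p 1) c u := by
            simp only [happ]
            rw [Finset.sum_eq_single (u h)]
            · rw [if_pos rfl]
              unfold app
              rw [Finset.sum_eq_single l]
              · have := happ l p (Function.update u h l)
                unfold app at this
                rw [this]; simp
              · intro v _ hv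
                have := happ l p (Function.update u h v)
                unfold app at this
                rw [this, if_neg (by simpa using hv), mul_zero]
              · simp
            · intro q _ hq
              rw [if_neg hq.symm, mul_zero]
            · simp
          rw [e3, Finset.mul_sum]
          refine Finset.sum_congr rfl (fun q _ => ?_)
          ring
        · intro j hj
          have hj := Finset.ne_of_mem_erase hj
          refine Finset.sum_eq_zero (fun u _ => ?_)
          rw [D.LX_eq h _ hCs, hδ' j hj, app_comm hj, hcA j hj, app_zero]
          simp
      · refine Finset.sum_eq_zero (fun q _ => ?_)
        by_cases hq : D.dD q l = 0
        · simp [hq]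
        · exact absurd (D.dD_supp _ _ hq).2 hl
    have hd := D.distD g' (by
      intro u hu; by_contra h9; exact hu (by simp [g', h9])) hg' (by
      intro h9
      have := congrFun h9 p
      simp only [g', if_pos hpP] at this
      exact hp this)
    refine le_trans hd ?_
    have hinj : ∀ q : {q | g' q ≠ 0}, ∃ u, x (h, u) ≠ 0 ∧ u h = q.1 := by
      rintro ⟨q, hq⟩
      have hq : g' q ≠ 0 := hq
      have : g p q ≠ 0 := by
        intro h9; apply hq; simp [g', h9]
      obtain ⟨u, _, hu⟩ := Finset.exists_ne_zero_of_sum_ne_zero this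
      refine ⟨u, left_ne_zero_of_mul hu, ?_⟩
      have hu := right_ne_zero_of_mul hu
      rw [happ] at hu
      by_contra h9
      rw [if_neg h9] at hu
      exact hu rfl
    choose U1 hU1 hU2 using hinj
    refine Nat.card_le_card_of_injective (fun q => (⟨(h, U1 q), hU1 q⟩ : {i | x i ≠ 0})) ?_
    intro q q' hqq
    have : U1 q = U1 q' := by simpa using hqq
    apply Subtype.ext
    rw [← hU2 q, ← hU2 q', this]
  · -- the weight of z
    obtain ⟨u0, _, hu0⟩ := Finset.exists_ne_zero_of_sum_ne_zero hne'
    have hu0 := right_ne_zero_of_mul hu0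
    obtain ⟨j, hj⟩ : ∃ j : Fin r, j ≠ h := by
      by_cases h0 : h = ⟨0, by omega⟩
      · exact ⟨⟨1, by omega⟩, by rw [h0]; simp [Fin.ext_iff]⟩
      · exact ⟨_, Ne.symm h0⟩
    have hd := D.distC (fun t => c (Function.update u0 j t)) (by
        intro t ht
        have := (hc _ ht).2 j hj
        simpa [g0, hj] using this) (by
        funext s
        have := congrFun (hcA j hj) (Function.update u0 j s)
        simpa [app, Matrix.mulVec, dotProduct] using this) (by
        intro h9
        have := congrFun h9 (u0 j)
        simp only [Function.update_eq_self] at this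
        exact hu0 this)
    refine le_trans hd ?_
    have hinj : ∀ t : {t | c (Function.update u0 j t) ≠ 0}, ∃ u, z (h, u) ≠ 0 ∧ u j = t.1 := by
      rintro ⟨t, ht⟩
      obtain ⟨v, hv⟩ := hcz _ ht
      refine ⟨_, hv, ?_⟩
      rw [Function.update_of_ne hj]; simp
    choose U1 hU1 hU2 using hinj
    refine Nat.card_le_card_of_injective (fun q => (⟨(h, U1 q), hU1 q⟩ : {i | z i ≠ 0})) ?_
    intro q q' hqq
    have : U1 q = U1 q' := by simpa using hqq
    apply Subtype.ext
    rw [← hU2 q, ← hU2 q', this]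

end Dir
lemma card_prod_le {A B : Type} [Finite A] [Finite B] (P : B → Prop) :
    Nat.card {p : A × B | P p.2} ≤ Nat.card A * Nat.card {b | P b} := by
  rw [← Nat.card_prod]
  refine Nat.card_le_card_of_injective
    (fun p => ((p.1.1, ⟨p.1.2, p.2⟩) : A × {b | P b})) ?_
  rintro ⟨⟨a, b⟩, h⟩ ⟨⟨a', b'⟩, h'⟩ e
  simpa using e

lemma card_mono {A : Type} [Finite A] {P Q : A → Prop} (h : ∀ a, P a → Q a) :
    Nat.card {a | P a} ≤ Nat.card {a | Q a} := by
  refine Nat.card_le_card_of_injective (fun a => (⟨a.1, h _ a.2⟩ : {a | Q a})) ?_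
  intro a b e
  simpa [Subtype.ext_iff] using e

lemma card_sum_eq {A B : Type} [Finite A] [Finite B] (P : A ⊕ B → Prop) :
    Nat.card {a | P a} = Nat.card {a | P (Sum.inl a)} + Nat.card {a | P (Sum.inr a)} := by
  rw [← Nat.card_sum]
  exact Nat.card_congr Equiv.subtypeSum

lemma card_le_one' {A : Type} [Finite A] {P : A → Prop} (a : A) (h : ∀ b, P b → b = a) :
    Nat.card {b | P b} ≤ 1 := by
  rw [Finite.card_le_one_iff_subsingleton]
  refine ⟨fun x y => Subtype.ext ?_⟩
  rw [h _ x.2, h _ y.2]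

namespace Dir

variable {r : ℕ} {F : Type} [Field F] {U J : Type} [Fintype U] [DecidableEq U] {ν d : ℕ}
  (D : Dir r F U J ν d)

lemma card_adj {m : Type} [Fintype m] (w : m → U) :
    Nat.card {u : m → U | ∀ k, D.adj (w k) (u k)} ≤ ν ^ Fintype.card m := by
  have e : Nat.card {u : m → U | ∀ k, D.adj (w k) (u k)} =
      Nat.card ((k : m) → {v | D.adj (w k) v}) := by
    refine Nat.card_congr ⟨fun u k => ⟨u.1 k, u.2 k⟩, fun u => ⟨fun k => (u k).1, fun k => (u k).2⟩,
      ?_, ?_⟩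
    · intro u; rfl
    · intro u; rfl
  rw [e, Nat.card_pi]
  refine le_trans (Finset.prod_le_prod' (fun k _ => D.adj_card (w k))) ?_
  simp

/-- X-checks. -/
noncomputable def HX (h : Fin r) : Matrix (Fin r → U) (Fin r × (Fin r → U)) F :=
  (LinearMap.toMatrix' (D.LX h))ᵀ

/-- Z-checks. -/
noncomputable def HZ (h : Fin r) :
    Matrix ((Fin r × Fin r × (Fin r → U)) ⊕ (Fin r × (Fin r → U))) (Fin r × (Fin r → U)) F :=
  LinearMap.toMatrix' (D.LZ h)

lemma HX_adj (h : Fin r) (w : Fin r → U) (p : Fin r × (Fin r → U)) (H : D.HX h w p ≠ 0) :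
    ∀ k, D.adj (p.2 k) (w k) := by
  obtain ⟨i, u⟩ := p
  rw [HX, Matrix.transpose_apply, LinearMap.toMatrix'_apply] at H
  obtain ⟨f', hf1, hf2, hf3⟩ := D.LX_def h (Pi.single w 1)
  have e : D.LX h (Pi.single w 1) (i, u) = _ := congrFun (hf3 i) u
  have H : D.LX h (Pi.single w 1) (i, u) ≠ 0 := by
    convert H using 3
  rw [e] at H
  obtain ⟨v, hv1, hv2⟩ := app_ne_zero H
  have hv2 := hf1 _ hv2
  have hw : Function.update u i v = w := by
    by_contra h9; exact hv2 (Pi.single_eq_of_ne h9 _)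
  intro k
  rw [← hw]
  by_cases hk : k = i
  · subst hk; simpa using D.δ_adj _ _ _ _ hv1
  · simpa [Function.update_of_ne hk] using D.adj_refl _

lemma app_single_adj (h i j l : Fin r) (u w : Fin r → U)
    (H : app i (D.δ h i) (fun u => (Pi.single (l, w) 1 : Fin r × (Fin r → U) → F) (j, u)) u ≠ 0) :
    ∀ k, D.adj (u k) (w k) := by
  obtain ⟨v, hv1, hv2⟩ := app_ne_zero H
  have hw : (j, Function.update u i v) = (l, w) := by
    by_contra h9; exact hv2 (Pi.single_eq_of_ne h9 _)
  have hw : Function.update u i v = w := (Prod.mk.inj hw).2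
  intro k
  rw [← hw]
  by_cases hk : k = i
  · subst hk; simpa using D.δ_adj _ _ _ _ hv1
  · simpa [Function.update_of_ne hk] using D.adj_refl _

lemma HZ_adj_inl (h : Fin r) (i j : Fin r) (u : Fin r → U) (p : Fin r × (Fin r → U))
    (H : D.HZ h (Sum.inl (i, j, u)) p ≠ 0) :
    ∀ k, D.adj (u k) (p.2 k) := by
  obtain ⟨l, w⟩ := p
  rw [HZ, LinearMap.toMatrix'_apply] at H
  have H : D.LZ h (Pi.single (l, w) 1) (Sum.inl (i, j, u)) ≠ 0 := by
    convert H using 3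
  simp only [LZ, LinearMap.coe_mk, AddHom.coe_mk, Sum.elim_inl] at H
  by_cases h1 : app i (D.δ h i)
      (fun u => (Pi.single (l, w) 1 : Fin r × (Fin r → U) → F) (j, u)) u = 0
  · rw [h1, zero_sub, neg_ne_zero] at H
    exact D.app_single_adj _ _ _ _ _ _ H
  · exact D.app_single_adj _ _ _ _ _ _ h1

lemma HZ_inr (h : Fin r) (p p' : Fin r × (Fin r → U))
    (H : D.HZ h (Sum.inr p') p ≠ 0) : p' = p := by
  rw [HZ, LinearMap.toMatrix'_apply] at H
  have H : D.LZ h (Pi.single p 1) (Sum.inr p') ≠ 0 := by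
    convert H using 3
  simp only [LZ, LinearMap.coe_mk, AddHom.coe_mk, Sum.elim_inr] at H
  by_contra h9
  rw [Pi.single_eq_of_ne h9] at H
  simp at H

lemma loc_HX (hr : 2 ≤ r) (h : Fin r) : locN (D.HX h) (r * r * ν ^ r + 1) := by
  have hrr : r ≤ r * r := by nlinarith
  have h1 : ν ^ r ≤ r * r * ν ^ r := Nat.le_mul_of_pos_left _ (by nlinarith)
  have hc : ∀ w : Fin r → U, Nat.card {u : Fin r → U | ∀ k, D.adj (w k) (u k)} ≤ ν ^ r := by
    intro w; simpa using D.card_adj w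
  constructor
  · intro w
    have := card_prod_le (A := Fin r) (fun u : Fin r → U => ∀ k, D.adj (w k) (u k))
    have h2 := card_mono (P := fun p => D.HX h w p ≠ 0)
      (Q := fun p : Fin r × (Fin r → U) => ∀ k, D.adj (w k) (p.2 k))
      (fun p hp k => D.adj_symm _ _ (D.HX_adj h w p hp k))
    have h3 := Nat.mul_le_mul_left r (hc w)
    have h4 := Nat.mul_le_mul_right (ν ^ r) hrr
    simp only [Nat.card_fin] at this
    omega
  · intro p
    have h2 := card_mono (P := fun w => D.HX h w p ≠ 0)
      (Q := fun w : (Fin r → U) => ∀ k, D.adj (p.2 k) (w k))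
      (fun w hp k => (D.HX_adj h w p hp k))
    have := hc p.2
    omega

lemma loc_HZ (hr : 2 ≤ r) (h : Fin r) : locN (D.HZ h) (r * r * ν ^ r + 1) := by
  have hrr : r ≤ r * r := by nlinarith
  have hc : ∀ w : Fin r → U, Nat.card {u : Fin r → U | ∀ k, D.adj (w k) (u k)} ≤ ν ^ r := by
    intro w; simpa using D.card_adj w
  constructor
  · rintro (⟨i, j, u⟩ | p')
    · have := card_prod_le (A := Fin r) (fun w : Fin r → U => ∀ k, D.adj (u k) (w k))
      have h2 := card_mono (P := fun p => D.HZ h (Sum.inl (i, j, u)) p ≠ 0)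
        (Q := fun p : Fin r × (Fin r → U) => ∀ k, D.adj (u k) (p.2 k))
        (fun p hp k => (D.HZ_adj_inl h i j u p hp k))
      have h3 := Nat.mul_le_mul_left r (hc u)
      have h4 := Nat.mul_le_mul_right (ν ^ r) hrr
      simp only [Nat.card_fin] at this
      omega
    · refine le_trans (card_le_one' p' ?_) (by omega)
      intro b hb
      exact (D.HZ_inr h _ _ hb).symm
  · intro p
    rw [card_sum_eq]
    refine Nat.add_le_add ?_ ?_
    · have h2 := card_mono (P := fun q => D.HZ h (Sum.inl q) p ≠ 0)
        (Q := fun q : Fin r × Fin r × (Fin r → U) => ∀ k, D.adj (p.2 k) (q.2.2 k))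
        (fun q hp k => D.adj_symm _ _ (D.HZ_adj_inl h q.1 q.2.1 q.2.2 p hp k))
      refine le_trans h2 ?_
      refine le_trans (card_prod_le (A := Fin r)
        (fun q : Fin r × (Fin r → U) => ∀ k, D.adj (p.2 k) (q.2 k))) ?_
      have := card_prod_le (A := Fin r) (fun w : Fin r → U => ∀ k, D.adj (p.2 k) (w k))
      rw [mul_assoc]
      simp only [Nat.card_fin] at this ⊢
      exact Nat.mul_le_mul_left _ (le_trans this (Nat.mul_le_mul_left _ (hc _)))
    · refine card_le_one' p ?_
      intro b hb
      exact D.HZ_inr h _ _ hb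

open Classical in
/-- Logical representatives. -/
noncomputable def vv (h : Fin r) (j : Fin r → J) (p : Fin r × (Fin r → U)) : F :=
  if p.1 = h then ∏ k, (if k = h then D.vD (j k) else D.vC (j k)) (p.2 k) else 0

lemma vv_closed (h : Fin r) (j : Fin r → J) : D.LZ h (D.vv h j) = 0 := by
  classical
  apply D.closed_LZ
  have hcase : ∀ i l, i ≠ h → l = h →
      app i (D.δ h i) (fun u => D.vv h j (l, u)) = app l (D.δ h l) (fun u => D.vv h j (i, u)) := by
    intro i l hi hl
    subst hl
    have e1 : (fun u => D.vv l j (l, u)) =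
        (fun u => ∏ k, (if k = l then D.vD (j k) else D.vC (j k)) (u k)) := by
      funext u; simp [vv]
    have e2 : (fun u => D.vv l j (i, u)) = 0 := by
      funext u; simp [vv, hi]
    rw [e1, e2, app_zero]
    funext u
    rw [app_tensor]
    have : D.δ l i *ᵥ (if i = l then D.vD (j i) else D.vC (j i)) = 0 := by
      simp only [δ, if_neg hi]
      exact D.vC_ker _
    rw [this]; simp
  constructor
  · intro i u hv
    by_contra hne
    apply hv
    simp only [vv] at hne
    split_ifs at hne with hi
    · subst hi
      have hne := Finset.prod_ne_zero_iff.mp hne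
      refine ⟨?_, fun k hk => ?_⟩
      · have := hne i (Finset.mem_univ _)
        simp only [if_true] at this
        simpa [g1] using D.vD_supp _ _ this
      · have := hne k (Finset.mem_univ _)
        simp only [if_neg hk] at this
        simpa [g0, hk] using D.vC_supp _ _ this
    · exact absurd rfl hne
  · intro i l
    by_cases hi : i = h
    · by_cases hl : l = h
      · rw [hi, hl]
      · exact (hcase l i hl hi).symm
    · by_cases hl : l = h
      · exact hcase i l hi hl
      · have e2 : ∀ i, i ≠ h → (fun u => D.vv h j (i, u)) = 0 := by
          intro i hi; funext u; simp [vv, hi]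
        simp only [e2 i hi, e2 l hl, app_zero]

lemma ζ_vv (jj : Fin r → Fin r → J) :
    D.ζ (fun h i u => D.vv h (jj h) (i, u)) =
      open Classical in if ∀ h h', jj h = jj h' then 1 else 0 := by
  classical
  unfold ζ
  rw [Finset.sum_eq_single 1]
  · rw [Equiv.Perm.sign_one]
    simp only [Units.val_one, Int.cast_one, one_mul, inv_one, Equiv.Perm.one_apply]
    let Y : Fin r → Fin r → U → F := fun i h => if h = i then D.vD (jj h i) else D.vC (jj h i)
    have e1 : ∀ u : Fin r × Fin r → U,
        (∏ i, D.κ i i (fun h => u (h, i))) * ∏ h, D.vv h (jj h) (h, fun i => u (h, i)) =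
        ∏ i, (D.κ i i (fun h => u (h, i)) * ∏ h, Y i h (u (h, i))) := by
      intro u
      rw [Finset.prod_mul_distrib]
      congr 1
      rw [Finset.prod_comm]
      refine Finset.prod_congr rfl (fun h _ => ?_)
      simp only [vv, if_true]
      refine Finset.prod_congr rfl (fun i _ => ?_)
      simp only [Y]
      by_cases e : i = h
      · subst e; simp
      · simp [e, Ne.symm e]
    have e2 : ∑ u : Fin r × Fin r → U, ∏ i, (D.κ i i (fun h => u (h, i)) * ∏ h, Y i h (u (h, i)))
        = ∏ i, ∑ w : Fin r → U, D.κ i i w * ∏ h, Y i h (w h) := by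
      rw [Finset.prod_univ_sum, Fintype.piFinset_univ]
      refine Finset.sum_nbij' (fun u i h => u (h, i)) (fun p q => p q.2 q.1) ?_ ?_ ?_ ?_ ?_
      · simp
      · simp
      · intro u _; rfl
      · intro u _; rfl
      · intro u _; rfl
    rw [Finset.sum_congr rfl (fun u _ => e1 u), e2]
    split_ifs with H
    · refine Finset.prod_eq_one (fun i _ => ?_)
      exact D.v_val i (fun h => jj h i) (Y i) (fun h => rfl) (fun h => by
        show jj h i = jj i i
        rw [H h i])
    · have : ∃ i, ¬ ∀ h, jj h i = jj i i := by
        by_contra! h9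
        apply H
        intro h h'
        funext i
        rw [h9 i h, h9 i h']
      obtain ⟨i, hi⟩ := this
      refine Finset.prod_eq_zero (Finset.mem_univ i) ?_
      exact D.v_val0 i (fun h => jj h i) (Y i) (fun h => rfl) hi
  · intro σ _ hσ
    have : ∃ h, σ h ≠ h := by
      by_contra! h9; apply hσ; ext h; simp [h9]
    obtain ⟨h, hh⟩ := this
    refine mul_eq_zero_of_right _ (Finset.sum_eq_zero (fun u _ => ?_))
    refine mul_eq_zero_of_right _ (Finset.prod_eq_zero (Finset.mem_univ h) ?_)
    simp [vv, hh]
  · simp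

lemma HX_mulVec (h : Fin r) (f : (Fin r → U) → F) : (D.HX h)ᵀ *ᵥ f = D.LX h f := by
  rw [HX, Matrix.transpose_transpose, LinearMap.toMatrix'_mulVec]

lemma HZ_mulVec (h : Fin r) (z : Fin r × (Fin r → U) → F) : (D.HZ h) *ᵥ z = D.LZ h z := by
  rw [HZ, LinearMap.toMatrix'_mulVec]

open Classical in
theorem toSys (D : Dir r F U J ν d) (hr : 2 ≤ r) [DecidableEq J] (w0 w1 : ℕ) (hw0 : w0 = r * r * ν ^ r + 1)
    (hw1 : w1 = r.factorial * ν ^ (r * r)) :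
    ∃ (T : Type) (_ : Fintype T), Fintype.card T ≤ w1 * Fintype.card (Fin r × (Fin r → U)) ∧
      Sys r F (T ⊕ (Fin r × (Fin r → U))) (Fin r → U)
        (((Fin r × Fin r × (Fin r → U)) ⊕ (Fin r × (Fin r → U))) ⊕ T) (Fin r → J)
        (w0 * (w1 + 1) + w1 + 2) d := by
  let P : Equiv.Perm (Fin r) × (Fin r × Fin r → U) → Prop :=
    fun t => ∏ i, D.κ i (t.1⁻¹ i) (fun h => t.2 (h, i)) ≠ 0
  let T := {t : Equiv.Perm (Fin r) × (Fin r × Fin r → U) // P t}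
  let φ : Fin r → T → Fin r × (Fin r → U) := fun h t => (t.1.1 h, fun i => t.1.2 (h, i))
  let a : T → F := fun t => ((Equiv.Perm.sign t.1.1 : ℤ) : F) *
    ∏ i, D.κ i (t.1.1⁻¹ i) (fun h => t.1.2 (h, i))
  have hφ : ∀ h i, Nat.card {t | φ h t = i} ≤ w1 := by
    intro h p
    have h1 : Nat.card {t | φ h t = p} ≤
        Nat.card {t : Equiv.Perm (Fin r) × (Fin r × Fin r → U) | ∀ k, D.adj (p.2 k.2) (t.2 k)} := by
      refine Nat.card_le_card_of_injective (fun t => ⟨t.1.1, ?_⟩) ?_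
      · rintro ⟨h', i⟩
        have ht : φ h t.1 = p := t.2
        have hP : P t.1.1 := t.1.2
        have := (Finset.prod_ne_zero_iff.mp hP) i (Finset.mem_univ _)
        have := D.κ_adj _ _ _ this h h'
        have e : p.2 i = t.1.1.2 (h, i) := (congrFun (congrArg Prod.snd ht) i).symm
        simpa [e] using this
      · intro t t' e
        apply Subtype.ext; apply Subtype.ext
        simpa using e
    refine le_trans h1 (le_trans (card_prod_le
      (fun u : Fin r × Fin r → U => ∀ k, D.adj (p.2 k.2) (u k))) ?_)
    rw [hw1]
    refine Nat.mul_le_mul ?_ ?_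
    · rw [Nat.card_eq_fintype_card, Fintype.card_perm, Fintype.card_fin]
    · simpa using D.card_adj (fun k : Fin r × Fin r => p.2 k.2)
  have hform : ∀ z : Fin r → Fin r × (Fin r → U) → F, ∑ t, a t * ∏ h, z h (φ h t) =
      D.ζ (fun h i u => z h (i, u)) := by
    intro z
    let G : Equiv.Perm (Fin r) × (Fin r × Fin r → U) → F := fun t =>
      (((Equiv.Perm.sign t.1 : ℤ) : F) * ∏ i, D.κ i (t.1⁻¹ i) (fun h => t.2 (h, i))) *
        ∏ h, z h (t.1 h, fun i => t.2 (h, i))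
    have e1 : ∑ t, a t * ∏ h, z h (φ h t) = ∑ t : T, G t.1 := rfl
    have e2 : ∑ t : T, G t.1 = ∑ t ∈ Finset.univ.filter P, G t :=
      (Finset.sum_subtype (Finset.univ.filter P) (by simp) G).symm
    rw [e1, e2, Finset.sum_filter_of_ne, Fintype.sum_prod_type]
    · unfold ζ
      refine Finset.sum_congr rfl (fun σ _ => ?_)
      rw [Finset.mul_sum]
      refine Finset.sum_congr rfl (fun u _ => ?_)
      simp only [G]
      ring
    · intro t _ ht
      exact right_ne_zero_of_mul (left_ne_zero_of_mul ht)
  refine ⟨T, inferInstance, ?_, ?_⟩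
  · have := Finset.card_le_mul_card_image_of_maps_to (s := (Finset.univ : Finset T))
      (t := (Finset.univ : Finset (Fin r × (Fin r → U)))) (f := φ ⟨0, by omega⟩)
      (fun _ _ => Finset.mem_univ _) w1 (by
        intro b _
        have := hφ ⟨0, by omega⟩ b
        rwa [natcard_filter] at this)
    simpa using this
  · refine Sys.repeat_coords φ hφ (fun h => D.HX h) (fun h => D.HZ h) ?_ ?_ ?_ a
      (fun h j => D.vv h j) ?_ ?_ ?_
    · intro h
      rw [HX, HZ, Matrix.transpose_transpose, ← LinearMap.toMatrix'_comp, D.LZ_LX]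
      simp
    · intro h
      rw [hw0]
      exact ⟨D.loc_HX hr h, D.loc_HZ hr h⟩
    · intro h x z hx hz hxz
      refine D.distance hr h x z ?_ ?_ hxz
      · intro f
        have : x ⬝ᵥ ((D.HX h)ᵀ *ᵥ f) = 0 := by
          rw [Matrix.dotProduct_mulVec, Matrix.vecMul_transpose, hx, zero_dotProduct]
        rw [HX_mulVec] at this
        exact this
      · rw [← HZ_mulVec]; exact hz
    · intro h j
      rw [HZ_mulVec]; exact D.vv_closed h j
    · intro h z f hz hf
      rw [hform]
      obtain ⟨f', _, _, hf'⟩ := D.LX_def h f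
      refine D.ζ_exact h _ f' ?_ ?_
      · intro h' hh'
        have := hz h' hh'
        rw [HZ_mulVec] at this
        exact (D.LZ_closed h' _ this).2
      · intro i
        rw [← hf', hf, HX_mulVec]
    · intro jj
      rw [hform, D.ζ_vv]
      congr

end Dir

end ProductCode
section Descend

open Classical in
/-- Restriction of scalars of a system from `K` to `F`. -/
lemma Sys.descend {r : ℕ} {F K : Type} [Field F] [Field K] [Algebra F K] {e : ℕ}
    (b : Module.Basis (Fin e) F K) {ι RX RZ J : Type} [Fintype ι] [Fintype RX]
    [Fintype RZ] [DecidableEq J] {w d : ℕ} (H : Sys r K ι RX RZ J w d) :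
    Sys r F ((ι × (Fin r → Fin e)) ⊕ (ι × Fin e)) (RX × Fin e)
      ((RZ × Fin e) ⊕ (ι × (Fin r → Fin e))) J
      (w * e * (e ^ r + 1) + e ^ r + 2) d := by
  obtain ⟨HX, HZ, h1, h2, h3, a, v, h4, h5, h6⟩ := H
  haveI : Module.Finite F K := Module.Finite.of_basis b
  -- a functional with value one at one
  obtain ⟨lam, hlam⟩ : ∃ lam : K →ₗ[F] F, lam 1 = 1 := by
    obtain ⟨g, hg⟩ := LinearMap.exists_leftInverse_of_injective (Algebra.linearMap F K)
      (LinearMap.ker_eq_bot.mpr (FaithfulSMul.algebraMap_injective F K))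
    refine ⟨g, ?_⟩
    have := LinearMap.congr_fun hg 1
    simpa using this
  -- duality
  have hdual : ∀ ψ : K →ₗ[F] F, ∃ y : K, ∀ t, lam (y * t) = ψ t := by
    let Φ : K →ₗ[F] (K →ₗ[F] F) := (LinearMap.llcomp F K K F lam).comp (LinearMap.mul F K)
    have hinj : Function.Injective Φ := by
      rw [← LinearMap.ker_eq_bot, LinearMap.ker_eq_bot']
      intro y hy
      by_contra h9
      have := LinearMap.congr_fun hy (y⁻¹)
      simp [Φ, h9, hlam] at this
    have hfin : Module.finrank F K = Module.finrank F (K →ₗ[F] F) := by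
      rw [Module.finrank_linearMap]; simp
    have hsurj := (LinearMap.injective_iff_surjective_of_finrank_eq_finrank hfin).mp hinj
    intro ψ
    obtain ⟨y, hy⟩ := hsurj ψ
    refine ⟨y, fun t => ?_⟩
    rw [← hy]; simp [Φ]
  -- expansion
  let up : (α : Type) → (α × Fin e → F) → α → K := fun α z j => ∑ c, z (j, c) • b c
  let lM : K → Fin e → Fin e → F := fun y c c' => b.repr (y * b c') c
  have hlM : ∀ (y : K) (f : Fin e → F) c, ∑ c', lM y c c' * f c' = b.repr (y * ∑ c', f c' • b c') c := by
    intro y f c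
    rw [Finset.mul_sum, map_sum, Finsupp.finset_sum_apply]
    refine Finset.sum_congr rfl (fun c' _ => ?_)
    rw [mul_smul_comm, map_smul, Finsupp.smul_apply, smul_eq_mul, mul_comm]
  have hlM0 : ∀ y c c', lM y c c' ≠ 0 → y ≠ 0 := by
    intro y c c' h9 h8; apply h9; simp [lM, h8]
  let HXF : Fin r → Matrix (RX × Fin e) (ι × Fin e) F := fun h p q => lM (HX h p.1 q.1) q.2 p.2
  let HZF : Fin r → Matrix (RZ × Fin e) (ι × Fin e) F := fun h p q => lM (HZ h p.1 q.1) p.2 q.2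
  have hZ : ∀ h (z : ι × Fin e → F) ρ c, (HZF h *ᵥ z) (ρ, c) = b.repr ((HZ h *ᵥ up ι z) ρ) c := by
    intro h z ρ c
    simp only [Matrix.mulVec, dotProduct, HZF, Fintype.sum_prod_type]
    rw [map_sum, Finsupp.finset_sum_apply]
    refine Finset.sum_congr rfl (fun j _ => ?_)
    rw [hlM]
  have hZ0 : ∀ h (z : ι × Fin e → F), HZF h *ᵥ z = 0 ↔ HZ h *ᵥ up ι z = 0 := by
    intro h z
    constructor
    · intro H
      funext ρ
      apply b.repr.injective
      ext c
      rw [← hZ, H]; simp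
    · intro H
      funext ⟨ρ, c⟩
      rw [hZ, H]; simp
  have hXT : ∀ h (f : RX × Fin e → F), up ι ((HXF h)ᵀ *ᵥ f) = (HX h)ᵀ *ᵥ up RX f := by
    intro h f
    funext j
    have e1 : ∀ c, ((HXF h)ᵀ *ᵥ f) (j, c) = b.repr (((HX h)ᵀ *ᵥ up RX f) j) c := by
      intro c
      simp only [Matrix.mulVec, dotProduct, Fintype.sum_prod_type, Matrix.transpose_apply]
      rw [map_sum, Finsupp.finset_sum_apply]
      refine Finset.sum_congr rfl (fun ρ _ => ?_)
      exact hlM (HX h ρ j) (fun c' => f (ρ, c')) c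
    simp only [up, e1]
    exact b.sum_repr _
  have hup : ∀ (x : ι → K), up ι (fun p => b.repr (x p.1) p.2) = x := by
    intro x; funext j; simp only [up]; exact b.sum_repr _
  have hwt_up : ∀ (z : ι × Fin e → F) (y : ι → K), (∀ j, y j ≠ 0 → ∃ c, z (j, c) ≠ 0) →
      hwt y ≤ hwt z := by
    intro z y hy
    have hy : ∀ j : {j | y j ≠ 0}, ∃ c, z (j.1, c) ≠ 0 := fun j => hy j.1 j.2
    choose c hc using hy
    refine Nat.card_le_card_of_injective
      (fun j : {j | y j ≠ 0} => (⟨(j.1, c j), hc j⟩ : {p | z p ≠ 0})) ?_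
    intro j j' hjj
    have := congrArg (fun p => p.1.1) hjj
    exact Subtype.ext this
  have hloc : ∀ {R : Type} [Fintype R] (M : Matrix R ι K) (M' : Matrix (R × Fin e) (ι × Fin e) F),
      (∀ p q, M' p q ≠ 0 → M p.1 q.1 ≠ 0) → locN M w → locN M' (w * e) := by
    intro R _ M M' hM hl
    constructor
    · intro p
      rw [mul_comm]
      refine le_trans ?_ (Nat.mul_le_mul_left e (hl.1 p.1))
      have := card_prod_le (A := Fin e) (fun j => M p.1 j ≠ 0)
      rw [Nat.card_fin] at this
      refine le_trans ?_ this
      refine Nat.card_le_card_of_injective (fun q => ⟨(q.1.2, q.1.1), hM _ _ q.2⟩) ?_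
      rintro ⟨⟨x, y⟩, _⟩ ⟨⟨x', y'⟩, _⟩ h
      simp at h ⊢; tauto
    · intro p
      rw [mul_comm]
      refine le_trans ?_ (Nat.mul_le_mul_left e (hl.2 p.1))
      have := card_prod_le (A := Fin e) (fun j => M j p.1 ≠ 0)
      rw [Nat.card_fin] at this
      refine le_trans ?_ this
      refine Nat.card_le_card_of_injective (fun q => ⟨(q.1.2, q.1.1), hM _ _ q.2⟩) ?_
      rintro ⟨⟨x, y⟩, _⟩ ⟨⟨x', y'⟩, _⟩ h
      simp at h ⊢; tauto
  have hform : ∀ z : Fin r → ι × Fin e → F,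
      ∑ t : ι × (Fin r → Fin e), lam (a t.1 * ∏ h, b (t.2 h)) * ∏ h, z h (t.1, t.2 h) =
        lam (∑ j, a j * ∏ h, up ι (z h) j) := by
    intro z
    rw [Fintype.sum_prod_type, map_sum]
    refine Finset.sum_congr rfl (fun j _ => ?_)
    simp only [up]
    rw [Finset.prod_univ_sum, Fintype.piFinset_univ, Finset.mul_sum, map_sum]
    refine Finset.sum_congr rfl (fun β _ => ?_)
    rw [Finset.prod_smul, mul_smul_comm, map_smul, smul_eq_mul, mul_comm]
  refine Sys.repeat_coords (φ := fun h t => (t.1, t.2 h)) ?_ HXF HZF ?_ ?_ ?_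
    (fun t => lam (a t.1 * ∏ h, b (t.2 h))) (fun h j p => b.repr (v h j p.1) p.2) ?_ ?_ ?_
  · rintro h ⟨j, c⟩
    have : Nat.card (Fin r → Fin e) = e ^ r := by simp
    rw [← this]
    refine Nat.card_le_card_of_injective (fun t => t.1.2) ?_
    rintro ⟨⟨x, y⟩, h1⟩ ⟨⟨x', y'⟩, h2⟩ h
    simp at h h1 h2
    simp [h, h1.1, h2.1]
  · intro h
    have : ∀ f : RX × Fin e → F, HZF h *ᵥ ((HXF h)ᵀ *ᵥ f) = 0 := by
      intro f
      rw [hZ0, hXT, Matrix.mulVec_mulVec, h1, Matrix.zero_mulVec]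
    ext i j
    have := congrFun (this (Pi.single j 1)) i
    rw [Matrix.mulVec_mulVec] at this
    simpa using this
  · intro h
    exact ⟨hloc (HX h) _ (fun p q hpq => hlM0 _ _ _ hpq) (h2 h).1,
      hloc (HZ h) _ (fun p q hpq => hlM0 _ _ _ hpq) (h2 h).2⟩
  · intro h x z hx hz hxz
    -- the dual vector
    have hex : ∀ j, ∃ y : K, ∀ f : Fin e → F, lam (y * ∑ c, f c • b c) = ∑ c, x (j, c) * f c := by
      intro j
      obtain ⟨y, hy⟩ := hdual (b.constr F (fun c => x (j, c)))
      refine ⟨y, fun f => ?_⟩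
      rw [hy, map_sum]
      refine Finset.sum_congr rfl (fun c _ => ?_)
      rw [map_smul, Module.Basis.constr_basis, smul_eq_mul, mul_comm]
    choose y hy using hex
    have hpair : ∀ z : ι × Fin e → F, x ⬝ᵥ z = lam (y ⬝ᵥ up ι z) := by
      intro z
      simp only [dotProduct, Fintype.sum_prod_type, map_sum]
      refine Finset.sum_congr rfl (fun j _ => ?_)
      rw [hy]
    have hy0 : HX h *ᵥ y = 0 := by
      funext ρ
      by_contra hne
      have key : ∀ f : RX × Fin e → F, lam (y ⬝ᵥ ((HX h)ᵀ *ᵥ up RX f)) = 0 := by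
        intro f
        rw [← hXT, ← hpair, Matrix.dotProduct_mulVec, Matrix.vecMul_transpose, hx,
          zero_dotProduct]
      have key2 := key (fun p => if p.1 = ρ then b.repr (((HX h *ᵥ y) ρ)⁻¹) p.2 else 0)
      rw [Matrix.dotProduct_mulVec, Matrix.vecMul_transpose] at key2
      have e1 : up RX (fun p => if p.1 = ρ then b.repr (((HX h *ᵥ y) ρ)⁻¹) p.2 else 0) =
          Pi.single ρ (((HX h *ᵥ y) ρ)⁻¹) := by
        funext ρ'
        simp only [up]
        by_cases hρ : ρ' = ρ
        · subst hρ
          simp only [if_true, Pi.single_eq_same]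
          exact b.sum_repr _
        · simp [hρ]
      rw [e1, dotProduct_single, mul_inv_cancel₀ hne, hlam] at key2
      exact one_ne_zero key2
    have hmain := h3 h y (up ι z) hy0 ((hZ0 h z).mp hz) (by
      intro h9; rw [hpair, h9, map_zero] at hxz; exact hxz rfl)
    refine ⟨le_trans hmain.1 (hwt_up _ _ ?_), le_trans hmain.2 (hwt_up _ _ ?_)⟩
    · intro j hj
      by_contra! h9
      have e1 := hy j (fun c => b.repr ((y j)⁻¹) c)
      rw [b.sum_repr, mul_inv_cancel₀ hj, hlam] at e1
      simp [h9] at e1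
    · intro j hj
      by_contra! h9
      apply hj
      simp [up, h9]
  · intro h j
    rw [hZ0, hup]; exact h4 h j
  · intro h z f hz hf
    rw [hform, h5 h (fun h => up ι (z h)) (up RX f), map_zero]
    · intro h' hh'
      exact (hZ0 _ _).mp (hz h' hh')
    · rw [← hXT, ← hf]
  · intro jj
    have e1 := hform (fun h p => b.repr (v h (jj h) p.1) p.2)
    simp only [hup] at e1
    refine e1.trans ?_
    rw [h6]
    split_ifs
    · exact hlam
    · simp

end Descend
section GridDir

variable {K : Type} [Field K] [Fintype K] [DecidableEq K] {m : ℕ}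

/-- Vertices: points, A-checks, D-checks. -/
abbrev GU (K : Type) (m : ℕ) : Type :=
  (Fin m → K) ⊕ ((Fin m × (Fin m → K)) ⊕ (Fin m × (Fin m → K)))

def gpos : GU K m → (Fin m → K)
  | .inl x => x
  | .inr (.inl p) => p.2
  | .inr (.inr p) => p.2

def gtag : GU K m → Unit ⊕ (Fin m ⊕ Fin m)
  | .inl _ => .inl ()
  | .inr (.inl p) => .inr (.inl p.1)
  | .inr (.inr p) => .inr (.inr p.1)

lemma gext {u v : GU K m} (h1 : gpos u = gpos v) (h2 : gtag u = gtag v) : u = v := by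
  rcases u with u | u | u <;> rcases v with v | v | v <;> simp [gpos, gtag] at h1 h2 ⊢
  · exact h1
  · exact Prod.ext h2 h1
  · exact Prod.ext h2 h1

def gadj (u v : GU K m) : Prop := ∃ a : Fin m, ∀ b, b ≠ a → gpos u b = gpos v b

lemma gadj_card (u : GU K m) :
    Nat.card {v | gadj u v} ≤ m * Fintype.card K * (2 * m + 1) := by
  have e : Nat.card ((Fin m × K) × (Unit ⊕ (Fin m ⊕ Fin m))) = m * Fintype.card K * (2 * m + 1) := by
    simp only [Nat.card_eq_fintype_card, Fintype.card_prod, Fintype.card_sum, Fintype.card_fin,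
      Fintype.card_unit]
    ring
  rw [← e]
  have hex : ∀ v : {v | gadj u v}, ∃ a : Fin m, ∀ b, b ≠ a → gpos u b = gpos v.1 b := fun v => v.2
  choose a ha using hex
  refine Nat.card_le_card_of_injective (fun v => ((a v, gpos v.1 (a v)), gtag v.1)) ?_
  intro v v' h
  simp only [Prod.mk.injEq] at h
  apply Subtype.ext
  refine gext ?_ h.2
  funext b
  by_cases hb : b = a v
  · subst hb
    rw [h.1.2, h.1.1]
  · rw [← ha v b hb, ← ha v' b (h.1.1 ▸ hb)]

/-- indicator of a point -/
def eP (y : Fin m → K) (u : GU K m) : K := if u = .inl y then 1 else 0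

/-- row of a projection -/
def eQ (Pj : Fin m → Matrix (Fin m → K) (Fin m → K) K) (a : Fin m) (y : Fin m → K) : GU K m → K
  | .inl x => Pj a y x
  | .inr _ => 0

/-- indicator of an A-check -/
def eA (a : Fin m) (y : Fin m → K) (u : GU K m) : K := if u = .inr (.inl (a, y)) then 1 else 0

open Classical in
/-- D-checks restricted to a set of rows -/
noncomputable def mD (S : Set (Fin m × (Fin m → K))) (Pj' : Fin m → Matrix (Fin m → K) (Fin m → K) K)
    (a : Fin m) (y : Fin m → K) : GU K m → K
  | .inl _ => 0
  | .inr (.inl _) => 0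
  | .inr (.inr p) => if p ∈ S ∧ p.1 = a then (1 - Pj' a) p.2 y else 0

lemma sum_eP (f : GU K m → K) (y : Fin m → K) : ∑ u, eP y u * f u = f (.inl y) := by
  rw [Finset.sum_eq_single (.inl y)]
  · simp [eP]
  · intro u _ hu; simp [eP, hu]
  · simp

lemma sum_eA (f : GU K m → K) (a : Fin m) (y : Fin m → K) :
    ∑ u, eA a y u * f u = f (.inr (.inl (a, y))) := by
  rw [Finset.sum_eq_single (.inr (.inl (a, y)))]
  · simp [eA]
  · intro u _ hu; simp [eA, hu]
  · simp

/-- A-checks -/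
def gA (Pj : Fin m → Matrix (Fin m → K) (Fin m → K) K) : Matrix (GU K m) (GU K m) K
  | .inr (.inl p), v => eP p.2 v - eQ Pj p.1 p.2 v
  | .inl _, _ => 0
  | .inr (.inr _), _ => 0

/-- D-checks, transposed -/
noncomputable def gD (S : Set (Fin m × (Fin m → K)))
    (Pj' : Fin m → Matrix (Fin m → K) (Fin m → K) K) : Matrix (GU K m) (GU K m) K
  | .inl y, v => ∑ a, mD S Pj' a y v
  | .inr _, _ => 0

/-- the kernel of the form -/
noncomputable def gκ {r : ℕ} (S : Set (Fin m × (Fin m → K)))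
    (Pj Pj' : Fin m → Matrix (Fin m → K) (Fin m → K) K) (i h : Fin r) (w : Fin r → GU K m) : K :=
  if i = h then ∑ y, ∏ h', eP y (w h')
  else - ∑ a, ∑ y, mD S Pj' a y (w i) * eA a y (w h) *
    ((∏ h' ∈ (Finset.univ.erase i).filter (· < h), eQ Pj a y (w h')) *
      ∏ h' ∈ (Finset.univ.erase i).filter (h < ·), eP y (w h'))

lemma eP_ne {y : Fin m → K} {u : GU K m} (h : eP y u ≠ 0) : u = .inl y := by
  by_contra h9; exact h (by simp [eP, h9])

lemma eA_ne {a : Fin m} {y : Fin m → K} {u : GU K m} (h : eA a y u ≠ 0) :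
    u = .inr (.inl (a, y)) := by
  by_contra h9; exact h (by simp [eA, h9])

lemma mD_ne {S : Set (Fin m × (Fin m → K))} {Pj' : Fin m → Matrix (Fin m → K) (Fin m → K) K}
    {a : Fin m} {y : Fin m → K} {u : GU K m} (h : mD S Pj' a y u ≠ 0) :
    ∃ x, u = .inr (.inr (a, x)) ∧ (a, x) ∈ S ∧ (1 - Pj' a) x y ≠ 0 := by
  rcases u with u | u | ⟨a', x⟩
  · exact absurd rfl h
  · exact absurd rfl h
  · simp only [mD] at h
    split_ifs at h with h1
    · obtain ⟨h1, rfl⟩ := h1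
      exact ⟨x, rfl, h1, h⟩
    · exact absurd rfl h

lemma eQ_ne {Pj : Fin m → Matrix (Fin m → K) (Fin m → K) K}
    {a : Fin m} {y : Fin m → K} {u : GU K m} (h : eQ Pj a y u ≠ 0) :
    ∃ x, u = .inl x ∧ Pj a y x ≠ 0 := by
  rcases u with u | u
  · exact ⟨u, rfl, h⟩
  · exact absurd rfl h

/-- structure of the support of the form -/
lemma gκ_ne {r : ℕ} {S : Set (Fin m × (Fin m → K))}
    {Pj Pj' : Fin m → Matrix (Fin m → K) (Fin m → K) K} {i h : Fin r} (hih : i ≠ h)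
    {w : Fin r → GU K m} (H : gκ S Pj Pj' i h w ≠ 0) :
    ∃ a x y, w i = .inr (.inr (a, x)) ∧ (a, x) ∈ S ∧ (1 - Pj' a) x y ≠ 0 ∧
      w h = .inr (.inl (a, y)) ∧ ∀ h', h' ≠ i → h' ≠ h → ∃ y', w h' = .inl y' ∧
        (Pj a y y' ≠ 0 ∨ y = y') := by
  rw [gκ, if_neg hih, neg_ne_zero] at H
  obtain ⟨a, _, H⟩ := Finset.exists_ne_zero_of_sum_ne_zero H
  obtain ⟨y, _, H⟩ := Finset.exists_ne_zero_of_sum_ne_zero H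
  obtain ⟨x, hx1, hx2, hx3⟩ := mD_ne (left_ne_zero_of_mul (left_ne_zero_of_mul H))
  have hA := eA_ne (right_ne_zero_of_mul (left_ne_zero_of_mul H))
  have hL := Finset.prod_ne_zero_iff.mp (left_ne_zero_of_mul (right_ne_zero_of_mul H))
  have hR := Finset.prod_ne_zero_iff.mp (right_ne_zero_of_mul (right_ne_zero_of_mul H))
  refine ⟨a, x, y, hx1, hx2, hx3, hA, fun h' h1 h2 => ?_⟩
  rcases lt_or_gt_of_ne h2 with h3 | h3
  · obtain ⟨y', hy', hy''⟩ := eQ_ne (hL h' (by simp [h1, h3]))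
    exact ⟨y', hy', Or.inl hy''⟩
  · exact ⟨y, eP_ne (hR h' (by simp [h1, h3])), Or.inr rfl⟩

lemma gκ_ne' {r : ℕ} {S : Set (Fin m × (Fin m → K))}
    {Pj Pj' : Fin m → Matrix (Fin m → K) (Fin m → K) K} {i : Fin r}
    {w : Fin r → GU K m} (H : gκ S Pj Pj' i i w ≠ 0) : ∃ y, ∀ h, w h = .inl y := by
  rw [gκ, if_pos rfl] at H
  obtain ⟨y, _, H⟩ := Finset.exists_ne_zero_of_sum_ne_zero H
  exact ⟨y, fun h => eP_ne (Finset.prod_ne_zero_iff.mp H h (Finset.mem_univ _))⟩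

lemma gleib {r : ℕ} (S : Set (Fin m × (Fin m → K)))
    (Pj Pj' : Fin m → Matrix (Fin m → K) (Fin m → K) K)
    (hker : ∀ a (i : Fin r) (y : Fin r → Fin m → K) x,
      ∑ z, (1 - Pj' a) x z * ∏ h ∈ Finset.univ.erase i, Pj a z (y h) = 0)
    (i : Fin r) (w : Fin r → GU K m) (hw : ∀ h, h ≠ i → ∃ y, w h = .inl y) :
    ∑ h, ∑ v, gκ S Pj Pj' i h (Function.update w h v) *
      (if i = h then gD S Pj' else gA Pj) v (w h) = 0 := by
  classical
  -- diagonal term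
  have e1 : ∑ v, gκ S Pj Pj' i i (Function.update w i v) * gD S Pj' v (w i) =
      ∑ a, ∑ y, mD S Pj' a y (w i) * ∏ h ∈ Finset.univ.erase i, eP y (w h) := by
    have : ∀ v, gκ S Pj Pj' i i (Function.update w i v) * gD S Pj' v (w i) =
        ∑ y, eP y v * (gD S Pj' v (w i) * ∏ h ∈ Finset.univ.erase i, eP y (w h)) := by
      intro v
      rw [gκ, if_pos rfl, Finset.sum_mul]
      refine Finset.sum_congr rfl (fun y _ => ?_)
      rw [← Finset.mul_prod_erase _ _ (Finset.mem_univ i), Function.update_self]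
      have : ∏ h ∈ Finset.univ.erase i, eP y (Function.update w i v h) =
          ∏ h ∈ Finset.univ.erase i, eP y (w h) :=
        Finset.prod_congr rfl (fun h hh => by
          rw [Function.update_of_ne (Finset.ne_of_mem_erase hh)])
      rw [this]; ring
    simp only [this]
    rw [Finset.sum_comm]
    simp only [sum_eP]
    rw [Finset.sum_comm]
    refine Finset.sum_congr rfl (fun y _ => ?_)
    rw [← Finset.sum_mul]
    rfl
  have e2 : ∀ h, h ≠ i → ∑ v, gκ S Pj Pj' i h (Function.update w h v) * gA Pj v (w h) =
      ∑ a, ∑ y, mD S Pj' a y (w i) * ((eQ Pj a y (w h) - eP y (w h)) *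
      (∏ h' ∈ (Finset.univ.erase i).filter (· < h), eQ Pj a y (w h')) *
      ∏ h' ∈ (Finset.univ.erase i).filter (h < ·), eP y (w h')) := by
    intro h hh
    have : ∀ v, gκ S Pj Pj' i h (Function.update w h v) * gA Pj v (w h) =
        ∑ a, ∑ y, eA a y v * (- gA Pj v (w h) * (mD S Pj' a y (w i) *
          ((∏ h' ∈ (Finset.univ.erase i).filter (· < h), eQ Pj a y (w h')) *
            ∏ h' ∈ (Finset.univ.erase i).filter (h < ·), eP y (w h')))) := by
      intro v
      rw [gκ, if_neg hh.symm, neg_mul, ← mul_neg, Finset.sum_mul]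
      refine Finset.sum_congr rfl (fun a _ => ?_)
      rw [Finset.sum_mul]
      refine Finset.sum_congr rfl (fun y _ => ?_)
      rw [Function.update_self, Function.update_of_ne hh.symm]
      have t1 : ∏ h' ∈ (Finset.univ.erase i).filter (· < h), eQ Pj a y (Function.update w h v h') =
          ∏ h' ∈ (Finset.univ.erase i).filter (· < h), eQ Pj a y (w h') :=
        Finset.prod_congr rfl (fun h' hh' => by
          rw [Function.update_of_ne (ne_of_lt (Finset.mem_filter.mp hh').2)])
      have t2 : ∏ h' ∈ (Finset.univ.erase i).filter (h < ·), eP y (Function.update w h v h') =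
          ∏ h' ∈ (Finset.univ.erase i).filter (h < ·), eP y (w h') :=
        Finset.prod_congr rfl (fun h' hh' => by
          rw [Function.update_of_ne (ne_of_gt (Finset.mem_filter.mp hh').2)])
      rw [t1, t2]; ring
    simp only [this]
    rw [Finset.sum_comm]
    refine Finset.sum_congr rfl (fun a _ => ?_)
    rw [Finset.sum_comm]
    refine Finset.sum_congr rfl (fun y _ => ?_)
    rw [sum_eA]
    simp only [gA]
    ring
  rw [← Finset.add_sum_erase _ _ (Finset.mem_univ i)]
  simp only [if_true]
  rw [e1]
  have e3 : ∑ h ∈ Finset.univ.erase i, ∑ v, gκ S Pj Pj' i h (Function.update w h v) *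
      (if i = h then gD S Pj' else gA Pj) v (w h) =
      ∑ h ∈ Finset.univ.erase i,
      ∑ a, ∑ y, mD S Pj' a y (w i) * ((eQ Pj a y (w h) - eP y (w h)) *
      (∏ h' ∈ (Finset.univ.erase i).filter (· < h), eQ Pj a y (w h')) *
      ∏ h' ∈ (Finset.univ.erase i).filter (h < ·), eP y (w h')) := by
    refine Finset.sum_congr rfl (fun h hh => ?_)
    have hh := Finset.ne_of_mem_erase hh
    rw [← e2 h hh]
    simp only [if_neg hh.symm]
  rw [e3, Finset.sum_comm (s := Finset.univ.erase i), ← Finset.sum_add_distrib]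
  refine Finset.sum_eq_zero (fun a _ => ?_)
  rw [Finset.sum_comm (s := Finset.univ.erase i), ← Finset.sum_add_distrib]
  have e4 : ∀ y, mD S Pj' a y (w i) * ∏ h ∈ Finset.univ.erase i, eP y (w h) +
      ∑ h ∈ Finset.univ.erase i, mD S Pj' a y (w i) * ((eQ Pj a y (w h) - eP y (w h)) *
      (∏ h' ∈ (Finset.univ.erase i).filter (· < h), eQ Pj a y (w h')) *
      ∏ h' ∈ (Finset.univ.erase i).filter (h < ·), eP y (w h')) =
      mD S Pj' a y (w i) * ∏ h ∈ Finset.univ.erase i, eQ Pj a y (w h) := by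
    intro y
    have := Finset.prod_add_ordered (Finset.univ.erase i) (fun h => eP y (w h))
      (fun h => eQ Pj a y (w h) - eP y (w h))
    simp only [add_sub_cancel] at this
    rw [this, mul_add, Finset.mul_sum]
  simp only [e4]
  choose! y hy using hw
  have e5 : ∀ z, ∏ h ∈ Finset.univ.erase i, eQ Pj a z (w h) =
      ∏ h ∈ Finset.univ.erase i, Pj a z (y h) := by
    intro z
    refine Finset.prod_congr rfl (fun h hh => ?_)
    rw [hy h (Finset.ne_of_mem_erase hh)]
    rfl
  simp only [e5]
  rcases hwi : w i with u | u | ⟨a', x⟩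
  · simp [mD]
  · simp [mD]
  · simp only [mD]
    split_ifs with h9
    · exact hker a i y x
    · simp

lemma gD_D {S : Set (Fin m × (Fin m → K))} {Pj' : Fin m → Matrix (Fin m → K) (Fin m → K) K}
    (y : Fin m → K) (q : Fin m × (Fin m → K)) (hq : q ∈ S) :
    gD S Pj' (.inl y) (.inr (.inr q)) = (1 - Pj' q.1) q.2 y := by
  simp only [gD, mD]
  rw [Finset.sum_eq_single q.1]
  · simp [hq]
  · intro a _ ha; rw [if_neg]; rintro ⟨_, h⟩; exact ha h.symm
  · simp

lemma gD_supp {S : Set (Fin m × (Fin m → K))} {Pj' : Fin m → Matrix (Fin m → K) (Fin m → K) K}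
    {u v : GU K m} (h : gD S Pj' u v ≠ 0) :
    ∃ y q, u = .inl y ∧ v = .inr (.inr q) ∧ q ∈ S ∧ (1 - Pj' q.1) q.2 y ≠ 0 := by
  rcases u with y | u
  · simp only [gD] at h
    obtain ⟨a, _, ha⟩ := Finset.exists_ne_zero_of_sum_ne_zero h
    obtain ⟨x, hx1, hx2, hx3⟩ := mD_ne ha
    exact ⟨y, (a, x), rfl, hx1, hx2, hx3⟩
  · exact absurd rfl h

lemma gA_supp {Pj : Fin m → Matrix (Fin m → K) (Fin m → K) K}
    {u v : GU K m} (h : gA Pj u v ≠ 0) :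
    ∃ q y, u = .inr (.inl q) ∧ v = .inl y ∧ (q.2 = y ∨ Pj q.1 q.2 y ≠ 0) := by
  rcases u with y | q | u
  · exact absurd rfl h
  · simp only [gA] at h
    by_cases h1 : eP q.2 v = 0
    · rw [h1, zero_sub, neg_ne_zero] at h
      obtain ⟨x, hx, hx'⟩ := eQ_ne h
      exact ⟨q, x, rfl, hx, Or.inr hx'⟩
    · exact ⟨q, q.2, rfl, eP_ne h1, Or.inl rfl⟩
  · exact absurd rfl h

lemma grid_wt (f : GU K m → K) : hwt (fun x => f (.inl x)) ≤ hwt f := by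
  unfold hwt
  refine Nat.card_le_card_of_injective (fun x => ⟨.inl x.1, x.2⟩) ?_
  intro x y h
  apply Subtype.ext
  simpa using h

open Classical in
theorem gridDir {r d : ℕ} (hm : 0 < m) {J : Type}
    (Pj Pj' : Fin m → Matrix (Fin m → K) (Fin m → K) K)
    (hloc : ∀ a x y, Pj a x y ≠ 0 → ∀ b, b ≠ a → x b = y b)
    (hloc' : ∀ a x y, Pj' a x y ≠ 0 → ∀ b, b ≠ a → x b = y b)
    (hker : ∀ a (i : Fin r) (y : Fin r → Fin m → K) x,
      ∑ z, (1 - Pj' a) x z * ∏ h ∈ Finset.univ.erase i, Pj a z (y h) = 0)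
    (dist : ∀ f : (Fin m → K) → K, (∀ a, Pj a *ᵥ f = f) → f ≠ 0 → d ≤ hwt f)
    (dist' : ∀ f : (Fin m → K) → K, (∀ a, Pj' a *ᵥ f = f) → f ≠ 0 → d ≤ hwt f)
    (pt : J → Fin m → K) (cw : J → (Fin m → K) → K)
    (hcw : ∀ j a, Pj a *ᵥ cw j = cw j)
    (hpt : ∀ j j', cw j (pt j') = if j = j' then 1 else 0) :
    Nonempty (Dir r K (GU K m) J (m * Fintype.card K * (2 * m + 1)) d) := by
  obtain ⟨κ, ia, hinj, hspan, hli⟩ := exists_linearIndependent' K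
    (fun p : Fin m × (Fin m → K) => ((1 - Pj' p.1) p.2 : (Fin m → K) → K))
  let S := Set.range ia
  obtain ⟨L, hL⟩ := LinearMap.exists_leftInverse_of_injective _ (LinearMap.ker_eq_bot.mpr hli)
  have hLR : ∀ s, L ((1 - Pj' (ia s).1) (ia s).2) = Finsupp.single s 1 := by
    intro s
    have := LinearMap.congr_fun hL (Finsupp.single s 1)
    simpa using this
  have hloc1 : ∀ a x y, (1 - Pj' a) x y ≠ 0 → ∀ b, b ≠ a → x b = y b := by
    intro a x y h b hb
    by_cases e : x = y
    · rw [e]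
    · rw [Matrix.sub_apply, Matrix.one_apply_ne e, zero_sub, neg_ne_zero] at h
      exact hloc' a x y h b hb
  have hgD : ∀ t y, gD S Pj' (.inl y) (.inr (.inr (ia t))) = (1 - Pj' (ia t).1) (ia t).2 y :=
    fun t y => gD_D y (ia t) (Set.mem_range_self t)
  let ρ : Matrix (GU K m) (GU K m) K := fun u v => match u, v with
    | .inr (.inr p), .inl y => if hp : p ∈ S then L (Pi.single y 1) (Classical.choose hp) else 0
    | _, _ => 0
  have hval : ∀ (i : Fin r) (b : Fin r → GU K m → K),
      ∑ w, gκ S Pj Pj' i i w * ∏ h, b h (w h) = ∑ y, ∏ h, b h (.inl y) := by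
    intro i b
    simp only [gκ, if_true, Finset.sum_mul]
    rw [Finset.sum_comm]
    refine Finset.sum_congr rfl (fun y _ => ?_)
    simp only [← Finset.prod_mul_distrib]
    have := Finset.prod_univ_sum (fun _ : Fin r => (Finset.univ : Finset (GU K m)))
      (fun h u => eP y u * b h u)
    rw [Fintype.piFinset_univ] at this
    rw [← this]
    simp only [sum_eP]
  let vC : J → GU K m → K := fun j u => match u with
    | .inl x => cw j x
    | .inr _ => 0
  let vD : J → GU K m → K := fun j u => eP (pt j) u
  have hval2 : ∀ (i : Fin r) (jj : Fin r → J) (b : Fin r → GU K m → K),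
    (∀ h, b h = if h = i then vD (jj h) else vC (jj h)) →
      ∑ w, gκ S Pj Pj' i i w * ∏ h, b h (w h) = ∏ h ∈ Finset.univ.erase i, cw (jj h) (pt (jj i)) := by
    intro i jj b hb
    rw [hval, Finset.sum_eq_single (pt (jj i))]
    · rw [← Finset.mul_prod_erase _ _ (Finset.mem_univ i), hb i, if_pos rfl]
      have : vD (jj i) (.inl (pt (jj i))) = 1 := by simp [vD, eP]
      rw [this, one_mul]
      refine Finset.prod_congr rfl (fun h hh => ?_)
      rw [hb h, if_neg (Finset.ne_of_mem_erase hh)]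
    · intro y _ hy
      refine Finset.prod_eq_zero (Finset.mem_univ i) ?_
      rw [hb i, if_pos rfl]
      simp [vD, eP, hy]
    · simp
  have hadj : ∀ (y : Fin m → K) (a : Fin m) (u v : GU K m), (∀ b, b ≠ a → gpos u b = y b) →
      (∀ b, b ≠ a → gpos v b = y b) → gadj u v := by
    intro y a u v h1 h2
    exact ⟨a, fun b hb => by rw [h1 b hb, h2 b hb]⟩
  refine ⟨{
    pP := fun u => ∃ x, u = .inl x
    pA := fun u => ∃ q, u = .inr (.inl q)
    pD := fun u => ∃ q ∈ S, u = .inr (.inr q)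
    dA := gA Pj
    dD := gD S Pj'
    ρ := ρ
    κ := gκ S Pj Pj'
    adj := gadj
    vC := vC
    vD := vD
    dA_supp := ?_
    dD_supp := ?_
    ρ_supp := ?_
    ρ_dD := ?_
    κ_supp := ?_
    leib := ?_
    distC := ?_
    distD := ?_
    adj_refl := ?_
    adj_symm := ?_
    adj_card := gadj_card
    dA_adj := ?_
    dD_adj := ?_
    κ_adj := ?_
    vC_supp := ?_
    vD_supp := ?_
    vC_ker := ?_
    v_val := ?_
    v_val0 := ?_ }⟩
  · intro u v h
    obtain ⟨q, y, h1, h2, _⟩ := gA_supp h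
    exact ⟨⟨q, h1⟩, ⟨y, h2⟩⟩
  · intro u v h
    obtain ⟨y, q, h1, h2, h3, _⟩ := gD_supp h
    exact ⟨⟨y, h1⟩, ⟨q, h3, h2⟩⟩
  · intro u v h
    rcases u with u | u | p
    · exact absurd rfl h
    · exact absurd rfl h
    · rcases v with y | v
      · simp only [ρ] at h
        split_ifs at h with hp
        · exact ⟨p, hp, rfl⟩
        · exact absurd rfl h
      · exact absurd rfl h
  · rintro u v ⟨q, ⟨t, rfl⟩, rfl⟩
    rw [Matrix.mul_apply, Fintype.sum_sum_type]
    have e0 : ∑ x, ρ u (Sum.inr x) * gD S Pj' (Sum.inr x) (Sum.inr (Sum.inr (ia t))) = 0 := by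
      refine Finset.sum_eq_zero (fun x _ => ?_)
      simp [gD]
    rw [e0, add_zero]
    rcases u with u | u | p
    · simp [ρ]
    · simp [ρ]
    · by_cases hp : p ∈ S
      · have hs : ia (Classical.choose hp) = p := Classical.choose_spec hp
        have e1 : ∀ y, ρ (.inr (.inr p)) (.inl y) = L (Pi.single y 1) (Classical.choose hp) := by
          intro y; simp only [ρ, dif_pos hp]
        rw [Finset.sum_congr rfl (fun y _ => by rw [e1 y, hgD t y] :
          ∀ y ∈ Finset.univ, ρ (.inr (.inr p)) (.inl y) * gD S Pj' (.inl y) (.inr (.inr (ia t))) =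
            L (Pi.single y 1) (Classical.choose hp) * (1 - Pj' (ia t).1) (ia t).2 y)]
        have e2 := congrArg (fun f => f (Classical.choose hp))
          (LinearMap.pi_apply_eq_sum_univ L ((1 - Pj' (ia t).1) (ia t).2))
        simp only [hLR, Finsupp.finset_sum_apply, Finsupp.smul_apply, smul_eq_mul] at e2
        have e3 : ∑ x, L (Pi.single x 1) (Classical.choose hp) * (1 - Pj' (ia t).1) (ia t).2 x =
            (Finsupp.single t (1 : K)) (Classical.choose hp) := by
          rw [e2]
          refine Finset.sum_congr rfl (fun y _ => ?_)
          rw [mul_comm]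
          congr 3
          funext z
          simp [Pi.single_apply, eq_comm]
        rw [e3, Finsupp.single_apply]
        by_cases ht : t = Classical.choose hp
        · rw [if_pos ht, if_pos]
          rw [ht, hs]
        · rw [if_neg ht, if_neg]
          intro h9
          apply ht
          apply hinj
          rw [hs]
          simpa using h9.symm
      · simp only [ρ, dif_neg hp, zero_mul, Finset.sum_const_zero]
        rw [if_neg]
        intro h9
        apply hp
        have : p = ia t := by simpa using h9
        exact ⟨t, this.symm⟩
  · intro i h w hw
    by_cases hih : i = h
    · subst hih
      obtain ⟨y, hy⟩ := gκ_ne' hw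
      simp only [if_true]
      refine ⟨⟨y, hy i⟩, fun h' hh' => ?_⟩
      rw [if_neg hh'.symm]
      exact ⟨y, hy h'⟩
    · obtain ⟨a, x, y, h1, h2, h3, h4, h5⟩ := gκ_ne hih hw
      rw [if_neg hih]
      refine ⟨⟨_, h4⟩, fun h' hh' => ?_⟩
      split_ifs with h6
      · subst h6
        exact ⟨_, h2, h1⟩
      · obtain ⟨y', hy', _⟩ := h5 h' (Ne.symm h6) hh'
        exact ⟨y', hy'⟩
  · intro i w hw
    refine gleib S Pj Pj' hker i w (fun h hh => ?_)
    have := hw h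
    rwa [if_neg hh.symm] at this
  · intro f hf hk hne
    refine le_trans (dist (fun x => f (.inl x)) ?_ ?_) (grid_wt f)
    · intro a
      funext x
      have := congrFun hk (.inr (.inl (a, x)))
      simp only [Matrix.mulVec, dotProduct, gA, sub_mul, Finset.sum_sub_distrib, sum_eP,
        Pi.zero_apply, sub_eq_zero] at this
      rw [this, Fintype.sum_sum_type]
      simp [eQ, Matrix.mulVec, dotProduct]
    · intro h9
      apply hne
      funext u
      by_contra h8
      obtain ⟨x, rfl⟩ := hf u h8
      exact h8 (congrFun h9 x)
  · intro f hf hk hne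
    refine le_trans (dist' (fun x => f (.inl x)) ?_ ?_) (grid_wt f)
    · let φ : ((Fin m → K) → K) →ₗ[K] K := ∑ y, (f (.inl y)) • LinearMap.proj y
      have hφ : ∀ g, φ g = ∑ y, f (.inl y) * g y := by
        intro g; simp [φ]
      have h1 : Submodule.span K (Set.range ((fun p : Fin m × (Fin m → K) =>
          ((1 - Pj' p.1) p.2 : (Fin m → K) → K)) ∘ ia)) ≤ LinearMap.ker φ := by
        rw [Submodule.span_le]
        rintro _ ⟨t, rfl⟩
        show φ _ = 0
        rw [hφ]
        have := congrFun hk (.inr (.inr (ia t)))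
        simp only [Matrix.mulVec, dotProduct, Matrix.transpose_apply, Pi.zero_apply] at this
        rw [Fintype.sum_sum_type] at this
        have e0 : ∑ x, gD S Pj' (Sum.inr x) (Sum.inr (Sum.inr (ia t))) * f (.inr x) = 0 := by
          refine Finset.sum_eq_zero (fun x _ => ?_)
          simp [gD]
        rw [e0, add_zero] at this
        rw [← this]
        refine Finset.sum_congr rfl (fun y _ => ?_)
        rw [hgD t y, mul_comm]; rfl
      rw [hspan] at h1
      intro a
      funext x
      have h2 := h1 (Submodule.subset_span ⟨(a, x), rfl⟩)
      rw [LinearMap.mem_ker, hφ] at h2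
      simp only [Matrix.sub_apply, mul_sub, Finset.sum_sub_distrib, Matrix.one_apply, mul_ite,
        mul_one, mul_zero, Finset.sum_ite_eq, Finset.mem_univ, if_true, sub_eq_zero] at h2
      rw [h2]
      simp only [Matrix.mulVec, dotProduct]
      refine Finset.sum_congr rfl (fun y _ => mul_comm _ _)
    · intro h9
      apply hne
      funext u
      by_contra h8
      obtain ⟨x, rfl⟩ := hf u h8
      exact h8 (congrFun h9 x)
  · intro u
    exact ⟨⟨0, hm⟩, fun _ _ => rfl⟩
  · rintro u v ⟨a, ha⟩
    exact ⟨a, fun b hb => (ha b hb).symm⟩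
  · intro u v h
    obtain ⟨q, y, rfl, rfl, h3⟩ := gA_supp h
    refine ⟨q.1, fun b hb => ?_⟩
    simp only [gpos]
    rcases h3 with h3 | h3
    · rw [h3]
    · exact hloc _ _ _ h3 b hb
  · intro u v h
    obtain ⟨y, q, rfl, rfl, _, h3⟩ := gD_supp h
    refine ⟨q.1, fun b hb => ?_⟩
    exact (hloc1 _ _ _ h3 b hb).symm
  · intro i h w hw h₁ h₂
    by_cases hih : i = h
    · subst hih
      obtain ⟨y, hy⟩ := gκ_ne' hw
      rw [hy h₁, hy h₂]
      exact ⟨⟨0, hm⟩, fun _ _ => rfl⟩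
    · obtain ⟨a, x, y, h1, h2, h3, h4, h5⟩ := gκ_ne hih hw
      have key : ∀ h', ∀ b, b ≠ a → gpos (w h') b = y b := by
        intro h' b hb
        by_cases e1 : h' = i
        · rw [e1, h1]; exact hloc1 _ _ _ h3 b hb
        · by_cases e2 : h' = h
          · rw [e2, h4]; rfl
          · obtain ⟨y', hy', h6⟩ := h5 h' e1 e2
            rw [hy']
            rcases h6 with h6 | h6
            · exact (hloc _ _ _ h6 b hb).symm
            · rw [h6]; rfl
      exact hadj y a _ _ (key _) (key _)
  · intro j u h
    rcases u with x | u
    · exact ⟨x, rfl⟩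
    · exact absurd rfl h
  · intro j u h
    exact ⟨_, eP_ne h⟩
  · intro j
    funext u
    rcases u with x | q | u
    · simp [Matrix.mulVec, dotProduct, gA]
    · simp only [Matrix.mulVec, dotProduct, gA, sub_mul, Finset.sum_sub_distrib, sum_eP,
        Pi.zero_apply, sub_eq_zero]
      rw [Fintype.sum_sum_type]
      have := congrFun (hcw j q.1) q.2
      simp only [Matrix.mulVec, dotProduct] at this
      simp [eQ, vC, this]
    · simp [Matrix.mulVec, dotProduct, gA]
  · intro i jj b hb hjj
    rw [hval2 i jj b hb]
    refine Finset.prod_eq_one (fun h _ => ?_)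
    rw [hpt, if_pos (hjj h)]
  · intro i jj b hb hjj
    rw [hval2 i jj b hb]
    push Not at hjj
    obtain ⟨h, hh⟩ := hjj
    refine Finset.prod_eq_zero (i := h) ?_ ?_
    · refine Finset.mem_erase.mpr ⟨?_, Finset.mem_univ _⟩
      rintro rfl
      exact hh rfl
    · rw [hpt, if_neg hh]

end GridDir
section RSInst

variable {K : Type} [Field K] [Fintype K] [DecidableEq K] {m : ℕ}

/-- The interpolation matrix of the node set `s`. -/
noncomputable def rsl (s : Finset K) : Matrix K K K :=
  fun t y => if y ∈ s then (Lagrange.basis s id y).eval t else 0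

lemma rsl_sum (s : Finset K) (g : K → K) (t : K) :
    ∑ y, rsl s t y * g y = (Lagrange.interpolate s id g).eval t := by
  rw [Lagrange.interpolate_apply, Polynomial.eval_finset_sum]
  simp only [rsl, ite_mul, zero_mul, Polynomial.eval_mul, Polynomial.eval_C]
  rw [Finset.sum_ite_mem, Finset.univ_inter]
  exact Finset.sum_congr rfl (fun y _ => mul_comm _ _)

lemma rsl_repr (s : Finset K) (P : Polynomial K) (hP : P.degree < s.card) (t : K) :
    ∑ y, rsl s t y * P.eval y = P.eval t := by
  rw [rsl_sum]
  have := Lagrange.eq_interpolate (s := s) (v := id) (Function.injective_id.injOn) hP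
  conv_rhs => rw [this]
  rfl

lemma rsl_poly (s : Finset K) (y : K) : ∃ P : Polynomial K, P.natDegree ≤ s.card - 1 ∧
    ∀ t, rsl s t y = P.eval t := by
  by_cases hy : y ∈ s
  · refine ⟨Lagrange.basis s id y, ?_, fun t => by simp [rsl, hy]⟩
    rw [Lagrange.natDegree_basis (Function.injective_id.injOn) hy]
  · exact ⟨0, by simp, fun t => by simp [rsl, hy]⟩

/-- Interpolation along the axis `a`. -/
noncomputable def rsP (s : Finset K) (a : Fin m) : Matrix (Fin m → K) (Fin m → K) K :=
  fun x y => if ∀ b, b ≠ a → x b = y b then rsl s (x a) (y a) else 0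

lemma rsP_sum (s : Finset K) (a : Fin m) (x : Fin m → K) (g : (Fin m → K) → K) :
    ∑ z, rsP s a x z * g z = ∑ t, rsl s (x a) t * g (Function.update x a t) := by
  have h : ∀ z, rsP s a x z * g z =
      ∑ t, if z = Function.update x a t then rsl s (x a) t * g (Function.update x a t) else 0 := by
    intro z
    unfold rsP
    by_cases hz : ∀ b, b ≠ a → x b = z b
    · have e : z = Function.update x a (z a) := by
        funext b
        by_cases hb : b = a
        · subst hb; simp
        · rw [Function.update_of_ne hb, hz b hb]
      rw [if_pos hz, Finset.sum_eq_single (z a), if_pos e, ← e]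
      · intro t _ ht
        rw [if_neg]
        intro h
        apply ht
        rw [h]; simp
      · simp
    · rw [if_neg hz, zero_mul]
      symm
      refine Finset.sum_eq_zero (fun t _ => ?_)
      rw [if_neg]
      rintro rfl
      exact hz (fun b hb => by rw [Function.update_of_ne hb])
  simp only [h]
  rw [Finset.sum_comm]
  simp

lemma rsP_line (s : Finset K) (f : (Fin m → K) → K) (a : Fin m) (hf : rsP s a *ᵥ f = f)
    (x : Fin m → K) (hx : f x ≠ 0) :
    Fintype.card K - s.card ≤
      (Finset.univ.filter (fun t => f (Function.update x a t) ≠ 0)).card := by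
  set P := Lagrange.interpolate s id (fun t => f (Function.update x a t)) with hP
  have h1 : ∀ t, f (Function.update x a t) = P.eval t := by
    intro t
    rw [hP, ← rsl_sum]
    have := rsP_sum s a (Function.update x a t) f
    simp only [Function.update_self, Function.update_idem] at this
    rw [← this]
    conv_lhs => rw [← hf]
    rfl
  have h0 : P ≠ 0 := by
    intro h
    apply hx
    have := h1 (x a)
    rw [Function.update_eq_self, h] at this
    simpa using this
  have h2 : P.roots.toFinset.card ≤ s.card := by
    refine (Multiset.toFinset_card_le _).trans ((Polynomial.card_roots' P).trans ?_)
    have : P.degree < s.card := Lagrange.degree_interpolate_lt _ (Function.injective_id.injOn)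
    exact ((Polynomial.natDegree_lt_iff_degree_lt h0).mpr this).le
  have h3 : (Finset.univ.filter (fun t => f (Function.update x a t) ≠ 0)) =
      Finset.univ \ P.roots.toFinset := by
    ext t
    simp [h1, h0]
  rw [h3, Finset.card_sdiff_of_subset (Finset.subset_univ _), Finset.card_univ]
  omega

lemma grid_count (D : ℕ) : ∀ (m : ℕ) (S : Finset (Fin m → K)), S.Nonempty →
    (∀ x ∈ S, ∀ a, D ≤ (Finset.univ.filter (fun t => Function.update x a t ∈ S)).card) →
    D ^ m ≤ S.card := by
  intro m
  induction m with
  | zero => intro S hS _; simpa using hS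
  | succ m ih =>
    intro S hS h
    let A : K → Finset (Fin m → K) := fun t => Finset.univ.filter (fun y => Fin.cons t y ∈ S)
    have hA : ∀ t, (A t).Nonempty → D ^ m ≤ (A t).card := by
      intro t ht
      refine ih (A t) ht ?_
      intro y hy a
      have := h (Fin.cons t y) (by simpa [A] using hy) a.succ
      refine this.trans (Finset.card_le_card ?_)
      intro u hu
      simp only [A, Finset.mem_filter, Finset.mem_univ, true_and] at hu ⊢
      rwa [Fin.cons_update]
    obtain ⟨x, hx⟩ := hS
    have h0 := h x hx 0
    set T := Finset.univ.filter (fun t => Function.update x 0 t ∈ S) with hT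
    have hsum : S.card = ∑ t, (A t).card := by
      rw [← Finset.card_sigma]
      refine Finset.card_nbij' (fun z => ⟨z 0, Fin.tail z⟩) (fun p => Fin.cons p.1 p.2) ?_ ?_ ?_ ?_
      · intro z hz; simpa [A] using hz
      · intro z hz; simpa [A] using hz
      · intro z hz; simp
      · intro z hz; simp
    calc D ^ (m+1) = D * D ^ m := by ring
      _ ≤ T.card * D ^ m := Nat.mul_le_mul_right _ h0
      _ = ∑ t ∈ T, D ^ m := by simp
      _ ≤ ∑ t ∈ T, (A t).card := by
        refine Finset.sum_le_sum (fun t ht => hA t ⟨Fin.tail x, ?_⟩)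
        simp only [hT, A, Finset.mem_filter, Finset.mem_univ, true_and] at ht ⊢
        convert ht using 1
        conv_rhs => rw [← Fin.cons_self_tail x]
        rw [Fin.update_cons_zero]
      _ ≤ ∑ t, (A t).card := Finset.sum_le_sum_of_subset (Finset.subset_univ _)
      _ = S.card := hsum.symm

lemma rsP_dist (s : Finset K) (f : (Fin m → K) → K) (hf : ∀ a, rsP s a *ᵥ f = f) (h0 : f ≠ 0) :
    (Fintype.card K - s.card) ^ m ≤ hwt f := by
  have : hwt f = (Finset.univ.filter (fun x => f x ≠ 0)).card := by
    unfold hwt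
    rw [← Fintype.card_subtype, ← Nat.card_eq_fintype_card]
    rfl
  rw [this]
  refine grid_count _ m _ ?_ ?_
  · obtain ⟨x, hx⟩ := Function.ne_iff.mp h0
    exact ⟨x, by simpa using hx⟩
  · intro x hx a
    have := rsP_line s f a (hf a) x (by simpa using hx)
    simpa using this

theorem rsDir {r k : ℕ} (hr : 2 ≤ r) (hk : 1 ≤ k) (hm : 0 < m) (hQ : r * k ≤ Fintype.card K) :
    ∃ s : Finset K, s.card = k ∧
      Nonempty (Dir r K (GU K m) (Fin m → s) (m * Fintype.card K * (2 * m + 1))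
        ((Fintype.card K - r * k) ^ m)) := by
  have hkr : k ≤ r * k := by nlinarith
  obtain ⟨s, -, hs⟩ := Finset.exists_subset_card_eq (s := (Finset.univ : Finset K)) (n := k)
    (by rw [Finset.card_univ]; omega)
  obtain ⟨s', -, hs'⟩ := Finset.exists_subset_card_eq (s := (Finset.univ : Finset K)) (n := r * k)
    (by rw [Finset.card_univ]; omega)
  refine ⟨s, hs, gridDir hm (rsP s) (rsP s') ?_ ?_ ?_ ?_ ?_ (fun j a => (j a : K))
    (fun j x => ∏ a, rsl s (x a) (j a)) ?_ ?_⟩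
  · intro a x y h
    by_contra h2
    exact h (if_neg h2)
  · intro a x y h
    by_contra h2
    exact h (if_neg h2)
  · intro a i y x
    set G : (Fin m → K) → K := fun z => ∏ h ∈ Finset.univ.erase i, rsP s a z (y h) with hG
    have hp : ∀ h, ∃ P : Polynomial K, P.natDegree ≤ k - 1 ∧
        ∀ t, rsP s a (Function.update x a t) (y h) = P.eval t := by
      intro h
      obtain ⟨P, h1, h2⟩ := rsl_poly s (y h a)
      by_cases hb : ∀ b, b ≠ a → x b = y h b
      · refine ⟨P, by rw [← hs]; exact h1, fun t => ?_⟩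
        unfold rsP
        rw [if_pos, Function.update_self, h2]
        intro b hb'
        rw [Function.update_of_ne hb', hb b hb']
      · refine ⟨0, by simp, fun t => ?_⟩
        unfold rsP
        rw [if_neg, Polynomial.eval_zero]
        intro h3
        apply hb
        intro b hb'
        have := h3 b hb'
        rwa [Function.update_of_ne hb'] at this
    choose P hP1 hP2 using hp
    have hGP : ∀ t, G (Function.update x a t) = (∏ h ∈ Finset.univ.erase i, P h).eval t := by
      intro t
      rw [Polynomial.eval_prod]
      exact Finset.prod_congr rfl (fun h _ => hP2 h t)
    have hdeg : (∏ h ∈ Finset.univ.erase i, P h).degree < s'.card := by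
      rw [hs']
      refine lt_of_le_of_lt Polynomial.degree_le_natDegree ?_
      norm_cast
      refine lt_of_le_of_lt (Polynomial.natDegree_prod_le _ _) ?_
      refine lt_of_le_of_lt (Finset.sum_le_card_nsmul _ _ (k - 1) (fun h _ => hP1 h)) ?_
      rw [Finset.card_erase_of_mem (Finset.mem_univ i), Finset.card_univ, Fintype.card_fin,
        smul_eq_mul]
      calc (r - 1) * (k - 1) ≤ r * (k - 1) := Nat.mul_le_mul_right _ (by omega)
        _ < r * k := Nat.mul_lt_mul_of_pos_left (by omega) (by omega)
    have h1 : ∑ z, (1 - rsP s' a) x z * G z = G x - ∑ z, rsP s' a x z * G z := by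
      simp only [Matrix.sub_apply, sub_mul, Finset.sum_sub_distrib, Matrix.one_apply]
      simp
    show ∑ z, (1 - rsP s' a) x z * G z = 0
    rw [h1, rsP_sum]
    simp only [hGP]
    rw [rsl_repr s' _ hdeg, ← hGP, Function.update_eq_self, sub_self]
  · intro f hf h0
    refine le_trans (Nat.pow_le_pow_left ?_ m) (rsP_dist s f hf h0)
    rw [hs]; omega
  · intro f hf h0
    refine le_trans (Nat.pow_le_pow_left ?_ m) (rsP_dist s' f hf h0)
    rw [hs']
  · intro j a
    funext x
    show ∑ z, rsP s a x z * ∏ b, rsl s (z b) (j b) = _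
    rw [rsP_sum]
    have e : ∀ t, ∏ b, rsl s (Function.update x a t b) (j b) =
        rsl s t (j a) * ∏ b ∈ Finset.univ.erase a, rsl s (x b) (j b) := by
      intro t
      rw [← Finset.mul_prod_erase Finset.univ _ (Finset.mem_univ a), Function.update_self]
      congr 1
      refine Finset.prod_congr rfl (fun b hb => ?_)
      rw [Function.update_of_ne (Finset.ne_of_mem_erase hb)]
    simp only [e]
    have e2 : ∑ t, rsl s (x a) t * rsl s t (j a) = rsl s (x a) (j a) := by
      have := rsl_repr s (Lagrange.basis s id (j a : K)) (by
        rw [Lagrange.degree_basis (Function.injective_id.injOn) (j a).2]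
        norm_cast
        omega) (x a)
      simpa [rsl] using this
    rw [← Finset.mul_prod_erase Finset.univ _ (Finset.mem_univ a)]
    simp only [← mul_assoc]
    rw [← Finset.sum_mul, e2]
  · intro j j'
    have e : ∀ a, rsl s (j' a : K) (j a : K) = if j a = j' a then 1 else 0 := by
      intro a
      simp only [rsl, if_pos (j a).2]
      by_cases h : j a = j' a
      · rw [if_pos h, ← h]
        exact Lagrange.eval_basis_self (v := id) (Function.injective_id.injOn) (j a).2
      · rw [if_neg h]
        exact Lagrange.eval_basis_of_ne (v := id) (fun h' => h (Subtype.ext h')) (j' a).2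
    simp only [e]
    rw [Fintype.prod_ite_zero]
    simp [funext_iff]

end RSInst
lemma Sys.descendFin {r : ℕ} {F K : Type} [Field F] [Field K] [Algebra F K] {e : ℕ}
    (b : Module.Basis (Fin e) F K) {ι RX RZ J : Type} [Fintype ι] [Fintype RX]
    [Fintype RZ] [DecidableEq J] {w d s : ℕ} (eJ : Fin s ≃ J) (H : Sys r K ι RX RZ J w d) :
    ∃ N mX mZ : ℕ, N = Fintype.card ι * (e ^ r + e) ∧
      Sys r F (Fin N) (Fin mX) (Fin mZ) (Fin s) (w * e * (e ^ r + 1) + e ^ r + 2) d := by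
  refine ⟨Fintype.card ((ι × (Fin r → Fin e)) ⊕ (ι × Fin e)), _, _, ?_,
    (H.descend b).reindex (Fintype.equivFin _).symm (Fintype.equivFin _).symm
    (Fintype.equivFin _).symm eJ⟩
  simp [mul_add]

/-- The construction, with all sizes explicit. -/
theorem sysF (F : Type) [Field F] [Fintype F] (r k m e : ℕ) (hr : 2 ≤ r) (hk : 1 ≤ k)
    (hm : 0 < m) (he : 0 < e) (Q ν I w0 w1 : ℕ) (hQ : Q = Fintype.card F ^ e) (hQk : r * k ≤ Q)
    (hν : ν = m * Q * (2 * m + 1)) (hI : I = r * (Q ^ m * (2 * m + 1)) ^ r)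
    (hw0 : w0 = r * r * ν ^ r + 1) (hw1 : w1 = r.factorial * ν ^ (r * r)) :
    ∃ N mX mZ : ℕ, I ≤ N ∧ N ≤ (w1 + 1) * I * (e ^ r + e) ∧
      Sys r F (Fin N) (Fin mX) (Fin mZ) (Fin ((k ^ m) ^ r))
        ((w0 * (w1 + 1) + w1 + 2) * e * (e ^ r + 1) + e ^ r + 2) ((Q - r * k) ^ m) := by
  classical
  obtain ⟨p, hp⟩ := CharP.exists F
  haveI : Fact p.Prime := ⟨CharP.char_is_prime F p⟩
  haveI : NeZero e := ⟨he.ne'⟩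
  let K := FiniteField.Extension F p e
  letI : Fintype K := Fintype.ofFinite K
  have hK : Fintype.card K = Q := by
    rw [hQ, ← Nat.card_eq_fintype_card, ← Nat.card_eq_fintype_card,
      FiniteField.natCard_extension F p e]
  let b : Module.Basis (Fin e) F K :=
    Module.finBasisOfFinrankEq F K (FiniteField.finrank_extension F p e)
  obtain ⟨s, hs, ⟨D⟩⟩ := rsDir (K := K) (m := m) (r := r) (k := k) hr hk hm (by rw [hK]; exact hQk)
  rw [hK, ← hν] at D
  obtain ⟨T, iT, hT, H⟩ := D.toSys hr w0 w1 hw0 hw1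
  have hcI : Fintype.card (Fin r × (Fin r → GU K m)) = I := by
    rw [hI, Fintype.card_prod, Fintype.card_fun, Fintype.card_fin]
    congr 2
    unfold GU
    simp only [Fintype.card_sum, Fintype.card_prod, Fintype.card_fin, Fintype.card_fun, hK]
    ring
  rw [hcI] at hT
  have hJ : Fintype.card (Fin r → Fin m → s) = (k ^ m) ^ r := by
    simp [hs]
  obtain ⟨N, mX, mZ, hN, H2⟩ := H.descendFin b (Fintype.equivFinOfCardEq hJ).symm
  rw [Fintype.card_sum, hcI] at hN
  refine ⟨N, mX, mZ, ?_, ?_, H2⟩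
  · have : 1 ≤ e ^ r + e := by omega
    rw [hN]
    nlinarith
  · rw [hN]
    refine Nat.mul_le_mul_right _ ?_
    linarith
section Numerics

lemma num_pow {m a b x y : ℕ} (hx : x ≤ m ^ a) (hy : y ≤ m ^ b) : x * y ≤ m ^ (a + b) := by
  rw [pow_add]; exact Nat.mul_le_mul hx hy

lemma num_add {m a x y : ℕ} (hm : 2 ≤ m) (hx : x ≤ m ^ a) (hy : y ≤ m ^ a) :
    x + y ≤ m ^ (a + 1) := by
  rw [pow_succ]; nlinarith

lemma num_mono {m a b x : ℕ} (hm : 2 ≤ m) (hx : x ≤ m ^ a) (hab : a ≤ b) : x ≤ m ^ b :=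
  hx.trans (Nat.pow_le_pow_right (by omega) hab)

lemma num_ppow {m a x : ℕ} (n : ℕ) (hx : x ≤ m ^ a) : x ^ n ≤ m ^ (a * n) := by
  rw [pow_mul]; exact Nat.pow_le_pow_left hx n

/-- All polylogarithmic quantities are bounded by a fixed power of `m`. -/
lemma num_bounds (r C0 : ℕ) : ∃ C : ℕ, ∀ m e Q ν I w0 w1 N : ℕ, 4 ≤ m → r ≤ m →
    e ≤ m ^ 2 → Q = m ^ (C0 + 2) → ν = m * Q * (2 * m + 1) →
    I = r * (Q ^ m * (2 * m + 1)) ^ r → w0 = r * r * ν ^ r + 1 →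
    w1 = r.factorial * ν ^ (r * r) → N ≤ (w1 + 1) * I * (e ^ r + e) →
    (w0 * (w1 + 1) + w1 + 2) * e * (e ^ r + 1) + e ^ r + 2 ≤ m ^ C ∧
      N ≤ m ^ C * Q ^ (m * r) := by
  let A := C0 + 5
  let B := r + A * (r * r) + 1
  let W := A * r + 4 + B
  refine ⟨W + 4 * r + 20, ?_⟩
  intro m e Q ν I w0 w1 N hm hrm he hQ hν hI hw0 hw1 hN
  have h2 : 2 ≤ m := by omega
  have one : ∀ n, 1 ≤ m ^ n := fun n => Nat.one_le_pow _ _ (by omega)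
  have h2m : 2 * m + 1 ≤ m ^ 2 := by nlinarith
  have hm1 : m ≤ m ^ 1 := by simp
  have hr1 : r ≤ m ^ 1 := by simpa using hrm
  have hνb : ν ≤ m ^ A := by
    rw [hν]
    exact num_mono h2 (num_pow (num_pow hm1 hQ.le) h2m) (by simp only [A]; omega)
  have hw0b : w0 ≤ m ^ (A * r + 3) := by
    rw [hw0]
    have := num_add h2 (num_pow (num_pow hr1 hr1) (num_ppow r hνb)) (one _)
    exact num_mono h2 this (by omega)
  have hw1b : w1 + 1 ≤ m ^ B := by
    rw [hw1]
    have hf : r.factorial ≤ m ^ (1 * r) := (Nat.factorial_le_pow r).trans (num_ppow r hr1)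
    have := num_add h2 (num_pow hf (num_ppow (r * r) hνb)) (one _)
    exact num_mono h2 this (by simp only [B]; omega)
  have hW : w0 * (w1 + 1) + w1 + 2 ≤ m ^ (W + 1) := by
    have a1 : w0 * (w1 + 1) ≤ m ^ (W - 1) := num_mono h2 (num_pow hw0b hw1b) (by simp only [W]; omega)
    have a2 : w1 + 1 ≤ m ^ (W - 1) := num_mono h2 hw1b (by simp only [W]; omega)
    have a3 := num_add h2 a1 a2
    have a4 := num_add h2 a3 (one _)
    refine le_trans (by omega) (num_mono h2 a4 (by simp only [W]; omega))
  have her := num_ppow r he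
  have her1 : e ^ r + 1 ≤ m ^ (2 * r + 1) := num_add h2 her (one _)
  constructor
  · have b1 := num_pow (num_pow hW he) her1
    have b2 := num_add h2 b1 (num_mono h2 her1 (by omega))
    have b3 := num_add h2 b2 (one _)
    refine le_trans (by omega) (num_mono h2 b3 (by omega))
  · have c1 : e ^ r + e ≤ m ^ (2 * r + 3) :=
      num_add h2 (num_mono h2 her (by omega)) (num_mono h2 he (by omega))
    have c2 : r * (2 * m + 1) ^ r ≤ m ^ (1 + 2 * r) := num_pow hr1 (num_ppow r h2m)
    have c3 := num_pow (num_pow hw1b c2) c1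
    calc N ≤ (w1 + 1) * I * (e ^ r + e) := hN
      _ = (w1 + 1) * (r * (2 * m + 1) ^ r) * (e ^ r + e) * Q ^ (m * r) := by
        rw [hI, mul_pow, ← pow_mul]; ring
      _ ≤ _ := Nat.mul_le_mul_right _ (num_mono h2 c3 (by simp only [W]; omega))

lemma num_dist {Q k r m : ℕ} (hm : 1 ≤ m) (hQ : 0 < Q) (h : 2 * r * k * m ≤ Q) :
    (Q : ℝ) ^ m ≤ 2 * (((Q - r * k) ^ m : ℕ) : ℝ) := by
  have h1 : r * k ≤ Q := by nlinarith [Nat.zero_le (r * k)]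
  have hQ' : (0 : ℝ) < Q := by exact_mod_cast hQ
  rw [Nat.cast_pow, Nat.cast_sub h1]
  set x : ℝ := ((r * k : ℕ) : ℝ) / Q with hx
  have hx0 : 0 ≤ x := by positivity
  have hx1 : x ≤ 1 := by rw [hx, div_le_one hQ']; exact_mod_cast h1
  have e : (Q : ℝ) - ((r * k : ℕ) : ℝ) = Q * (1 + (-x)) := by
    rw [hx]; field_simp; ring
  rw [e, mul_pow]
  have hb := one_add_mul_le_pow (a := -x) (by linarith) m
  have hmx : (m : ℝ) * x ≤ 1 / 2 := by
    rw [hx, ← mul_div_assoc, div_le_iff₀ hQ']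
    have : ((2 * r * k * m : ℕ) : ℝ) ≤ Q := by exact_mod_cast h
    push_cast at this ⊢
    nlinarith
  have : (1 : ℝ) / 2 ≤ (1 + -x) ^ m := by nlinarith
  have hp : (0 : ℝ) < (Q : ℝ) ^ m := by positivity
  nlinarith

end Numerics
/-- main quantum LDPC theorem; Theorem 1.1 / Corollary 6.2.  For every
`ε > 0`, `r ≥ 2` and finite field `F = F_q`, there is a constant `c ≥ 1` such that for
infinitely many `N` the following holds: there are `r` quantum CSS codes of length `N`
over `F`, given by parity-check matrices `H_X^{(h)}, H_Z^{(h)}` with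
`H_Z^{(h)} (H_X^{(h)})ᵀ = 0` of locality at most `(log N)^c`, each of dimension at least
`N^{1-ε}` and distance at least `N^{1/r}/(log N)^c`; moreover, with `B_h = im (H_X^{(h)})ᵀ`
and `Z_h = ker H_Z^{(h)}`, there are coefficients `a_j ∈ F` and cohomology subspaces
`H'_h ⊆ Z_h/B_h` — represented by intermediate subspaces `W_h` with `B_h ≤ W_h ≤ Z_h` —
such that the `r`-linear form `ζ(z⁽¹⁾,…,z⁽ʳ⁾) = ∑_j a_j · z⁽¹⁾_j ⋯ z⁽ʳ⁾_j` is
coboundary-invariant on `H'` and the induced form has subrank at least `N^{1-ε}`. -/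
theorem stmt16 (ε : ℝ) (hε : 0 < ε) (r : ℕ) (hr : 2 ≤ r)
    (F : Type) [Field F] [Fintype F] :
    ∃ c : ℕ, 1 ≤ c ∧ ∀ N0 : ℕ, ∃ N : ℕ, N0 ≤ N ∧
      ∃ (mX mZ : ℕ) (HX : Fin r → Matrix (Fin mX) (Fin N) F)
        (HZ : Fin r → Matrix (Fin mZ) (Fin N) F),
        (∀ h, HZ h * (HX h)ᵀ = 0) ∧
        (∀ h, locLE (HX h) ((Real.log N) ^ c) ∧ locLE (HZ h) ((Real.log N) ^ c)) ∧
        (∀ h, (N : ℝ) ^ ((1 : ℝ) - ε) ≤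
          (Module.finrank F (LinearMap.ker (HZ h).mulVecLin) : ℝ) -
            (Module.finrank F (dualCode F (LinearMap.ker (HX h).mulVecLin)) : ℝ)) ∧
        (∀ h, ∀ x : Fin N → F,
          ((x ∈ LinearMap.ker (HX h).mulVecLin ∧
              x ∉ dualCode F (LinearMap.ker (HZ h).mulVecLin)) ∨
           (x ∈ LinearMap.ker (HZ h).mulVecLin ∧
              x ∉ dualCode F (LinearMap.ker (HX h).mulVecLin))) →
          (N : ℝ) ^ ((1 : ℝ) / r) / (Real.log N) ^ c ≤ (hwt x : ℝ)) ∧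
        ∃ (a : Fin N → F) (W : Fin r → Submodule F (Fin N → F)),
          (∀ h, LinearMap.range ((HX h)ᵀ.mulVecLin) ≤ W h ∧
            W h ≤ LinearMap.ker (HZ h).mulVecLin) ∧
          (∀ z b : Fin r → (Fin N → F), (∀ h, z h ∈ W h) →
            (∀ h, b h ∈ LinearMap.range ((HX h)ᵀ.mulVecLin)) →
            (∑ j, a j * ∏ h, (z h + b h) j) = ∑ j, a j * ∏ h, z h j) ∧
          ∃ s : ℕ, (N : ℝ) ^ ((1 : ℝ) - ε) ≤ (s : ℝ) ∧
            ∃ v : Fin r → Fin s → (Fin N → F), (∀ h j, v h j ∈ W h) ∧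
              ∀ jj : Fin r → Fin s,
                (∑ j, a j * ∏ h, v h (jj h) j) =
                  if ∀ h, jj h = jj ⟨0, by omega⟩ then 1 else 0 := by
  obtain ⟨C0, hC0⟩ := exists_nat_ge (3 / ε)
  obtain ⟨C, hC⟩ := num_bounds r C0
  refine ⟨C + 1, by omega, fun N0 => ?_⟩
  have hq : 2 ≤ Fintype.card F := Fintype.one_lt_card
  obtain ⟨l, hl⟩ : ∃ l, l = 2 * r + C + C0 + N0 + 10 := ⟨_, rfl⟩
  obtain ⟨m, hm⟩ : ∃ m, m = Fintype.card F ^ l := ⟨_, rfl⟩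
  have hlm : l < m := by rw [hm]; exact Nat.lt_pow_self hq
  obtain ⟨Q, hQ⟩ : ∃ Q, Q = m ^ (C0 + 2) := ⟨_, rfl⟩
  have hQe : Q = Fintype.card F ^ ((C0 + 2) * l) := by
    rw [hQ, hm, ← pow_mul, mul_comm]
  have he : (C0 + 2) * l ≤ m ^ 2 := by
    rw [pow_two]; exact Nat.mul_le_mul (by omega) hlm.le
  have hk : 1 ≤ m ^ C0 := Nat.one_le_pow _ _ (by omega)
  have h2 : 2 * r * m ^ C0 * m ≤ Q := by
    rw [hQ, pow_add, pow_two]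
    have : 2 * r ≤ m := by omega
    nlinarith [Nat.mul_le_mul_right (m ^ C0 * m) this]
  have hrk : r * m ^ C0 ≤ Q := by nlinarith [Nat.zero_le (r * m ^ C0)]
  have hmQ : m ≤ Q := by rw [hQ]; exact Nat.le_self_pow (by omega) m
  obtain ⟨N, mX, mZ, hIN, hN, H⟩ := sysF F r (m ^ C0) m ((C0 + 2) * l) hr hk (by omega)
    (Nat.mul_pos (by omega) (by omega)) Q _ _ _ _ hQe hrk rfl rfl rfl rfl
  obtain ⟨hw, hNC⟩ := hC m _ Q _ _ _ _ N (by omega) (by omega) he hQ rfl rfl rfl rfl hN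
  have hQN : Q ^ (m * r) ≤ N := by
    refine le_trans ?_ hIN
    rw [mul_pow, ← pow_mul, ← mul_assoc, mul_comm r, mul_assoc]
    exact Nat.le_mul_of_pos_right _ (by positivity)
  have hmN : m ≤ N := by
    refine hmQ.trans (le_trans (Nat.le_self_pow ?_ Q) hQN)
    exact Nat.mul_ne_zero (by omega) (by omega)
  have hm4 : (4 : ℝ) ≤ m := by exact_mod_cast (by omega : 4 ≤ m)
  have hN1 : (1 : ℝ) ≤ N := by exact_mod_cast (by omega : 1 ≤ N)
  have hlog : (m : ℝ) ≤ Real.log N := by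
    have h3 : Real.exp 1 ≤ Q := by
      have : (4 : ℝ) ≤ Q := by exact_mod_cast (by omega : 4 ≤ Q)
      linarith [Real.exp_one_lt_d9]
    rw [Real.le_log_iff_exp_le (by linarith)]
    calc Real.exp m = Real.exp 1 ^ m := by rw [← Real.exp_nat_mul]; simp
      _ ≤ (Q : ℝ) ^ m := pow_le_pow_left₀ (Real.exp_pos _).le h3 m
      _ ≤ (Q : ℝ) ^ (m * r) := pow_le_pow_right₀ (by linarith [Real.add_one_le_exp 1])
          (Nat.le_mul_of_pos_right _ (by omega))
      _ ≤ N := by exact_mod_cast hQN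
  have hm0 : (0 : ℝ) ≤ m := by linarith
  have hlog1 : (1 : ℝ) ≤ Real.log N := by linarith
  have hr0 : (r : ℝ) ≠ 0 := by exact_mod_cast (by omega : r ≠ 0)
  refine ⟨N, by omega, mX, mZ, Sys.final hr (by omega) H ε (C + 1) ?_ ?_ ?_⟩
  · calc _ ≤ ((m ^ C : ℕ) : ℝ) := by exact_mod_cast hw
      _ = (m : ℝ) ^ C := by push_cast; rfl
      _ ≤ (Real.log N) ^ C := pow_le_pow_left₀ hm0 hlog C
      _ ≤ (Real.log N) ^ (C + 1) := pow_le_pow_right₀ hlog1 (by omega)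
  · rw [div_le_iff₀ (by positivity)]
    have hd := num_dist (Q := Q) (k := m ^ C0) (r := r) (m := m) (by omega) (by omega) h2
    have e1 : (N : ℝ) ≤ ((m : ℝ) ^ C * (Q : ℝ) ^ m) ^ r := by
      calc (N : ℝ) ≤ (m : ℝ) ^ C * (Q : ℝ) ^ (m * r) := by exact_mod_cast hNC
        _ ≤ ((m : ℝ) ^ C) ^ r * (Q : ℝ) ^ (m * r) := by
          refine mul_le_mul_of_nonneg_right ?_ (by positivity)
          exact le_self_pow₀ (one_le_pow₀ (by linarith)) (by omega)
        _ = _ := by rw [mul_pow, ← pow_mul (Q : ℝ)]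
    have e2 : (N : ℝ) ^ ((1 : ℝ) / r) ≤ (m : ℝ) ^ C * (Q : ℝ) ^ m := by
      calc (N : ℝ) ^ ((1 : ℝ) / r) ≤ (((m : ℝ) ^ C * (Q : ℝ) ^ m) ^ r) ^ ((1 : ℝ) / r) :=
            Real.rpow_le_rpow (by positivity) e1 (by positivity)
        _ = _ := by
          rw [one_div]
          exact Real.pow_rpow_inv_natCast (by positivity) (by omega)
    set d : ℝ := (((Q - r * m ^ C0) ^ m : ℕ) : ℝ) with hdd
    have hd0 : 0 ≤ d := by positivity
    calc (N : ℝ) ^ ((1 : ℝ) / r) ≤ (m : ℝ) ^ C * (Q : ℝ) ^ m := e2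
      _ ≤ (m : ℝ) ^ C * (m * d) := by
        refine mul_le_mul_of_nonneg_left (hd.trans ?_) (by positivity)
        exact mul_le_mul_of_nonneg_right (by linarith) hd0
      _ = d * (m : ℝ) ^ (C + 1) := by ring
      _ ≤ d * (Real.log N) ^ (C + 1) :=
        mul_le_mul_of_nonneg_left (pow_le_pow_left₀ hm0 hlog _) hd0
  · have hs : (1 : ℝ) ≤ (((m ^ C0) ^ m) ^ r : ℕ) := by
      exact_mod_cast Nat.one_le_pow _ _ (Nat.one_le_pow _ _ hk)
    rcases le_or_gt 1 ε with h1 | h1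
    · refine le_trans (Real.rpow_le_one_of_one_le_of_nonpos hN1 (by linarith)) hs
    have e1 : N ≤ m ^ ((C0 + 3) * (m * r)) := by
      calc N ≤ m ^ C * Q ^ (m * r) := hNC
        _ = m ^ (C + (C0 + 2) * (m * r)) := by rw [hQ, ← pow_mul, pow_add]
        _ ≤ _ := by
          refine Nat.pow_le_pow_right (by omega) ?_
          have : C ≤ m * r := le_trans (by omega) (Nat.le_mul_of_pos_right m (by omega : 0 < r))
          nlinarith
    have e2 : (N : ℝ) ≤ (m : ℝ) ^ (((C0 + 3) * (m * r) : ℕ) : ℝ) := by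
      rw [Real.rpow_natCast]; exact_mod_cast e1
    calc (N : ℝ) ^ (1 - ε) ≤ ((m : ℝ) ^ (((C0 + 3) * (m * r) : ℕ) : ℝ)) ^ (1 - ε) :=
          Real.rpow_le_rpow (by positivity) e2 (by linarith)
      _ = (m : ℝ) ^ ((((C0 + 3) * (m * r) : ℕ) : ℝ) * (1 - ε)) := (Real.rpow_mul hm0 _ _).symm
      _ ≤ (m : ℝ) ^ (((C0 * m * r : ℕ)) : ℝ) := by
        refine Real.rpow_le_rpow_of_exponent_le (by linarith) ?_
        push_cast
        have h3 : 3 ≤ C0 * ε := by rwa [div_le_iff₀ hε] at hC0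
        have h4 : ((C0 : ℝ) + 3) * (1 - ε) ≤ C0 := by nlinarith
        have h5 : (0 : ℝ) ≤ m * r := by positivity
        nlinarith [mul_le_mul_of_nonneg_right h4 h5]
      _ = (((m ^ C0) ^ m) ^ r : ℕ) := by
        rw [Real.rpow_natCast, pow_mul, pow_mul]; push_cast; rfl
end

section
/- For every real ε > 0 and every integer r ≥ 1, there exist a constant c ≥ 1 and q₀ ∈ ℕ such that for every prime power q ≥ q₀ the following holds. There exist an integer N > q and parity-check matrices H and H' over F_q, each with N columns and locality at most (log N)^c, such that the classical codes C = ker H ⊆ F_q^N and C' = ker H' ⊆ F_q^N satisfy: dim C ≥ N^{1−ε}; every nonzero codeword of C and of C' has Hamming weight at least N / (log N)^c; C is locally testable with soundness (log N)^{−c}, meaning that for every x ∈ F_q^N, |Hx| ≥ (log N)^{−c} · min_{z∈C} |x − z|; and C^{*r} ⊆ C', where C^{*r} denotes the span of all coordinatewise products c₁ * ⋯ * c_r with each c_i ∈ C. -/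
open scoped BigOperators
open Matrix

open scoped Classical in
/-- Syndrome matrix of the product of the code `ker P` with the code `ker H`. -/
noncomputable def stepM {A X R F : Type} [Field F] (P : Matrix A A F) (H : Matrix R X F) :
    Matrix ((A × X) ⊕ (A × R)) (A × X) F := fun ρ c =>
  match ρ with
  | Sum.inl (b, y) => if y = c.2 then P b c.1 else 0
  | Sum.inr (a, s) => if a = c.1 then H s c.2 else 0

open scoped Classical in
lemma hwt_eq {ι F : Type} [Zero F] [Fintype ι] (x : ι → F) :
    hwt x = ∑ i, if x i = 0 then 0 else 1 := by
  unfold hwt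
  rw [Nat.subtype_card (Finset.univ.filter (fun i => x i ≠ 0)) (by intro i; simp),
    Finset.card_filter]
  refine Finset.sum_congr rfl fun i _ => ?_
  by_cases h : x i = 0 <;> simp [h]

set_option linter.unusedSectionVars false

section step
variable {A X R F : Type} [Field F] [Fintype A] [Fintype X] [Fintype R]
  (P : Matrix A A F) (H : Matrix R X F)

lemma stepM_inl (x : A × X → F) (b : A) (y : X) :
    (stepM P H *ᵥ x) (Sum.inl (b, y)) = (P *ᵥ fun a => x (a, y)) b := by
  classical
  simp only [Matrix.mulVec, dotProduct, stepM, Fintype.sum_prod_type]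
  refine Finset.sum_congr rfl fun a _ => ?_
  simp

lemma stepM_inr (x : A × X → F) (a : A) (s : R) :
    (stepM P H *ᵥ x) (Sum.inr (a, s)) = (H *ᵥ fun y => x (a, y)) s := by
  classical
  simp only [Matrix.mulVec, dotProduct, stepM, Fintype.sum_prod_type_right]
  refine Finset.sum_congr rfl fun a _ => ?_
  simp

lemma stepM_ker (x : A × X → F) : stepM P H *ᵥ x = 0 ↔
    (∀ y, P *ᵥ (fun a => x (a, y)) = 0) ∧ (∀ a, H *ᵥ (fun y => x (a, y)) = 0) := by
  constructor
  · intro h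
    refine ⟨fun y => funext fun b => ?_, fun a => funext fun s => ?_⟩
    · rw [← stepM_inl P H, h]; rfl
    · rw [← stepM_inr P H, h]; rfl
  · rintro ⟨h1, h2⟩
    funext ρ
    rcases ρ with ⟨b, y⟩ | ⟨a, s⟩
    · rw [stepM_inl, h1]; rfl
    · rw [stepM_inr, h2]; rfl

lemma hwt_prod (x : A × X → F) : hwt x = ∑ a, hwt (fun y => x (a, y)) := by
  classical
  simp only [hwt_eq, Fintype.sum_prod_type]

lemma hwt_prod' (x : A × X → F) : hwt x = ∑ y, hwt (fun a => x (a, y)) := by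
  classical
  simp only [hwt_eq, Fintype.sum_prod_type_right]

lemma hwt_step (x : A × X → F) : hwt (stepM P H *ᵥ x) =
    ∑ y, hwt (P *ᵥ (fun a => x (a, y))) + ∑ a, hwt (H *ᵥ (fun y => x (a, y))) := by
  classical
  rw [hwt_eq, Fintype.sum_sum_type]
  congr 1
  · rw [Fintype.sum_prod_type_right]
    simp only [stepM_inl, hwt_eq]
  · rw [Fintype.sum_prod_type]
    simp only [stepM_inr, hwt_eq]

lemma hwt_eq_zero {ι : Type} [Fintype ι] (x : ι → F) : hwt x = 0 ↔ x = 0 := by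
  classical
  rw [hwt_eq]
  simp [funext_iff]

lemma hwt_le_card {ι : Type} [Fintype ι] (x : ι → F) : hwt x ≤ Fintype.card ι := by
  classical
  rw [hwt_eq, Fintype.card_eq_sum_ones]
  exact Finset.sum_le_sum fun i _ => by split_ifs <;> simp

/-- locality, rows -/
lemma stepM_row {n : ℕ} (hA : Fintype.card A ≤ n)
    (h : ∀ i, Nat.card {j | H i j ≠ 0} ≤ n) :
    ∀ i, Nat.card {j | stepM P H i j ≠ 0} ≤ n := by
  classical
  rintro (⟨b, y⟩ | ⟨a, s⟩)
  · refine le_trans ?_ hA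
    rw [← Nat.card_eq_fintype_card]
    refine Nat.card_le_card_of_injective (fun c => c.1.1) ?_
    rintro ⟨⟨a, y1⟩, h1⟩ ⟨⟨a2, y2⟩, h2⟩ h3
    simp only [stepM, Set.mem_ofPred_eq, ne_eq, ite_eq_right_iff, Classical.not_imp] at h1 h2 h3
    simp [h3, ← h1.1, ← h2.1]
  · refine le_trans ?_ (h s)
    refine Nat.card_le_card_of_injective (fun c => ⟨c.1.2, ?_⟩) ?_
    · rcases c with ⟨⟨a1, y1⟩, h1⟩
      simp only [stepM, Set.mem_ofPred_eq, ne_eq, ite_eq_right_iff, Classical.not_imp] at h1 ⊢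
      exact h1.2
    rintro ⟨⟨a, y1⟩, h1⟩ ⟨⟨a2, y2⟩, h2⟩ h3
    simp only [stepM, Set.mem_ofPred_eq, ne_eq, ite_eq_right_iff, Classical.not_imp,
      Subtype.mk.injEq] at h1 h2 h3
    simp [h3, ← h1.1, ← h2.1]

/-- locality, columns -/
lemma stepM_col {n m : ℕ} (hA : Fintype.card A ≤ n)
    (h : ∀ j, Nat.card {i | H i j ≠ 0} ≤ m) :
    ∀ j, Nat.card {i | stepM P H i j ≠ 0} ≤ n + m := by
  classical
  rintro ⟨a0, y0⟩
  have h0 := h y0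
  change hwt (fun i => H i y0) ≤ m at h0
  change hwt (fun i => stepM P H i (a0, y0)) ≤ n + m
  rw [hwt_eq] at h0 ⊢
  rw [Fintype.sum_sum_type]
  refine add_le_add (le_trans ?_ hA) (le_trans (le_of_eq ?_) h0)
  · rw [Fintype.sum_prod_type, Fintype.card_eq_sum_ones]
    refine Finset.sum_le_sum fun b _ => ?_
    rw [Finset.sum_eq_single y0]
    · split_ifs <;> simp
    · intro y _ hy
      simp [stepM, hy]
    · simp
  · rw [Fintype.sum_prod_type, Finset.sum_eq_single a0]
    · simp [stepM]
    · intro y _ hy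
      simp [stepM, hy]
    · simp

/-- distance -/
lemma stepM_dist {d e : ℕ} (hP : ∀ w, P *ᵥ w = 0 → w ≠ 0 → d ≤ hwt w)
    (hH : ∀ x, H *ᵥ x = 0 → x ≠ 0 → e ≤ hwt x) :
    ∀ x, stepM P H *ᵥ x = 0 → x ≠ 0 → d * e ≤ hwt x := by
  classical
  intro x hx hne
  obtain ⟨h1, h2⟩ := (stepM_ker P H x).1 hx
  obtain ⟨⟨a0, y0⟩, h0⟩ := Function.ne_iff.1 hne
  have h3 := hP _ (h1 y0) (fun h => h0 (congrFun h a0))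
  rw [hwt_prod]
  rw [hwt_eq] at h3
  calc d * e ≤ (∑ a, if x (a, y0) = 0 then 0 else 1) * e := Nat.mul_le_mul_right _ h3
    _ = ∑ a, (if x (a, y0) = 0 then 0 else 1) * e := Finset.sum_mul _ _ _
    _ ≤ _ := Finset.sum_le_sum fun a _ => by
      split_ifs with h
      · simp
      · rw [one_mul]
        exact hH _ (h2 a) (fun hzero => h (congrFun hzero y0))

/-- `ker P` is an MDS code of dimension `k`. -/
structure IsMDS (P : Matrix A A F) (k : ℕ) : Prop where
  uniq : ∀ w, P *ᵥ w = 0 → ∀ S : Finset A, k ≤ S.card → (∀ a ∈ S, w a = 0) → w = 0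
  interp : ∀ S : Finset A, S.card = k → ∀ b ∈ S, ∃ w, P *ᵥ w = 0 ∧ w b = 1 ∧
    ∀ a ∈ S, a ≠ b → w a = 0

lemma IsMDS.dist {P : Matrix A A F} {k : ℕ} (h : IsMDS P k) :
    ∀ w, P *ᵥ w = 0 → w ≠ 0 → Fintype.card A - k ≤ hwt w := by
  classical
  intro w hw hne
  by_contra hlt
  push Not at hlt
  refine hne (h.uniq w hw (Finset.univ.filter (fun a => w a = 0)) ?_ (by simp))
  have : hwt w + (Finset.univ.filter (fun a => w a = 0)).card = Fintype.card A := by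
    rw [hwt_eq, Finset.card_filter, ← Finset.sum_add_distrib, Fintype.card_eq_sum_ones]
    exact Finset.sum_congr rfl fun i _ => by split_ifs <;> simp
  omega

lemma interp_ker {ι : Type} [Fintype ι] {P : Matrix A A F} {H : Matrix R X F}
    (w : ι → A → F) (hw : ∀ b, P *ᵥ w b = 0) (z : ι → X → F) (hz : ∀ b, H *ᵥ z b = 0) :
    stepM P H *ᵥ (fun p => ∑ b, w b p.1 * z b p.2) = 0 := by
  rw [stepM_ker]
  constructor
  · intro y
    have : (fun a => ∑ b, w b a * z b y) = ∑ b, z b y • w b := by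
      funext a; simp [Finset.sum_apply, mul_comm]
    simp only [this, Matrix.mulVec_sum, Matrix.mulVec_smul, hw]
    simp
  · intro a
    have : (fun y => ∑ b, w b a * z b y) = ∑ b, w b a • z b := by
      funext a; simp [Finset.sum_apply]
    simp only [this, Matrix.mulVec_sum, Matrix.mulVec_smul, hz]
    simp

lemma stepM_finrank {P : Matrix A A F} {k : ℕ} (h : IsMDS P k) (hk : k ≤ Fintype.card A) :
    k * Module.finrank F (LinearMap.ker H.mulVecLin) ≤
      Module.finrank F (LinearMap.ker (stepM P H).mulVecLin) := by
  classical
  obtain ⟨S, -, hS⟩ := Finset.exists_subset_card_eq (s := (Finset.univ : Finset A)) hk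
  choose w hw1 hw2 hw3 using fun b : S => h.interp S hS b.1 b.2
  let L : (S → LinearMap.ker H.mulVecLin) →ₗ[F] LinearMap.ker (stepM P H).mulVecLin :=
    { toFun := fun z => ⟨fun p => ∑ b, w b p.1 * (z b).1 p.2, by
        rw [LinearMap.mem_ker, Matrix.mulVecLin_apply]
        exact interp_ker w hw1 (fun b => (z b).1) (fun b => (z b).2)⟩
      map_add' := by
        intro z z'
        ext p
        simp [mul_add, Finset.sum_add_distrib]
      map_smul' := by
        intro c z
        ext p
        simp [Finset.mul_sum, mul_left_comm] }
  have hL : Function.Injective L := by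
    rw [← LinearMap.ker_eq_bot, LinearMap.ker_eq_bot']
    intro z hz
    funext b
    ext y
    have h1 : ∑ b', w b' b.1 * (z b').1 y = 0 := congrFun (congrArg Subtype.val hz) (b.1, y)
    rw [Finset.sum_eq_single b] at h1
    · simpa [hw2] using h1
    · intro b' _ hb
      rw [hw3 b' b.1 b.2 (fun h => hb (Subtype.ext h.symm)), zero_mul]
    · simp
  have := LinearMap.finrank_le_finrank_of_injective hL
  rw [Module.finrank_pi_fintype] at this
  simpa [hS] using this

end step

section sound
variable {A X R F : Type} [Field F] [Fintype A] [Fintype X] [Fintype R]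

lemma sound_arith {T k K n s sc σ Vl U G e1 e2 : ℝ} (hT : 1 ≤ T) (hk : 1 ≤ k) (hK1 : 1 ≤ K)
    (hK : n ≤ K) (hcard : s + sc = n) (_hs0 : 0 ≤ s) (hsc0 : 0 ≤ sc) (hσ0 : 0 ≤ σ)
    (hVl0 : 0 ≤ Vl) (hU0 : 0 ≤ U) (hSbig : (T + 1) * k ≤ s) (hGle : (s - k) * G ≤ K * σ)
    (hσn : σ * n ≤ s * U) (he1 : e1 ≤ K * σ) (he2 : e2 ≤ sc * (G + Vl)) :
    e1 + e2 ≤ K * (1 + 1 / T) * (Vl + U) := by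
  have hsk : 0 < s - k := by nlinarith
  have hη : s ≤ (1 + 1 / T) * (s - k) := by
    have : (1 + 1 / T) * (s - k) - s = (s - (T + 1) * k) / T := by field_simp; ring
    have h2 : 0 ≤ (s - (T + 1) * k) / T := div_nonneg (by linarith) (by linarith)
    linarith
  have hmain : K * σ + sc * G ≤ K * (1 + 1 / T) * U := by
    refine le_of_mul_le_mul_right ?_ hsk
    have h1 : sc * ((s - k) * G) ≤ sc * (K * σ) := mul_le_mul_of_nonneg_left hGle hsc0
    have h2 : K * (σ * n) ≤ K * (s * U) := mul_le_mul_of_nonneg_left hσn (by linarith)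
    have h3 : (K * U) * s ≤ (K * U) * ((1 + 1 / T) * (s - k)) :=
      mul_le_mul_of_nonneg_left hη (by positivity)
    have h4 : 0 ≤ K * σ * k := by positivity
    rw [← hcard] at h2
    linarith
  have h5 : sc * Vl ≤ K * (1 + 1 / T) * Vl := by
    refine mul_le_mul_of_nonneg_right ?_ hVl0
    have : 0 ≤ K * (1 / T) := by positivity
    linarith
  linarith

set_option maxHeartbeats 1000000 in
lemma stepM_sound {P : Matrix A A F} {H : Matrix R X F} {k : ℕ} (hP : IsMDS P k) (T : ℕ)
    (hT : 1 ≤ T) (hk : 1 ≤ k) (hkn : (T + 1) ^ 2 * k ≤ Fintype.card A)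
    {K τ τ' D : ℝ} (hK : (Fintype.card A : ℝ) ≤ K) (hτ : 0 < τ)
    (hτ' : τ' * (T + 1) ≤ τ * Fintype.card A * T)
    (hD : ∀ x, H *ᵥ x = 0 → x ≠ 0 → D ≤ (hwt x : ℝ)) (hKD : K * τ' < D)
    (ih : ∀ x, (hwt (H *ᵥ x) : ℝ) ≤ τ →
      ∃ z, H *ᵥ z = 0 ∧ (hwt (x - z) : ℝ) ≤ K * hwt (H *ᵥ x)) :
    ∀ x, (hwt (stepM P H *ᵥ x) : ℝ) ≤ τ' →
      ∃ z, stepM P H *ᵥ z = 0 ∧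
        (hwt (x - z) : ℝ) ≤ K * (1 + 1 / T) * hwt (stepM P H *ᵥ x) := by
  classical
  intro x hx
  set n := Fintype.card A with hn
  have hn1 : 1 ≤ n := le_trans (Nat.mul_pos (by positivity) hk) hkn
  have hn1R : (1 : ℝ) ≤ n := by exact_mod_cast hn1
  have hT1R : (1 : ℝ) ≤ T := by exact_mod_cast hT
  have hk1R : (1 : ℝ) ≤ k := by exact_mod_cast hk
  have hK1 : 1 ≤ K := le_trans hn1R hK
  set v : A → ℝ := fun a => (hwt (H *ᵥ (fun y => x (a, y))) : ℝ) with hv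
  set l : X → ℝ := fun y => (hwt (P *ᵥ (fun a => x (a, y))) : ℝ) with hl
  have hv0 : ∀ a, 0 ≤ v a := fun a => Nat.cast_nonneg _
  have hl0 : ∀ y, 0 ≤ l y := fun a => Nat.cast_nonneg _
  have hl1 : ∀ y, P *ᵥ (fun a => x (a, y)) ≠ 0 → 1 ≤ l y := by
    intro y hy
    have : hwt (P *ᵥ (fun a => x (a, y))) ≠ 0 := fun h => hy ((hwt_eq_zero _).1 h)
    have : 1 ≤ hwt (P *ᵥ (fun a => x (a, y))) := by omega
    simp only [hl]
    exact_mod_cast this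
  have hV : (hwt (stepM P H *ᵥ x) : ℝ) = ∑ y, l y + ∑ a, v a := by
    rw [hwt_step]; push_cast; rfl
  rw [hV] at hx ⊢
  set Vl := ∑ y, l y with hVl
  set U := ∑ a, v a with hU
  have hVl0 : 0 ≤ Vl := Finset.sum_nonneg fun y _ => hl0 y
  have hU0 : 0 ≤ U := Finset.sum_nonneg fun y _ => hv0 y
  set S := Finset.univ.filter (fun a => v a ≤ τ) with hS
  set Sc := Finset.univ.filter (fun a => ¬ v a ≤ τ) with hSc
  have hcard : S.card + Sc.card = n := by
    rw [hS, hSc, Finset.card_filter_add_card_filter_not, Finset.card_univ]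
  have hcardR : (S.card : ℝ) + Sc.card = n := by exact_mod_cast hcard
  have hsplit : ∀ g : A → ℝ, ∑ a ∈ S, g a + ∑ a ∈ Sc, g a = ∑ a, g a := fun g =>
    Finset.sum_filter_add_sum_filter_not _ _ _
  set σ := ∑ a ∈ S, v a with hσ
  have hσ0 : 0 ≤ σ := Finset.sum_nonneg fun y _ => hv0 y
  have hScτ : (Sc.card : ℝ) * τ ≤ ∑ a ∈ Sc, v a := by
    rw [← nsmul_eq_mul]
    refine Finset.card_nsmul_le_sum _ _ _ fun a ha => ?_
    simp only [hSc, Finset.mem_filter, not_le] at ha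
    exact ha.2.le
  have hSτ : σ ≤ (S.card : ℝ) * τ := by
    rw [← nsmul_eq_mul]
    refine Finset.sum_le_card_nsmul _ _ _ fun a ha => ?_
    simp only [hS, Finset.mem_filter] at ha
    exact ha.2
  have hspU := hsplit v
  have hSbig : ((T : ℝ) + 1) * k ≤ S.card := by
    have h1 : (Sc.card : ℝ) * (T + 1) ≤ n * T := by
      have : ((Sc.card : ℝ) * (T + 1)) * τ ≤ (n * T) * τ := by nlinarith
      exact le_of_mul_le_mul_right this hτ
    have h2 : ((T : ℝ) + 1) ^ 2 * k ≤ n := by exact_mod_cast hkn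
    have h3 : (((T : ℝ) + 1) * k) * (T + 1) ≤ S.card * (T + 1) := by nlinarith
    exact le_of_mul_le_mul_right h3 (by positivity)
  have hkS : k ≤ S.card := by
    have : (k : ℝ) ≤ S.card := by nlinarith
    exact_mod_cast this
  -- local decodings
  have hz : ∀ a, ∃ z, H *ᵥ z = 0 ∧
      (a ∈ S → (hwt ((fun y => x (a, y)) - z) : ℝ) ≤ K * v a) := by
    intro a
    by_cases ha : a ∈ S
    · simp only [hS, Finset.mem_filter] at ha
      obtain ⟨z, h1, h2⟩ := ih _ ha.2
      exact ⟨z, h1, fun _ => h2⟩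
    · exact ⟨0, Matrix.mulVec_zero _, fun h => absurd h ha⟩
  choose z hz1 hz2 using hz
  obtain ⟨S0, hS0, hS0c⟩ := Finset.exists_subset_card_eq hkS
  choose w hw1 hw2 hw3 using fun b : S0 => hP.interp S0 hS0c b.1 b.2
  set f : A × X → F := fun p => ∑ b : S0, w b p.1 * z b.1 p.2 with hf
  have hfker : stepM P H *ᵥ f = 0 := interp_ker w hw1 (fun b : S0 => z b.1) (fun b => hz1 b.1)
  obtain ⟨hf1, hf2⟩ := (stepM_ker P H f).1 hfker
  -- the indicator of errors
  set e : A → X → ℝ := fun a y => if x (a, y) = z a y then 0 else 1 with he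
  have he0 : ∀ a y, 0 ≤ e a y := fun a y => by simp only [he]; split_ifs <;> norm_num
  have hesum : ∀ a, ∑ y, e a y = hwt ((fun y => x (a, y)) - z a) := by
    intro a
    rw [hwt_eq]; push_cast
    refine Finset.sum_congr rfl fun y _ => ?_
    simp [he, sub_eq_zero]
  have heS : ∑ a ∈ S, ∑ y, e a y ≤ K * σ := by
    rw [hσ, Finset.mul_sum]
    refine Finset.sum_le_sum fun a ha => ?_
    rw [hesum]; exact hz2 a ha
  have heqS : ∀ a ∈ S, ∀ y, f (a, y) = z a y := by
    intro a ha
    by_contra hcon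
    push Not at hcon
    obtain ⟨y0, hy0⟩ := hcon
    have hg := hD ((fun y => f (a, y)) - z a)
      (by rw [Matrix.mulVec_sub, hf2 a, hz1 a, sub_zero])
      (fun h => hy0 (sub_eq_zero.1 (congrFun h y0)))
    have hle : (hwt ((fun y => f (a, y)) - z a) : ℝ) ≤ ∑ y, (l y + ∑ b ∈ S, e b y) := by
      rw [hwt_eq]; push_cast
      refine Finset.sum_le_sum fun y _ => ?_
      have hs0 : 0 ≤ ∑ b ∈ S, e b y := Finset.sum_nonneg fun b _ => he0 b y
      split_ifs with hgy
      · exact add_nonneg (hl0 y) hs0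
      · by_cases hPy : P *ᵥ (fun a => x (a, y)) = 0
        · by_cases hall : ∀ b ∈ S, x (b, y) = z b y
          · exfalso
            apply hgy
            have := hP.uniq ((fun a => f (a, y)) - (fun a => x (a, y)))
              (by rw [Matrix.mulVec_sub, hf1 y, hPy, sub_zero]) S0 hS0c.ge (by
                intro b hb
                simp only [Pi.sub_apply, hf, sub_eq_zero]
                rw [Finset.sum_eq_single ⟨b, hb⟩]
                · rw [hw2 ⟨b, hb⟩, one_mul, hall b (hS0 hb)]
                · intro b' _ hb'
                  rw [hw3 b' b hb (fun h => hb' (Subtype.ext h.symm)), zero_mul]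
                · simp)
            have h2 := congrFun this a
            simp only [Pi.sub_apply, Pi.zero_apply] at h2 ⊢
            rw [← hall a ha]; exact h2
          · push Not at hall
            obtain ⟨b, hb, hxb⟩ := hall
            have h1 : e b y = 1 := by simp [he, hxb]
            have h2 := Finset.single_le_sum (f := fun b => e b y) (fun b _ => he0 b y) hb
            simp only [h1] at h2
            linarith [hl0 y]
        · linarith [hl1 y hPy]
    rw [Finset.sum_add_distrib, Finset.sum_comm] at hle
    have : K * σ ≤ K * U := by
      have : 0 ≤ ∑ a ∈ Sc, v a := Finset.sum_nonneg fun y _ => hv0 y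
      nlinarith
    nlinarith
  refine ⟨f, hfker, ?_⟩
  -- columns on which `x` is a codeword different from `f`
  set g : X → ℝ := fun y => if P *ᵥ (fun a => x (a, y)) = 0 ∧
    (fun a => x (a, y)) ≠ (fun a => f (a, y)) then 1 else 0 with hg
  have hg0 : ∀ y, 0 ≤ g y := fun y => by simp only [hg]; split_ifs <;> norm_num
  set E : A → X → ℝ := fun a y => if x (a, y) = f (a, y) then 0 else 1 with hE
  have hEe : ∀ a ∈ S, ∀ y, E a y = e a y := by
    intro a ha y; simp only [hE, he, heqS a ha y]
  have hEtot : (hwt (x - f) : ℝ) = ∑ a, ∑ y, E a y := by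
    rw [hwt_eq, Fintype.sum_prod_type]; push_cast
    refine Finset.sum_congr rfl fun a _ => Finset.sum_congr rfl fun y _ => ?_
    simp [hE, sub_eq_zero]
  have hES : ∑ a ∈ S, ∑ y, E a y ≤ K * σ := by
    refine le_trans (le_of_eq ?_) heS
    exact Finset.sum_congr rfl fun a ha => Finset.sum_congr rfl fun y _ => hEe a ha y
  have hgS : ∀ y, ((S.card : ℝ) - k) * g y ≤ ∑ a ∈ S, E a y := by
    intro y
    by_cases hc : P *ᵥ (fun a => x (a, y)) = 0 ∧ (fun a => x (a, y)) ≠ (fun a => f (a, y))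
    · simp only [hg, if_pos hc, mul_one]
      have hlt : (S.filter (fun a => x (a, y) = f (a, y))).card < k := by
        by_contra hge
        push Not at hge
        have := hP.uniq ((fun a => x (a, y)) - (fun a => f (a, y)))
          (by rw [Matrix.mulVec_sub, hf1 y, hc.1, sub_zero]) _ hge (by
            intro a ha
            simp only [Finset.mem_filter] at ha
            simp [ha.2])
        exact hc.2 (sub_eq_zero.1 this)
      have hsum : ∑ a ∈ S, E a y + (S.filter (fun a => x (a, y) = f (a, y))).card = S.card := by
        rw [Finset.card_filter]; push_cast
        rw [← Finset.sum_add_distrib, Finset.card_eq_sum_ones]; push_cast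
        exact Finset.sum_congr rfl fun a _ => by simp only [hE]; split_ifs <;> norm_num
      have : ((S.filter (fun a => x (a, y) = f (a, y))).card : ℝ) ≤ k := by exact_mod_cast hlt.le
      linarith
    · simp only [hg, if_neg hc, mul_zero]
      exact Finset.sum_nonneg fun a _ => by simp only [hE]; split_ifs <;> norm_num
  set G := ∑ y, g y with hG
  have hG0 : 0 ≤ G := Finset.sum_nonneg fun y _ => hg0 y
  have hGle : ((S.card : ℝ) - k) * G ≤ K * σ := by
    refine le_trans ?_ hES
    rw [Finset.sum_comm, hG, Finset.mul_sum]
    exact Finset.sum_le_sum fun y _ => hgS y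
  have hESc : ∑ a ∈ Sc, ∑ y, E a y ≤ Sc.card * (G + Vl) := by
    rw [← nsmul_eq_mul]
    refine Finset.sum_le_card_nsmul _ _ _ fun a _ => ?_
    rw [hG, hVl, ← Finset.sum_add_distrib]
    refine Finset.sum_le_sum fun y _ => ?_
    simp only [hE]
    split_ifs with hxy
    · exact add_nonneg (hg0 y) (hl0 y)
    · by_cases hPy : P *ᵥ (fun a => x (a, y)) = 0
      · have : g y = 1 := by
          simp only [hg]; rw [if_pos ⟨hPy, fun h => hxy (congrFun h a)⟩]
        linarith [hl0 y]
      · linarith [hl1 y hPy, hg0 y]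
  rw [hEtot, ← hsplit]
  have hσn : σ * n ≤ S.card * U := by
    have h1 : (Sc.card : ℝ) * σ ≤ S.card * (U - σ) := by
      have : (Sc.card : ℝ) * σ ≤ Sc.card * (S.card * τ) :=
        mul_le_mul_of_nonneg_left hSτ (Nat.cast_nonneg _)
      have h2 : (S.card : ℝ) * (Sc.card * τ) ≤ S.card * (U - σ) :=
        mul_le_mul_of_nonneg_left (by linarith) (Nat.cast_nonneg _)
      linarith
    rw [← hcardR]; linarith
  exact sound_arith hT1R hk1R hK1 hK hcardR (Nat.cast_nonneg _) (Nat.cast_nonneg _) hσ0 hVl0 hU0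
    hSbig hGle hσn hES hESc

end sound

lemma exists_mds {A F : Type} [Field F] [Fintype A] (α : A → F) (hα : Function.Injective α)
    (k : ℕ) (hk : 1 ≤ k) : ∃ P : Matrix A A F, IsMDS P k ∧
      ∀ w, P *ᵥ w = 0 ↔ ∃ p : Polynomial F, p.degree < k ∧ ∀ a, w a = p.eval (α a) := by
  classical
  let ev : Polynomial F →ₗ[F] (A → F) := LinearMap.pi fun a => Polynomial.leval (α a)
  let W : Submodule F (A → F) := (Polynomial.degreeLT F k).map ev
  obtain ⟨f, hf⟩ : ∃ f : (A → F) →ₗ[F] (A → F), LinearMap.ker f = W := by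
    obtain ⟨W', hW'⟩ := Submodule.exists_isCompl W
    exact ⟨_, Submodule.ker_projection hW'.symm⟩
  refine ⟨LinearMap.toMatrix' f, ?_⟩
  have key : ∀ w, LinearMap.toMatrix' f *ᵥ w = 0 ↔
      ∃ p : Polynomial F, p.degree < k ∧ ∀ a, w a = p.eval (α a) := by
    intro w
    rw [LinearMap.toMatrix'_mulVec, ← LinearMap.mem_ker, hf, Submodule.mem_map]
    constructor
    · rintro ⟨p, hp, rfl⟩
      exact ⟨p, Polynomial.mem_degreeLT.1 hp, fun a => rfl⟩
    · rintro ⟨p, hp, h⟩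
      exact ⟨p, Polynomial.mem_degreeLT.2 hp, funext fun a => (h a).symm⟩
  refine ⟨⟨?_, ?_⟩, key⟩
  · intro w hw S hS h0
    obtain ⟨p, hp, h⟩ := (key w).1 hw
    have : p = 0 := by
      refine Polynomial.eq_zero_of_degree_lt_of_eval_index_eq_zero S (v := α) hα.injOn
        (lt_of_lt_of_le hp (by exact_mod_cast hS)) ?_
      intro a ha
      rw [← h a, h0 a ha]
    funext a
    rw [h a, this]; simp
  · intro S hS b hb
    refine ⟨fun a => (Lagrange.basis S α b).eval (α a), (key _).2 ⟨_, ?_, fun a => rfl⟩, ?_, ?_⟩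
    · rw [Lagrange.degree_basis hα.injOn hb, hS]
      exact_mod_cast (by omega : k - 1 < k)
    · exact Lagrange.eval_basis_self hα.injOn hb
    · intro a ha hab
      exact Lagrange.eval_basis_of_ne hab.symm ha

lemma pow_half {n m t : ℕ} (hn : 1 ≤ n) (hm : m ≤ n) (h : 2 * t * m ≤ n) :
    (n : ℝ) ^ t / 2 ≤ (((n - m) ^ t : ℕ) : ℝ) := by
  have hnR : (0 : ℝ) < n := by exact_mod_cast hn
  have hmR : (m : ℝ) ≤ n := by exact_mod_cast hm
  have hR : 2 * (t : ℝ) * m ≤ n := by exact_mod_cast h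
  have hd : (m : ℝ) / n ≤ 1 := (div_le_one hnR).2 hmR
  have h1 := one_add_mul_le_pow (a := -((m : ℝ) / n)) (by linarith) t
  have h2 : (t : ℝ) * (m / n) ≤ 1 / 2 := by
    rw [← mul_div_assoc, div_le_iff₀ hnR]; linarith
  have h3 : (1 : ℝ) / 2 ≤ (1 + -((m : ℝ) / n)) ^ t := by linarith
  push_cast [Nat.cast_sub hm]
  have h4 : (n : ℝ) - m = n * (1 + -((m : ℝ) / n)) := by field_simp; ring
  rw [h4, mul_pow]
  have : (0 : ℝ) < (n : ℝ) ^ t := by positivity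
  nlinarith

lemma tower {A F : Type} [Field F] [Fintype A] {P P' : Matrix A A F} {k k' r T : ℕ}
    (hP : IsMDS P k) (hP' : IsMDS P' k') (hk : 1 ≤ k) (hT : 1 ≤ T)
    (hkn : (T + 1) ^ 2 * k ≤ Fintype.card A)
    (hmul : ∀ cf : Fin r → A → F, (∀ i, P *ᵥ cf i = 0) → P' *ᵥ (∏ i, cf i) = 0)
    (t : ℕ) (ht : t ≤ T) :
    ∃ (X R R' : Type) (_ : Fintype X) (_ : Fintype R) (_ : Fintype R')
      (H : Matrix R X F) (H' : Matrix R' X F),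
      Fintype.card X = Fintype.card A ^ t ∧
      (∀ i, Nat.card {j | H i j ≠ 0} ≤ Fintype.card A) ∧
      (∀ j, Nat.card {i | H i j ≠ 0} ≤ t * Fintype.card A) ∧
      (∀ i, Nat.card {j | H' i j ≠ 0} ≤ Fintype.card A) ∧
      (∀ j, Nat.card {i | H' i j ≠ 0} ≤ t * Fintype.card A) ∧
      k ^ t ≤ Module.finrank F (LinearMap.ker H.mulVecLin) ∧
      (∀ x, H *ᵥ x = 0 → x ≠ 0 → (Fintype.card A - k) ^ t ≤ hwt x) ∧
      (∀ x, H' *ᵥ x = 0 → x ≠ 0 → (Fintype.card A - k') ^ t ≤ hwt x) ∧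
      (∀ x, (hwt (H *ᵥ x) : ℝ) ≤
          (Fintype.card A : ℝ) ^ t / (4 * (Fintype.card A : ℝ) ^ 2 * (1 + 1 / T) ^ t) →
        ∃ z, H *ᵥ z = 0 ∧ (hwt (x - z) : ℝ) ≤
          (Fintype.card A * (1 + 1 / T) ^ t) * hwt (H *ᵥ x)) ∧
      (∀ cf : Fin r → X → F, (∀ i, H *ᵥ cf i = 0) → H' *ᵥ (∏ i, cf i) = 0) := by
  have hn1 : 1 ≤ Fintype.card A := le_trans (Nat.mul_pos (by positivity) hk) hkn
  have hn0 : (0 : ℝ) < Fintype.card A := by exact_mod_cast hn1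
  have hT0 : (0 : ℝ) < T := by exact_mod_cast hT
  have hk1 : k ≤ Fintype.card A :=
    le_trans (Nat.le_mul_of_pos_left _ (by positivity)) hkn
  induction t with
  | zero =>
    refine ⟨Unit, Empty, Empty, inferInstance, inferInstance, inferInstance, 0, 0, by simp,
      by simp, by simp, by simp, by simp, ?_, ?_, ?_, ?_, ?_⟩
    · have : LinearMap.ker (0 : Matrix Empty Unit F).mulVecLin = ⊤ := by
        rw [LinearMap.ker_eq_top]; ext; simp
      rw [this]; simp
    · intro x _ hx
      have := mt (hwt_eq_zero x).1 hx
      simp; omega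
    · intro x _ hx
      have := mt (hwt_eq_zero x).1 hx
      simp; omega
    · intro x _
      refine ⟨x, by funext i; exact i.elim, ?_⟩
      rw [sub_self, (hwt_eq_zero (0 : Unit → F)).2 rfl]
      simp only [Nat.cast_zero]
      positivity
    · intro cf _; funext i; exact i.elim
  | succ t ih =>
    obtain ⟨X, R, R', _, _, _, H, H', hX, hr, hc, hr', hc', hd, hD, hD', hs, hm⟩ := ih (by omega)
    refine ⟨A × X, (A × X) ⊕ (A × R), (A × X) ⊕ (A × R'), inferInstance, inferInstance,
      inferInstance, stepM P H, stepM P' H', ?_, stepM_row P H le_rfl hr, ?_,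
      stepM_row P' H' le_rfl hr', ?_, ?_, ?_, ?_, ?_, ?_⟩
    · rw [Fintype.card_prod, hX, pow_succ, mul_comm]
    · intro j; exact (stepM_col P H le_rfl hc j).trans (by rw [add_mul]; omega)
    · intro j; exact (stepM_col P' H' le_rfl hc' j).trans (by rw [add_mul]; omega)
    · rw [pow_succ, mul_comm]
      exact (Nat.mul_le_mul_left _ hd).trans (stepM_finrank H hP hk1)
    · rw [pow_succ, mul_comm]
      exact stepM_dist P H hP.dist hD
    · rw [pow_succ, mul_comm]
      exact stepM_dist P' H' hP'.dist hD'
    · have hpos : (0 : ℝ) < 1 + 1 / T := by positivity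
      have hge : (1 : ℝ) ≤ 1 + 1 / T := by
        have : (0 : ℝ) ≤ 1 / T := by positivity
        linarith
      have hhalf := pow_half (n := Fintype.card A) (m := k) (t := t) hn1 hk1
        (le_trans (Nat.mul_le_mul_right _ (by nlinarith)) hkn)
      have := stepM_sound (P := P) (H := H) hP T hT hk hkn
        (K := Fintype.card A * (1 + 1 / T) ^ t)
        (τ := (Fintype.card A : ℝ) ^ t / (4 * (Fintype.card A : ℝ) ^ 2 * (1 + 1 / T) ^ t))
        (τ' := (Fintype.card A : ℝ) ^ (t + 1) /
          (4 * (Fintype.card A : ℝ) ^ 2 * (1 + 1 / T) ^ (t + 1)))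
        (D := (((Fintype.card A - k) ^ t : ℕ) : ℝ))
        (le_mul_of_one_le_right hn0.le (one_le_pow₀ hge)) (by positivity)
        (le_of_eq (by
          set u : ℝ := 1 + 1 / T with hu
          have hT1 : (T : ℝ) + 1 = u * T := by rw [hu]; field_simp
          rw [hT1, pow_succ, pow_succ]
          field_simp
          ring))
        (fun x h1 h2 => by exact_mod_cast hD x h1 h2)
        (by
          refine lt_of_lt_of_le ?_ hhalf
          set u : ℝ := 1 + 1 / T with hu
          have e : (Fintype.card A : ℝ) * u ^ t * ((Fintype.card A : ℝ) ^ (t + 1) /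
            (4 * (Fintype.card A : ℝ) ^ 2 * u ^ (t + 1))) =
              (Fintype.card A : ℝ) ^ t / 4 / u := by
            rw [pow_succ, pow_succ]; field_simp; ring
          rw [e]
          have h1 : (Fintype.card A : ℝ) ^ t / 4 / u ≤ (Fintype.card A : ℝ) ^ t / 4 :=
            div_le_self (by positivity) hge
          have h2 : 0 < (Fintype.card A : ℝ) ^ t := by positivity
          linarith)
        hs
      intro x hx
      obtain ⟨z, h1, h2⟩ := this x hx
      refine ⟨z, h1, h2.trans (le_of_eq ?_)⟩
      rw [pow_succ]; ring
    · intro cf hcf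
      have := fun i => (stepM_ker P H (cf i)).1 (hcf i)
      rw [stepM_ker]
      constructor
      · intro y
        have h := hmul (fun i a => cf i (a, y)) (fun i => (this i).1 y)
        convert h using 2
        funext a; simp
      · intro a
        have h := hm (fun i y => cf i (a, y)) (fun i => (this i).2 a)
        convert h using 2
        funext a; simp

lemma hwt_comp {ι κ F : Type} [Zero F] (e : ι ≃ κ) (x : κ → F) : hwt (x ∘ e) = hwt x := by
  unfold hwt
  refine Nat.card_congr (e.subtypeEquiv ?_)
  intro a; rfl

lemma exists_root (j m b : ℕ) (hj : 1 ≤ j) (h : b ^ j ≤ m) :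
    ∃ s, b ≤ s ∧ s ^ j ≤ m ∧ m < (s + 1) ^ j := by
  have hex : ∃ s, m < (s + 1) ^ j :=
    ⟨m, lt_of_lt_of_le (Nat.lt_succ_self m) (Nat.le_self_pow (by omega) _)⟩
  classical
  refine ⟨Nat.find hex, ?_, ?_, Nat.find_spec hex⟩
  · by_contra hlt
    push Not at hlt
    have := Nat.find_spec hex
    have h2 : (Nat.find hex + 1) ^ j ≤ b ^ j := Nat.pow_le_pow_left hlt _
    omega
  · rcases Nat.eq_zero_or_pos (Nat.find hex) with h0 | h0
    · rw [h0, zero_pow (by omega)]; omega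
    · have := Nat.find_min hex (m := Nat.find hex - 1) (by omega)
      rw [Nat.sub_add_cancel h0] at this
      omega

lemma transport {X R R' F : Type} [Field F] [Fintype X] [Fintype R] [Fintype R']
    (H : Matrix R X F) (H' : Matrix R' X F) (N r : ℕ) (hN : Fintype.card X = N)
    (w B D : ℝ)
    (h1 : ∀ i, (Nat.card {j | H i j ≠ 0} : ℝ) ≤ w)
    (h2 : ∀ j, (Nat.card {i | H i j ≠ 0} : ℝ) ≤ w)
    (h1' : ∀ i, (Nat.card {j | H' i j ≠ 0} : ℝ) ≤ w)
    (h2' : ∀ j, (Nat.card {i | H' i j ≠ 0} : ℝ) ≤ w)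
    (hd : D ≤ Module.finrank F (LinearMap.ker H.mulVecLin))
    (h3 : ∀ x, H *ᵥ x = 0 → x ≠ 0 → B ≤ hwt x)
    (h3' : ∀ x, H' *ᵥ x = 0 → x ≠ 0 → B ≤ hwt x)
    (h4 : ∀ x, ∃ z, H *ᵥ z = 0 ∧ (hwt (x - z) : ℝ) / w ≤ hwt (H *ᵥ x))
    (hw : 0 < w)
    (h5 : ∀ cf : Fin r → X → F, (∀ i, H *ᵥ cf i = 0) → H' *ᵥ (∏ i, cf i) = 0) :
    ∃ (m m' : ℕ) (H : Matrix (Fin m) (Fin N) F) (H' : Matrix (Fin m') (Fin N) F),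
        locLE H w ∧ locLE H' w ∧
        D ≤ (Module.finrank F (LinearMap.ker H.mulVecLin) : ℝ) ∧
        (∀ x ∈ LinearMap.ker H.mulVecLin, x ≠ 0 → B ≤ (hwt x : ℝ)) ∧
        (∀ x ∈ LinearMap.ker H'.mulVecLin, x ≠ 0 → B ≤ (hwt x : ℝ)) ∧
        (∀ x : Fin N → F,
          ((sInf {d : ℕ | ∃ z ∈ LinearMap.ker H.mulVecLin, d = hwt (x - z)} : ℕ) : ℝ) /
              w ≤ (hwt (H.mulVec x) : ℝ)) ∧
        Submodule.span F {x : Fin N → F | ∃ cf : Fin r → (Fin N → F),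
            (∀ i, cf i ∈ LinearMap.ker H.mulVecLin) ∧ x = ∏ i, cf i} ≤
          LinearMap.ker H'.mulVecLin := by
  classical
  let eX : Fin N ≃ X := (Fintype.equivFinOfCardEq hN).symm
  let eR : Fin (Fintype.card R) ≃ R := (Fintype.equivFin R).symm
  let eR' : Fin (Fintype.card R') ≃ R' := (Fintype.equivFin R').symm
  have key : ∀ x : Fin N → F, H.submatrix eR eX *ᵥ x = (H *ᵥ (x ∘ eX.symm)) ∘ eR :=
    fun x => Matrix.submatrix_mulVec_equiv _ _ _ _
  have key' : ∀ x : Fin N → F, H'.submatrix eR' eX *ᵥ x = (H' *ᵥ (x ∘ eX.symm)) ∘ eR' :=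
    fun x => Matrix.submatrix_mulVec_equiv _ _ _ _
  have kk : ∀ x : Fin N → F, x ∈ LinearMap.ker (H.submatrix eR eX).mulVecLin ↔
      H *ᵥ (x ∘ eX.symm) = 0 := by
    intro x
    rw [LinearMap.mem_ker, Matrix.mulVecLin_apply, key]
    constructor
    · intro h; funext i; simpa using congrFun h (eR.symm i)
    · intro h; rw [h]; rfl
  have kk' : ∀ x : Fin N → F, x ∈ LinearMap.ker (H'.submatrix eR' eX).mulVecLin ↔
      H' *ᵥ (x ∘ eX.symm) = 0 := by
    intro x
    rw [LinearMap.mem_ker, Matrix.mulVecLin_apply, key']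
    constructor
    · intro h; funext i; simpa using congrFun h (eR'.symm i)
    · intro h; rw [h]; rfl
  have hne : ∀ x : Fin N → F, x ≠ 0 → x ∘ eX.symm ≠ 0 := by
    intro x hx h
    apply hx; funext i; simpa using congrFun h (eX i)
  have hrow : ∀ i, (Nat.card {j | H.submatrix eR eX i j ≠ 0} : ℝ) ≤ w := by
    intro i
    have := h1 (eR i)
    change (hwt (H (eR i)) : ℝ) ≤ w at this
    rw [← hwt_comp eX] at this
    exact this
  have hrow' : ∀ i, (Nat.card {j | H'.submatrix eR' eX i j ≠ 0} : ℝ) ≤ w := by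
    intro i
    have := h1' (eR' i)
    change (hwt (H' (eR' i)) : ℝ) ≤ w at this
    rw [← hwt_comp eX] at this
    exact this
  have hcol : ∀ j, (Nat.card {i | H.submatrix eR eX i j ≠ 0} : ℝ) ≤ w := by
    intro j
    have := h2 (eX j)
    change (hwt (fun i => H i (eX j)) : ℝ) ≤ w at this
    rw [← hwt_comp eR] at this
    exact this
  have hcol' : ∀ j, (Nat.card {i | H'.submatrix eR' eX i j ≠ 0} : ℝ) ≤ w := by
    intro j
    have := h2' (eX j)
    change (hwt (fun i => H' i (eX j)) : ℝ) ≤ w at this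
    rw [← hwt_comp eR'] at this
    exact this
  refine ⟨Fintype.card R, Fintype.card R', H.submatrix eR eX, H'.submatrix eR' eX,
    ⟨hrow, hcol⟩, ⟨hrow', hcol'⟩, ?_, ?_, ?_, ?_, ?_⟩
  · refine hd.trans ?_
    have hmem : ∀ z ∈ LinearMap.ker H.mulVecLin, LinearMap.funLeft F F eX z ∈
        LinearMap.ker (H.submatrix eR eX).mulVecLin := by
      intro z hz
      rw [kk]
      have : (LinearMap.funLeft F F eX z) ∘ eX.symm = z := by
        funext i; simp [LinearMap.funLeft]
      rw [this]
      exact hz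
    have := LinearMap.finrank_le_finrank_of_injective
      (f := (LinearMap.funLeft F F eX).restrict hmem) (by
        intro z z' h
        have h2 := congrArg Subtype.val h
        exact Subtype.ext (LinearMap.funLeft_injective_of_surjective F F eX eX.surjective h2))
    exact_mod_cast this
  · intro x hx hx0
    rw [← hwt_comp eX.symm x]
    exact h3 _ ((kk x).1 hx) (hne x hx0)
  · intro x hx hx0
    rw [← hwt_comp eX.symm x]
    exact h3' _ ((kk' x).1 hx) (hne x hx0)
  · intro x
    obtain ⟨z, hz, hle⟩ := h4 (x ∘ eX.symm)
    rw [key, hwt_comp]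
    refine le_trans (div_le_div_of_nonneg_right ?_ hw.le) hle
    have : sInf {d : ℕ | ∃ z ∈ LinearMap.ker (H.submatrix eR eX).mulVecLin, d = hwt (x - z)} ≤
        hwt (x ∘ eX.symm - z) := by
      refine Nat.sInf_le ⟨z ∘ eX, ?_, ?_⟩
      · rw [kk]
        have : (z ∘ eX) ∘ eX.symm = z := by funext i; simp
        rw [this, hz]
      · rw [← hwt_comp eX.symm (x - z ∘ eX)]
        congr 1
        funext i; simp
    exact_mod_cast this
  · rw [Submodule.span_le]
    rintro x ⟨cf, hcf, rfl⟩
    refine (kk' _).2 ?_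
    have := h5 (fun i => cf i ∘ eX.symm) (fun i => (kk _).1 (hcf i))
    convert this using 2
    funext i; simp

set_option maxHeartbeats 2000000 in
/-- classical LTCs with the multiplication property; Theorem 1.3 /
Corollary 7.2.  For every `ε > 0` and `r ≥ 1` there are a constant `c ≥ 1` and `q₀` such
that for every finite field `F` with `|F| ≥ q₀` there exist `N > |F|` and parity-check
matrices `H, H'` with `N` columns, of locality at most `(log N)^c`, such that the codes
`C = ker H` and `C' = ker H'` satisfy: `dim C ≥ N^{1-ε}`; every nonzero codeword of `C`
and of `C'` has Hamming weight at least `N/(log N)^c`; `C` is locally testable with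
soundness `(log N)^{-c}` (i.e. `|Hx| ≥ (log N)^{-c} · min_{z ∈ C} |x − z|` for all `x`);
and `C^{*r} ⊆ C'`, where `C^{*r}` is the span of all `r`-fold coordinatewise products of
codewords of `C`. -/
theorem stmt17 (ε : ℝ) (hε : 0 < ε) (r : ℕ) (hr : 1 ≤ r) :
    ∃ c : ℕ, 1 ≤ c ∧ ∃ q0 : ℕ,
      ∀ (F : Type) [Field F] [Fintype F], q0 ≤ Fintype.card F →
      ∃ N : ℕ, Fintype.card F < N ∧
      ∃ (m m' : ℕ) (H : Matrix (Fin m) (Fin N) F) (H' : Matrix (Fin m') (Fin N) F),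
        locLE H ((Real.log N) ^ c) ∧ locLE H' ((Real.log N) ^ c) ∧
        (N : ℝ) ^ ((1 : ℝ) - ε) ≤ (Module.finrank F (LinearMap.ker H.mulVecLin) : ℝ) ∧
        (∀ x ∈ LinearMap.ker H.mulVecLin, x ≠ 0 →
          (N : ℝ) / (Real.log N) ^ c ≤ (hwt x : ℝ)) ∧
        (∀ x ∈ LinearMap.ker H'.mulVecLin, x ≠ 0 →
          (N : ℝ) / (Real.log N) ^ c ≤ (hwt x : ℝ)) ∧
        (∀ x : Fin N → F,
          ((sInf {d : ℕ | ∃ z ∈ LinearMap.ker H.mulVecLin, d = hwt (x - z)} : ℕ) : ℝ) /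
              (Real.log N) ^ c ≤ (hwt (H.mulVec x) : ℝ)) ∧
        Submodule.span F {x : Fin N → F | ∃ cf : Fin r → (Fin N → F),
            (∀ i, cf i ∈ LinearMap.ker H.mulVecLin) ∧ x = ∏ i, cf i} ≤
          LinearMap.ker H'.mulVecLin := by
  classical
  obtain ⟨i, hi⟩ := exists_nat_ge (3 / ε)
  have hiε : 3 ≤ ((i : ℝ) + 3) * ε := by
    have := (div_le_iff₀ hε).1 hi
    nlinarith
  refine ⟨2 * i + 8, by omega, (r + 4) ^ (i + 3), ?_⟩
  intro F _ _ hF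
  obtain ⟨s, hs, hs1, hs2⟩ := exists_root (i + 3) (Fintype.card F) (r + 4) (by omega) hF
  have hs4 : 4 ≤ s := by omega
  have hsR : (4 : ℝ) ≤ s := by exact_mod_cast hs4
  have hs0 : (0 : ℝ) < s := by linarith
  set n := s ^ (i + 3) with hn
  set k := s ^ i with hk
  have hk1 : 1 ≤ k := Nat.one_le_pow _ _ (by omega)
  have hn1 : 1 ≤ n := Nat.one_le_pow _ _ (by omega)
  have hnk : n = k * s ^ 3 := by rw [hn, hk, pow_add]
  obtain ⟨α⟩ : Nonempty (Fin n ↪ F) :=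
    Function.Embedding.nonempty_of_card_le (by simpa using hs1)
  obtain ⟨P, hP, hPk⟩ := exists_mds α α.injective k hk1
  obtain ⟨P', hP', hPk'⟩ := exists_mds α α.injective (r * k) (Nat.mul_pos hr hk1)
  have hmul : ∀ cf : Fin r → Fin n → F, (∀ i, P *ᵥ cf i = 0) → P' *ᵥ (∏ i, cf i) = 0 := by
    intro cf hcf
    choose p hp1 hp2 using fun i => (hPk (cf i)).1 (hcf i)
    refine (hPk' _).2 ⟨∏ i, p i, ?_, ?_⟩
    · have hnat : ∀ i, (p i).natDegree ≤ k - 1 := by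
        intro i
        by_cases h0 : p i = 0
        · simp [h0]
        · have := (Polynomial.natDegree_lt_iff_degree_lt h0).2 (hp1 i)
          omega
      have h1 : (∏ i, p i).natDegree ≤ r * (k - 1) := by
        refine (Polynomial.natDegree_prod_le _ _).trans ?_
        refine (Finset.sum_le_card_nsmul _ _ (k - 1) fun i _ => hnat i).trans ?_
        simp
      refine lt_of_le_of_lt Polynomial.degree_le_natDegree ?_
      have : r * (k - 1) < r * k := Nat.mul_lt_mul_of_pos_left (by omega) hr
      exact_mod_cast lt_of_le_of_lt h1 this
    · intro a
      rw [Polynomial.eval_prod, Finset.prod_apply]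
      exact Finset.prod_congr rfl fun i _ => hp2 i a
  have hkn : (s + 1) ^ 2 * k ≤ Fintype.card (Fin n) := by
    rw [Fintype.card_fin, hnk, mul_comm]
    exact Nat.mul_le_mul_left _ (by nlinarith)
  obtain ⟨X, R, R', _, _, _, H, H', hX, hr1, hc1, hr1', hc1', hd, hD, hD', hsd, hm⟩ :=
    tower hP hP' hk1 (by omega : 1 ≤ s) hkn hmul s le_rfl
  simp only [Fintype.card_fin] at hX hr1 hc1 hr1' hc1' hD hD' hsd
  have hNs : n ^ s = s ^ ((i + 3) * s) := by rw [hn, ← pow_mul]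
  have hlog : (s : ℝ) ≤ Real.log ((n ^ s : ℕ) : ℝ) := by
    rw [hNs]; push_cast
    rw [Real.log_pow]; push_cast
    have h1 : 1 ≤ Real.log s := by
      rw [Real.le_log_iff_exp_le hs0]
      linarith [Real.exp_one_lt_d9]
    have h2 : (1 : ℝ) ≤ (i : ℝ) + 3 := by
      have : (0 : ℝ) ≤ i := Nat.cast_nonneg _
      linarith
    have h3 : (s : ℝ) ≤ ((i : ℝ) + 3) * s := le_mul_of_one_le_left hs0.le h2
    exact h3.trans (le_mul_of_one_le_right (by positivity) h1)
  set L := Real.log ((n ^ s : ℕ) : ℝ) with hL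
  have hLc : (s : ℝ) ^ (2 * i + 8) ≤ L ^ (2 * i + 8) := pow_le_pow_left₀ hs0.le hlog _
  have hLcN : ∀ m : ℕ, m ≤ s ^ (2 * i + 8) → (m : ℝ) ≤ L ^ (2 * i + 8) := by
    intro m hm
    refine le_trans ?_ hLc
    exact_mod_cast hm
  have hLpos : 0 < L ^ (2 * i + 8) := lt_of_lt_of_le (by positivity) hLc
  have hnle : n ≤ s ^ (2 * i + 8) := Nat.pow_le_pow_right (by omega) (by omega)
  have hsnle : s * n ≤ s ^ (2 * i + 8) := by
    rw [hn, ← pow_succ']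
    exact Nat.pow_le_pow_right (by omega) (by omega)
  have hn2le : 12 * n ^ 2 ≤ s ^ (2 * i + 8) := by
    have : s ^ (2 * i + 8) = s ^ 2 * n ^ 2 := by rw [hn, ← pow_mul, ← pow_add]; congr 1; ring
    rw [this]
    exact Nat.mul_le_mul_right _ (by nlinarith)
  have h2le : (2 : ℝ) ≤ L ^ (2 * i + 8) := by
    refine hLcN 2 (le_trans ?_ hn2le)
    nlinarith
  have hnR : (1 : ℝ) ≤ n := by exact_mod_cast hn1
  have hNhalf : ((n ^ s : ℕ) : ℝ) / L ^ (2 * i + 8) ≤ (n : ℝ) ^ s / 2 := by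
    push_cast
    exact div_le_div_of_nonneg_left (by positivity) (by norm_num) h2le
  refine ⟨n ^ s, ?_, ?_⟩
  · refine lt_of_lt_of_le hs2 ?_
    rw [hn, ← pow_mul, mul_comm, pow_mul]
    refine Nat.pow_le_pow_left ?_ _
    calc s + 1 ≤ s ^ 2 := by nlinarith
      _ ≤ s ^ s := Nat.pow_le_pow_right (by omega) (by omega)
  refine transport H H' (n ^ s) r hX (L ^ (2 * i + 8)) _ _
    (fun a => hLcN _ ((hr1 a).trans hnle)) (fun a => hLcN _ ((hc1 a).trans hsnle))
    (fun a => hLcN _ ((hr1' a).trans hnle)) (fun a => hLcN _ ((hc1' a).trans hsnle))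
    ?_ ?_ ?_ ?_ hLpos hm
  · have h1 : ((k ^ s : ℕ) : ℝ) ≤ Module.finrank F (LinearMap.ker H.mulVecLin) := by
      exact_mod_cast hd
    refine le_trans ?_ h1
    rw [hNs, hk, ← pow_mul]; push_cast
    rw [← Real.rpow_natCast, ← Real.rpow_natCast, ← Real.rpow_mul hs0.le]
    refine Real.rpow_le_rpow_of_exponent_le (by linarith) ?_
    push_cast
    nlinarith
  · intro x hx hx0
    refine hNhalf.trans ((pow_half (m := k) hn1 ?_ ?_).trans (by exact_mod_cast hD x hx hx0))
    · rw [hnk]; exact Nat.le_mul_of_pos_right _ (by positivity)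
    · rw [hnk, mul_comm]
      exact Nat.mul_le_mul_left _ (by nlinarith)
  · intro x hx hx0
    refine hNhalf.trans ((pow_half (m := r * k) hn1 ?_ ?_).trans (by exact_mod_cast hD' x hx hx0))
    · rw [hnk, mul_comm]; exact Nat.mul_le_mul_left _ (by nlinarith)
    · rw [hnk, ← mul_assoc, mul_comm]
      exact Nat.mul_le_mul_left _ (by nlinarith)
  · intro x
    set u : ℝ := (1 + 1 / (s : ℝ)) ^ s with hu
    have hu0 : 0 < u := by positivity
    have hu3 : u ≤ 3 := by
      have h1 : 1 + 1 / (s : ℝ) ≤ Real.exp (1 / s) := by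
        linarith [Real.add_one_le_exp (1 / (s : ℝ))]
      have h2 : u ≤ Real.exp (1 / s) ^ s := pow_le_pow_left₀ (by positivity) h1 _
      rw [← Real.exp_nat_mul, mul_one_div_cancel hs0.ne'] at h2
      linarith [Real.exp_one_lt_d9]
    have h12 : 12 * (n : ℝ) ^ 2 ≤ L ^ (2 * i + 8) := by
      have := hLcN _ hn2le
      push_cast at this
      exact this
    have hV0 : (0 : ℝ) ≤ hwt (H *ᵥ x) := Nat.cast_nonneg _
    by_cases hV : (hwt (H *ᵥ x) : ℝ) ≤ (n : ℝ) ^ s / (4 * (n : ℝ) ^ 2 * u)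
    · obtain ⟨z, hz, hle⟩ := hsd x hV
      refine ⟨z, hz, ?_⟩
      rw [div_le_iff₀ hLpos, mul_comm]
      refine hle.trans (mul_le_mul_of_nonneg_right ?_ hV0)
      have : (n : ℝ) * u ≤ n * 3 := mul_le_mul_of_nonneg_left hu3 (by linarith)
      have h6 : (n : ℝ) ≤ (n : ℝ) ^ 2 := le_self_pow₀ hnR (by norm_num)
      linarith
    · push Not at hV
      refine ⟨0, Matrix.mulVec_zero _, ?_⟩
      rw [div_le_iff₀ hLpos, mul_comm]
      have h1 : (hwt (x - 0) : ℝ) ≤ (n : ℝ) ^ s := by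
        have := hwt_le_card (x - 0)
        rw [hX] at this
        exact_mod_cast this
      rw [div_lt_iff₀ (by positivity)] at hV
      refine h1.trans (hV.le.trans ?_)
      rw [mul_comm]
      refine mul_le_mul_of_nonneg_right ?_ hV0
      have : (n : ℝ) ^ 2 * u ≤ (n : ℝ) ^ 2 * 3 := mul_le_mul_of_nonneg_left hu3 (by positivity)
      linarith
end
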